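/- arXiv:1703.06722 — 3 statements merged into one kernel-verified Lean document; each statement's English description precedes it below -/
import Mathlib

section
/- Let A and B be nonzero integers such that the Lucas sequence of the second kind v corresponding to (A,B) is non-degenerate, and assume that (A,B) is none of the pairs (1,1), (-1,1), (-1,2), (-1,-2). Then the set of triples (k,l,m) of nonnegative integers such that v_k < v_l < v_m and v_k + v_m = 2·v_l is finite, and its cardinality is at most 645·10^2338 (i.e., 6.45·10^2340). -/
/-- Lucas sequence of the second kind for parameters `A`, `B`:
`v 0 = 2`, `v 1 = A`, `v (n+2) = A * v (n+1) + B * v n`. -/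
def lucasV (A B : ℤ) : ℕ → ℤ
  | 0 => 2
  | 1 => A
  | n + 2 => A * lucasV A B (n + 1) + B * lucasV A B n

/-- A determinant whose rows are, up to an error of size `ε`, values of polynomials of degree
less than `T` in one variable is small. -/
theorem norm_det_le_of_near_polynomial {ι : Type*} [Fintype ι] [DecidableEq ι]
    (P E : Matrix ι ι ℂ) (z : ι → ℂ) (T : ℕ) (c : ι → ℕ → ℂ)
    (hP : ∀ i j, P i j = ∑ n ∈ Finset.range T, c i n * z j ^ n)
    (p ε : ℝ) (hp : 1 ≤ p) (hε0 : 0 ≤ ε) (hε : ε ≤ 1)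
    (hPle : ∀ i j, ‖P i j‖ ≤ p) (hEle : ∀ i j, ‖E i j‖ ≤ ε) :
    ‖(P + E).det‖ ≤ 2 ^ Fintype.card ι * ((Fintype.card ι).factorial *
      (p ^ Fintype.card ι * ε ^ (Fintype.card ι - T))) := by
  classical
  let m : Finset ι → Matrix ι ι ℂ := fun s => Matrix.of fun i j => if i ∈ s then P i j else E i j
  have hexp : (P + E).det = ∑ s : Finset ι, (m s).det := by
    refine ((Matrix.detRowAlternating (n := ι) (R := ℂ)).toMultilinearMap.map_add_univ P E).trans ?_
    refine Finset.sum_congr rfl fun s _ => congrArg Matrix.det ?_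
    ext i j
    by_cases hi : i ∈ s <;> simp [m, Finset.piecewise, hi]
  have hbound : ∀ s : Finset ι, ‖(m s).det‖ ≤
      (Fintype.card ι).factorial * (p ^ Fintype.card ι * ε ^ (Fintype.card ι - T)) := by
    intro s
    by_cases hs : T < s.card
    · have h0 : (m s).det = 0 := by
        refine (Matrix.detRowAlternating (n := ι) (R := ℂ)).map_linearDependent _ fun hli => ?_
        have hli' := hli.comp (Subtype.val : s → ι) Subtype.val_injective
        have := linearIndependent_le_span' _ hli'
          (((Finset.range T).image fun n j => z j ^ n : Finset (ι → ℂ)) : Set (ι → ℂ)) (by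
            rintro _ ⟨⟨i, hi⟩, rfl⟩
            have : (m s) i = ∑ n ∈ Finset.range T, c i n • fun j => z j ^ n := by
              ext j
              simp [m, hi, hP]
            simp only [Function.comp]
            rw [this]
            refine Submodule.sum_mem _ fun n hn => Submodule.smul_mem _ _ (Submodule.subset_span ?_)
            exact Finset.mem_coe.2 (Finset.mem_image_of_mem _ hn))
        have h1 : s.card ≤ ((Finset.range T).image fun n j => z j ^ n : Finset (ι → ℂ)).card := by
          simpa only [Cardinal.mk_coe_finset, Nat.cast_le, Finset.coe_sort_coe, Fintype.card_coe] using this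
        have h2 := h1.trans Finset.card_image_le
        rw [Finset.card_range] at h2
        omega
      rw [h0, norm_zero]
      positivity
    · push Not at hs
      rw [Matrix.det_apply]
      refine (norm_sum_le _ _).trans ?_
      have : ∀ σ ∈ (Finset.univ : Finset (Equiv.Perm ι)),
          ‖Equiv.Perm.sign σ • ∏ i, (m s) (σ i) i‖ ≤
            p ^ Fintype.card ι * ε ^ (Fintype.card ι - T) := by
        intro σ _
        have hsg : ‖Equiv.Perm.sign σ • ∏ i, (m s) (σ i) i‖ =
            ∏ i, ‖(m s) i (σ.symm i)‖ := by
          rw [← Equiv.prod_comp σ (fun i => ‖(m s) i (σ.symm i)‖)]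
          rcases Int.units_eq_one_or (Equiv.Perm.sign σ) with h | h <;> simp [h, Units.smul_def]
        rw [hsg]
        have h1 : ∏ i, ‖(m s) i (σ.symm i)‖ ≤
            ∏ i, s.piecewise (fun _ => p) (fun _ => ε) i := by
          refine Finset.prod_le_prod (fun _ _ => norm_nonneg _) fun i _ => ?_
          by_cases hi : i ∈ s
          · simpa [m, Finset.piecewise, hi] using hPle i _
          · simpa [m, Finset.piecewise, hi] using hEle i _
        refine h1.trans ?_
        rw [Finset.prod_piecewise]
        simp only [Finset.univ_inter, Finset.prod_const]
        rw [← Finset.compl_eq_univ_sdiff, Finset.card_compl]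
        gcongr ?_ * ?_
        · exact pow_le_pow_right₀ hp (Finset.card_le_univ s)
        · exact pow_le_pow_of_le_one hε0 hε (by omega)
      refine (Finset.sum_le_card_nsmul _ _ _ this).trans ?_
      rw [Finset.card_univ, Fintype.card_perm, nsmul_eq_mul]
  rw [hexp]
  refine (norm_sum_le _ _).trans ((Finset.sum_le_card_nsmul _ _ _ fun s _ => hbound s).trans ?_)
  rw [Finset.card_univ, Fintype.card_finset, nsmul_eq_mul]
  push_cast
  rfl

/-- Linearly independent rows have a nonzero maximal minor. -/
theorem exists_minor_det_ne_zero {ι κ : Type*} [Fintype ι] [DecidableEq ι]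
    (f : ι → κ → ℂ) (h : ∀ g : ι → ℂ, (∀ k, ∑ i, g i * f i k = 0) → g = 0) :
    ∃ c : ι → κ, (Matrix.of fun i j => f i (c j)).det ≠ 0 := by
  classical
  obtain ⟨τ, a, -, hspan, hli⟩ := exists_linearIndependent' ℂ (fun k i => f i k)
  have htop : Submodule.span ℂ (Set.range fun k i => f i k) = ⊤ := by
    by_contra hne
    obtain ⟨φ, hφ, hle⟩ := Submodule.exists_le_ker_of_lt_top _ (lt_top_iff_ne_top.2 hne)
    apply hφ
    have hz := h (fun i => φ (Pi.single i 1)) (fun k => by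
      have : φ (fun i => f i k) = 0 := hle (Submodule.subset_span ⟨k, rfl⟩)
      rw [← this, LinearMap.pi_apply_eq_sum_univ φ]
      refine Finset.sum_congr rfl fun i _ => ?_
      rw [smul_eq_mul, mul_comm]
      congr 2
      ext j
      simp [Pi.single_apply, eq_comm])
    refine LinearMap.pi_ext' fun i => LinearMap.ext_ring ?_
    simpa using congrFun hz i
  let b := Module.Basis.mk hli (by rw [hspan, htop])
  let e : ι ≃ τ := (Pi.basisFun ℂ ι).indexEquiv b
  refine ⟨a ∘ e, fun hdet => ?_⟩
  obtain ⟨v, hv, hMv⟩ := Matrix.exists_mulVec_eq_zero_iff.2 hdet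
  apply hv
  have := (Fintype.linearIndependent_iff.1 (hli.comp e e.injective)) v (by
    ext i
    have := congrFun hMv i
    simpa [Matrix.mulVec, dotProduct, mul_comm] using this)
  exact funext this

open Polynomial in
theorem coeff_det_of_natDegree_le {R : Type*} [CommRing R] {n : Type*} [Fintype n] [DecidableEq n]
    (M : Matrix n n R[X]) (d : ℕ) (h : ∀ i j, (M i j).natDegree ≤ d) :
    M.det.natDegree ≤ Fintype.card n * d ∧
      M.det.coeff (Fintype.card n * d) = (Matrix.of fun i j => (M i j).coeff d).det := by
  constructor
  · rw [Matrix.det_apply]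
    refine natDegree_sum_le_of_forall_le _ _ fun σ _ => ?_
    refine (natDegree_smul_le _ _).trans ((natDegree_prod_le _ _).trans ?_)
    refine (Finset.sum_le_card_nsmul _ _ d fun i _ => h _ _).trans ?_
    simp
  · rw [Matrix.det_apply, Matrix.det_apply, finsetSum_coeff]
    refine Finset.sum_congr rfl fun σ _ => ?_
    rw [coeff_smul, ← Finset.card_univ,
      coeff_prod_of_natDegree_le _ (fun i => M (σ i) i) d fun i _ => h _ _]
    rfl

open Polynomial in
/-- A polynomial of bidegree less than `(I, J)` vanishing at the points
`(s + q * t, ω ^ s * ζ ^ t)` for sufficiently many `s`, `t` is zero. -/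
theorem zero_estimate {I J S R q : ℕ} (ω ζ : ℂ) (hω : ω ≠ 0) (hζ : ζ ≠ 0)
    (hinj : ∀ i j, i < J → j < J → ω ^ i = ω ^ j → i = j) (hS : S ≤ q)
    (hSR : I * J < (S - J) * R) (g : Fin I × Fin J → ℂ)
    (h : ∀ s < S, ∀ t < R,
      ∑ i, ∑ j, g (i, j) * (((s + q * t : ℕ) : ℂ) ^ (i : ℕ) * (ω ^ s * ζ ^ t) ^ (j : ℕ)) = 0) :
    g = 0 := by
  classical
  let p : Fin J → ℂ[X] := fun j => ∑ i : Fin I, C (g (i, j)) * X ^ (i : ℕ)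
  have hpdeg : ∀ j, (p j).natDegree ≤ I := fun j =>
    natDegree_sum_le_of_forall_le _ _ fun i _ => (natDegree_C_mul_X_pow_le _ _).trans i.2.le
  have hpcoeff : ∀ (i : Fin I) (j : Fin J), (p j).coeff (i : ℕ) = g (i, j) := by
    intro i j
    simp [p, finsetSum_coeff, coeff_C_mul, coeff_X_pow, Fin.val_inj]
  by_contra hg
  let s0 : Finset (Fin J) := Finset.univ.filter fun j => p j ≠ 0
  have hs0 : s0.Nonempty := by
    obtain ⟨⟨i, j⟩, hij⟩ := Function.ne_iff.1 hg
    refine ⟨j, Finset.mem_filter.2 ⟨Finset.mem_univ _, fun h0 => hij ?_⟩⟩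
    rw [← hpcoeff, h0]
    rfl
  set m := s0.card with hm
  let e : Fin m ↪o Fin J := s0.orderEmbOfFin rfl
  have he : ∀ k, p (e k) ≠ 0 := fun k => by
    have := s0.orderEmbOfFin_mem rfl k
    exact (Finset.mem_filter.1 this).2
  have hmJ : m ≤ J := by simpa using Finset.card_le_univ s0
  have hm0 : 0 < m := hs0.card_pos
  let M : Matrix (Fin m) (Fin m) ℂ[X] := Matrix.of fun i k =>
    (C (ω ^ ((i : ℕ) * (e k : ℕ))) * taylor ((i : ℕ) : ℂ) (p (e k))) *
      (X + 1) ^ (I - (p (e k)).natDegree)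
  have hd1 : ∀ i k : Fin m, (C (ω ^ ((i : ℕ) * (e k : ℕ))) *
      taylor ((i : ℕ) : ℂ) (p (e k))).natDegree ≤ (p (e k)).natDegree := fun i k =>
    (natDegree_C_mul_le _ _).trans (natDegree_taylor _ _).le
  have hd2 : ∀ k : Fin m, ((X + 1 : ℂ[X]) ^ (I - (p (e k)).natDegree)).natDegree ≤
      I - (p (e k)).natDegree := fun k => by
    have h1 : (X + 1 : ℂ[X]).natDegree = 1 := by simpa using natDegree_X_add_C (1 : ℂ)
    exact natDegree_pow_le.trans (by rw [h1, mul_one])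
  have hadd : ∀ k : Fin m, (p (e k)).natDegree + (I - (p (e k)).natDegree) = I := fun k =>
    Nat.add_sub_cancel' (hpdeg _)
  have hMdeg : ∀ i k, (M i k).natDegree ≤ I := fun i k => by
    refine natDegree_mul_le.trans ?_
    rw [← hadd k]
    exact Nat.add_le_add (hd1 i k) (by rw [hadd k]; exact hd2 k)
  have hMcoeff : ∀ i k, (M i k).coeff I =
      (p (e k)).leadingCoeff * (ω ^ (e k : ℕ)) ^ (i : ℕ) := fun i k => by
    have h1 := coeff_mul_add_eq_of_natDegree_le (hd1 i k) (hd2 k)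
    rw [hadd k] at h1
    refine h1.trans ?_
    have h2 : (X + 1 : ℂ[X]).Monic := by simpa using monic_X_add_C (1 : ℂ)
    have h3 : (X + 1 : ℂ[X]).natDegree = 1 := by simpa using natDegree_X_add_C (1 : ℂ)
    have h4 := (h2.pow (I - (p (e k)).natDegree)).coeff_natDegree
    rw [natDegree_pow, h3, mul_one] at h4
    rw [h4, coeff_C_mul, coeff_taylor_natDegree, ← pow_mul]
    ring
  obtain ⟨hWdeg, hWcoeff⟩ := coeff_det_of_natDegree_le M I hMdeg
  have hW : M.det ≠ 0 := by
    intro h0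
    rw [h0, coeff_zero] at hWcoeff
    have h1 : (Matrix.of fun i j => (M i j).coeff I) =
        Matrix.of fun i k => (p (e k)).leadingCoeff *
          (Matrix.vandermonde fun k => ω ^ (e k : ℕ)).transpose i k := by
      ext i k
      simp [hMcoeff, Matrix.vandermonde]
    rw [h1, Matrix.det_mul_row, Matrix.det_transpose] at hWcoeff
    refine mul_ne_zero (Finset.prod_ne_zero_iff.2 fun k _ => leadingCoeff_ne_zero.2 (he k))
      (Matrix.det_vandermonde_ne_zero_iff.2 fun k k' hk => ?_) hWcoeff.symm
    exact e.injective (Fin.ext (hinj _ _ (e k).2 (e k').2 hk))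
  have heval : ∀ s < S - J, ∀ t < R, M.det.eval ((s + q * t : ℕ) : ℂ) = 0 := by
    intro s hs t ht
    set x : ℂ := ((s + q * t : ℕ) : ℂ) with hx
    set y : ℂ := ω ^ s * ζ ^ t with hy
    have hx1 : x + 1 ≠ 0 := by
      rw [hx]
      exact Nat.cast_add_one_ne_zero _
    rw [← coe_evalRingHom, RingHom.map_det]
    apply Matrix.exists_mulVec_eq_zero_iff.1
    refine ⟨fun k => y ^ (e k : ℕ) / (x + 1) ^ (I - (p (e k)).natDegree), fun h0 => ?_, ?_⟩
    · have := congrFun h0 ⟨0, hm0⟩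
      have hy0 : y ≠ 0 := mul_ne_zero (pow_ne_zero _ hω) (pow_ne_zero _ hζ)
      exact div_ne_zero (pow_ne_zero _ hy0) (pow_ne_zero _ hx1) this
    · ext i
      have hi := h (s + i) (by omega) t ht
      rw [Finset.sum_comm] at hi
      have hterm : ∀ j : Fin J, ∑ i' : Fin I, g (i', j) *
          (((s + i + q * t : ℕ) : ℂ) ^ (i' : ℕ) * (ω ^ (s + i) * ζ ^ t) ^ (j : ℕ)) =
          (p j).eval (x + i) * (ω ^ ((i : ℕ) * (j : ℕ)) * y ^ (j : ℕ)) := by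
        intro j
        simp only [p, eval_finsetSum, eval_mul, eval_C, eval_pow, eval_X, Finset.sum_mul]
        refine Finset.sum_congr rfl fun i' _ => ?_
        have : ((s + i + q * t : ℕ) : ℂ) = x + i := by rw [hx]; push_cast; ring
        rw [this, hy, pow_add, pow_mul]
        ring
      simp only [hterm] at hi
      have hsub : ∑ j ∈ s0, (p j).eval (x + i) * (ω ^ ((i : ℕ) * (j : ℕ)) * y ^ (j : ℕ)) = 0 := by
        rw [← hi]
        refine Finset.sum_subset (Finset.subset_univ _) fun j _ hj => ?_
        have : p j = 0 := by simpa [s0] using hj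
        simp [this]
      have himg : s0 = Finset.univ.image e := by
        have := s0.image_orderEmbOfFin_univ rfl
        exact this.symm
      rw [himg, Finset.sum_image fun a _ b _ hab => e.injective hab] at hsub
      simp only [Matrix.mulVec, dotProduct, Pi.zero_apply]
      rw [← hsub]
      refine Finset.sum_congr rfl fun k _ => ?_
      simp only [M, RingHom.mapMatrix_apply, Matrix.map_apply, Matrix.of_apply, coe_evalRingHom,
        eval_mul, eval_C, eval_pow, eval_add, eval_X, eval_one, taylor_eval]
      field_simp
  have hcard : ((Finset.range (S - J) ×ˢ Finset.range R).image
      fun st : ℕ × ℕ => ((st.1 + q * st.2 : ℕ) : ℂ)).card = (S - J) * R := by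
    rw [Finset.card_image_of_injOn, Finset.card_product, Finset.card_range, Finset.card_range]
    rintro ⟨s, t⟩ hst ⟨s', t'⟩ hst' heq
    simp only [Finset.coe_product, Finset.coe_range, Set.mem_prod, Set.mem_Iio] at hst hst'
    have h1 : s + q * t = s' + q * t' := by
      simpa only [Nat.cast_inj] using heq
    have hsq : s < q := by omega
    have hsq' : s' < q := by omega
    have h2 : s = s' := by
      have := congrArg (· % q) h1
      simpa [Nat.mod_eq_of_lt hsq, Nat.mod_eq_of_lt hsq'] using this
    subst h2
    have h3 : t = t' := by
      have : q * t = q * t' := by omega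
      exact Nat.eq_of_mul_eq_mul_left (by omega) this
    rw [h3]
  refine hW (eq_zero_of_natDegree_lt_card_of_eval_eq_zero' _
    ((Finset.range (S - J) ×ˢ Finset.range R).image
      fun st : ℕ × ℕ => ((st.1 + q * st.2 : ℕ) : ℂ)) ?_ ?_)
  · intro z hz
    obtain ⟨⟨s, t⟩, hst, rfl⟩ := Finset.mem_image.1 hz
    simp only [Finset.mem_product, Finset.mem_range] at hst
    exact heval s hst.1 t hst.2
  · rw [hcard]
    refine hWdeg.trans_lt (lt_of_le_of_lt ?_ hSR)
    rw [Fintype.card_fin, mul_comm]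
    exact Nat.mul_le_mul_left _ hmJ

theorem pow_div_factorial_le_half_pow {y : ℝ} {n : ℕ} (hy : 0 ≤ y) (h : 6 * y ≤ n) :
    y ^ n / n.factorial ≤ (1 / 2) ^ n := by
  have h1 : (n : ℝ) ^ n / n.factorial ≤ 3 ^ n := by
    refine (Real.pow_div_factorial_le_exp n (Nat.cast_nonneg n) n).trans ?_
    have h2 : Real.exp (n : ℝ) = Real.exp 1 ^ n := by rw [← Real.exp_nat_mul, mul_one]
    rw [h2]
    exact pow_le_pow_left₀ (Real.exp_pos 1).le (by linarith [Real.exp_one_lt_d9]) n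
  calc y ^ n / n.factorial ≤ (n / 6) ^ n / n.factorial := by gcongr; linarith
    _ = (1 / 6) ^ n * ((n : ℝ) ^ n / n.factorial) := by rw [div_pow, div_pow, one_pow]; ring
    _ ≤ (1 / 6) ^ n * 3 ^ n := by gcongr
    _ = (1 / 2) ^ n := by rw [← mul_pow]; norm_num

theorem norm_pow_sub_pow_le_of_norm_eq_one {a b : ℂ} (ha : ‖a‖ = 1) (hb : ‖b‖ = 1) (n : ℕ) :
    ‖a ^ n - b ^ n‖ ≤ n * ‖a - b‖ := by
  induction n with
  | zero => simp
  | succ n ih =>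
    have : a ^ (n + 1) - b ^ (n + 1) = a ^ n * (a - b) + (a ^ n - b ^ n) * b := by ring
    rw [this]
    refine (norm_add_le _ _).trans ?_
    rw [norm_mul, norm_mul, norm_pow, ha, hb, one_pow]
    push_cast
    linarith

open Polynomial in
/-- The interpolation determinant argument for two numbers `ω = a₁ / b₁` and `ζ = a₂ / b₂` of
absolute value one with `ω ^ q` close to `ζ`. -/
theorem interpolation_determinant (O : Subring ℂ) (hO : ∀ z ∈ O, z ≠ 0 → 1 ≤ ‖z‖)
    {a₁ b₁ a₂ b₂ : ℂ} (ha₁ : a₁ ∈ O) (hb₁ : b₁ ∈ O) (ha₂ : a₂ ∈ O) (hb₂ : b₂ ∈ O)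
    (hb₁0 : b₁ ≠ 0) (hb₂0 : b₂ ≠ 0)
    {θ : ℝ} {ω ζ : ℂ} (hω : ω = a₁ / b₁) (hζ : ζ = a₂ / b₂) (hωθ : ω = Complex.exp (θ * Complex.I))
    (hζ1 : ‖ζ‖ = 1) {I J S R q T W : ℕ} (hI : 0 < I) (hJ : 0 < J) (hR : 0 < R) (hS0 : 0 < S)
    (hinj : ∀ i j, i < J → j < J → ω ^ i = ω ^ j → i = j) (hS : S ≤ q)
    (hSR : I * J < (S - J) * R) (hT : 2 * (I + T) ≤ I * J)
    (hW : ‖b₁‖ ^ S * ‖b₂‖ ^ R ≤ 2 ^ W) (hθ : 6 * (|θ| * J * (S + q * R)) ≤ T)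
    (hclose : ‖ω ^ q - ζ‖ * (J * R) * 2 ^ T ≤ 1)
    (hfin : 48 * (I * J : ℝ) ^ 2 * (S + q * R) ^ (3 * I) * 2 ^ (2 * W * J) < 2 ^ T) : False := by
  classical
  have hω1 : ‖ω‖ = 1 := by rw [hωθ, Complex.norm_exp_ofReal_mul_I]
  have hω0 : ω ≠ 0 := norm_ne_zero_iff.1 (by rw [hω1]; exact one_ne_zero)
  have hζ0 : ζ ≠ 0 := norm_ne_zero_iff.1 (by rw [hζ1]; exact one_ne_zero)
  let ι := Fin I × Fin J
  let κ := Fin S × Fin R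
  let x : κ → ℕ := fun k => k.1 + q * k.2
  let y : κ → ℂ := fun k => ω ^ (k.1 : ℕ) * ζ ^ (k.2 : ℕ)
  set B : ℝ := S + q * R with hB
  have hB1 : 1 ≤ B := by
    have : (1 : ℝ) ≤ S := by exact_mod_cast hS0
    have h2 : (0 : ℝ) ≤ q * R := by positivity
    linarith
  have hxB : ∀ k, (x k : ℝ) ≤ B := by
    intro k
    have h1 : x k ≤ S + q * R := Nat.add_le_add k.1.2.le (Nat.mul_le_mul_left _ k.2.2.le)
    rw [hB]
    exact_mod_cast h1
  have hy1 : ∀ k, ‖y k‖ = 1 := fun k => by simp [y, hω1, hζ1]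
  obtain ⟨c, hc⟩ := exists_minor_det_ne_zero
    (fun (i : ι) (k : κ) => ((x k : ℕ) : ℂ) ^ (i.1 : ℕ) * y k ^ (i.2 : ℕ)) (by
      intro g hg
      refine zero_estimate ω ζ hω0 hζ0 hinj hS hSR g fun s hs t ht => ?_
      rw [← hg (⟨s, hs⟩, ⟨t, ht⟩), Fintype.sum_prod_type])
  set F : Matrix ι ι ℂ :=
    Matrix.of fun i j => ((x (c j) : ℕ) : ℂ) ^ (i.1 : ℕ) * y (c j) ^ (i.2 : ℕ) with hF
  set L := Fintype.card ι with hL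
  have hLIJ : L = I * J := by simp [hL, ι]
  have hL0 : 0 < L := by rw [hLIJ]; positivity
  -- arithmetic lower bound
  have hlow : 1 ≤ ‖F.det‖ * (2 ^ (W * J)) ^ L := by
    let G : ι → ℂ := fun j => (b₁ ^ ((c j).1 : ℕ) * b₂ ^ ((c j).2 : ℕ)) ^ J
    let F' : Matrix ι ι ℂ := Matrix.of fun i j => G j * F i j
    have hG0 : ∀ j, G j ≠ 0 := fun j =>
      pow_ne_zero _ (mul_ne_zero (pow_ne_zero _ hb₁0) (pow_ne_zero _ hb₂0))
    have hF'det : F'.det = (∏ j, G j) * F.det := Matrix.det_mul_row G F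
    have hF'mem : ∀ i j, F' i j ∈ O := by
      intro i j
      have : F' i j = ((x (c j) : ℕ) : ℂ) ^ (i.1 : ℕ) *
          ((a₁ ^ ((c j).1 : ℕ) * a₂ ^ ((c j).2 : ℕ)) ^ (i.2 : ℕ) *
            (b₁ ^ ((c j).1 : ℕ) * b₂ ^ ((c j).2 : ℕ)) ^ (J - (i.2 : ℕ))) := by
        have hsplit : (b₁ ^ ((c j).1 : ℕ) * b₂ ^ ((c j).2 : ℕ)) ^ J =
            (b₁ ^ ((c j).1 : ℕ) * b₂ ^ ((c j).2 : ℕ)) ^ (i.2 : ℕ) *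
              (b₁ ^ ((c j).1 : ℕ) * b₂ ^ ((c j).2 : ℕ)) ^ (J - (i.2 : ℕ)) := by
          rw [← pow_add, Nat.add_sub_of_le i.2.2.le]
        simp only [F', G, F, Matrix.of_apply, y, hω, hζ]
        rw [hsplit]
        have h1 : (a₁ / b₁) ^ ((c j).1 : ℕ) * (a₂ / b₂) ^ ((c j).2 : ℕ) =
            (a₁ ^ ((c j).1 : ℕ) * a₂ ^ ((c j).2 : ℕ)) /
              (b₁ ^ ((c j).1 : ℕ) * b₂ ^ ((c j).2 : ℕ)) := by
          rw [div_pow, div_pow, div_mul_div_comm]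
        have h2 : b₁ ^ ((c j).1 : ℕ) * b₂ ^ ((c j).2 : ℕ) ≠ 0 :=
          mul_ne_zero (pow_ne_zero _ hb₁0) (pow_ne_zero _ hb₂0)
        rw [h1, div_pow]
        generalize b₁ ^ ((c j).1 : ℕ) * b₂ ^ ((c j).2 : ℕ) = β at h2 ⊢
        generalize (i.2 : ℕ) = n
        field_simp
      rw [this]
      exact O.mul_mem (O.pow_mem (natCast_mem O _) _)
        (O.mul_mem (O.pow_mem (O.mul_mem (O.pow_mem ha₁ _) (O.pow_mem ha₂ _)) _)
          (O.pow_mem (O.mul_mem (O.pow_mem hb₁ _) (O.pow_mem hb₂ _)) _))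
    have hdetmem : F'.det ∈ O := by
      rw [Matrix.det_apply]
      refine O.sum_mem fun σ _ => ?_
      rw [Units.smul_def]
      exact O.zsmul_mem (O.prod_mem fun i _ => hF'mem _ _) _
    have h1 := hO _ hdetmem (by
      rw [hF'det]
      exact mul_ne_zero (Finset.prod_ne_zero_iff.2 fun j _ => hG0 j) hc)
    rw [hF'det, norm_mul, norm_prod, mul_comm] at h1
    refine h1.trans (mul_le_mul_of_nonneg_left ?_ (norm_nonneg _))
    have hn1 := hO _ hb₁ hb₁0
    have hn2 := hO _ hb₂ hb₂0
    calc ∏ j, ‖G j‖ ≤ ∏ _j : ι, (2 : ℝ) ^ (W * J) := by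
          refine Finset.prod_le_prod (fun _ _ => norm_nonneg _) fun j _ => ?_
          simp only [G, norm_pow, norm_mul]
          rw [pow_mul]
          refine pow_le_pow_left₀ (by positivity) (le_trans ?_ hW) _
          exact mul_le_mul (pow_le_pow_right₀ hn1 (c j).1.2.le)
            (pow_le_pow_right₀ hn2 (c j).2.2.le) (by positivity) (by positivity)
      _ = (2 ^ (W * J)) ^ L := by rw [Finset.prod_const, Finset.card_univ]
  -- analytic upper bound
  let pol : ι → ℂ[X] := fun i => X ^ (i.1 : ℕ) *
    ∑ n ∈ Finset.range T, C ((((i.2 : ℕ) : ℂ) * (θ * Complex.I)) ^ n / (n.factorial : ℂ)) * X ^ n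
  let P : Matrix ι ι ℂ := Matrix.of fun i j => (pol i).eval ((x (c j) : ℕ) : ℂ)
  have hT0 : 0 < T := by
    by_contra h0
    have : T = 0 := by omega
    rw [this, pow_zero] at hfin
    have h1 : (1 : ℝ) ≤ (I * J : ℝ) ^ 2 := one_le_pow₀ (by exact_mod_cast Nat.mul_pos hI hJ)
    have h2 : (1 : ℝ) ≤ B ^ (3 * I) := one_le_pow₀ hB1
    have h3 : (1 : ℝ) ≤ 2 ^ (2 * W * J) := one_le_pow₀ (by norm_num)
    have h4 := one_le_mul_of_one_le_of_one_le (one_le_mul_of_one_le_of_one_le h1 h2) h3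
    linarith
  have hpoldeg : ∀ i, (pol i).natDegree < I + T := by
    intro i
    refine lt_of_le_of_lt (b := (i.1 : ℕ) + (T - 1)) (natDegree_mul_le_of_le ?_ ?_) ?_
    · exact natDegree_X_pow_le _
    · refine natDegree_sum_le_of_forall_le _ _ fun n hn => ?_
      refine (natDegree_C_mul_X_pow_le _ _).trans ?_
      have := Finset.mem_range.1 hn
      omega
    · have := i.1.2
      omega
  set ε : ℝ := 3 * B ^ I * (1 / 2) ^ T with hε
  have hent : ∀ i j, ‖(F - P) i j‖ ≤ ε := by
    intro i j
    set k := c j with hk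
    have hev : (pol i).eval ((x k : ℕ) : ℂ) = ((x k : ℕ) : ℂ) ^ (i.1 : ℕ) *
        ∑ n ∈ Finset.range T,
          (((i.2 : ℕ) : ℂ) * (θ * Complex.I) * ((x k : ℕ) : ℂ)) ^ n / (n.factorial : ℂ) := by
      simp only [pol, eval_mul, eval_pow, eval_X, eval_finsetSum, eval_C]
      congr 1
      refine Finset.sum_congr rfl fun n _ => ?_
      rw [mul_pow _ ((x k : ℕ) : ℂ)]
      ring
    have hFP : (F - P) i j = ((x k : ℕ) : ℂ) ^ (i.1 : ℕ) * (y k ^ (i.2 : ℕ) -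
        ∑ n ∈ Finset.range T,
          (((i.2 : ℕ) : ℂ) * (θ * Complex.I) * ((x k : ℕ) : ℂ)) ^ n / (n.factorial : ℂ)) := by
      rw [Matrix.sub_apply, mul_sub, ← hev]
      rfl
    set u : ℂ := ((i.2 : ℕ) : ℂ) * (θ * Complex.I) * ((x k : ℕ) : ℂ) with hu
    have hexpu : Complex.exp u = (ω ^ (x k)) ^ (i.2 : ℕ) := by
      rw [hωθ, ← Complex.exp_nat_mul, ← Complex.exp_nat_mul, hu]
      congr 1
      ring
    have hiJ : ((i.2 : ℕ) : ℝ) ≤ J := by exact_mod_cast i.2.2.le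
    have hun : ‖u‖ ≤ |θ| * J * B := by
      rw [hu]
      simp only [norm_mul, Complex.norm_natCast, Complex.norm_real, Complex.norm_I, mul_one,
        Real.norm_eq_abs]
      calc ((i.2 : ℕ) : ℝ) * |θ| * (x k : ℝ) ≤ J * |θ| * B := by
            have := hxB k
            gcongr
        _ = |θ| * J * B := by ring
    have h6u : 6 * ‖u‖ ≤ T := le_trans (by linarith) hθ
    have hTpos : (0 : ℝ) < T := by exact_mod_cast hT0
    have htail : ‖Complex.exp u - ∑ n ∈ Finset.range T, u ^ n / (n.factorial : ℂ)‖ ≤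
        (1 / 2) ^ T * 2 := by
      refine (Complex.exp_bound' ?_).trans ?_
      · rw [div_le_iff₀ (by positivity)]
        push_cast
        linarith
      · exact mul_le_mul_of_nonneg_right
          (pow_div_factorial_le_half_pow (norm_nonneg _) h6u) (by norm_num)
    have hnear : ‖y k ^ (i.2 : ℕ) - Complex.exp u‖ ≤ (1 / 2) ^ T := by
      rw [hexpu]
      refine (norm_pow_sub_pow_le_of_norm_eq_one (hy1 k) (by rw [norm_pow, hω1, one_pow]) _).trans ?_
      have h1 : y k - ω ^ x k = -(ω ^ (k.1 : ℕ) * ((ω ^ q) ^ (k.2 : ℕ) - ζ ^ (k.2 : ℕ))) := by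
        simp only [y, x, pow_add, pow_mul]
        ring
      have h2 : ‖y k - ω ^ x k‖ ≤ R * ‖ω ^ q - ζ‖ := by
        rw [h1, norm_neg, norm_mul, norm_pow, hω1, one_pow, one_mul]
        refine (norm_pow_sub_pow_le_of_norm_eq_one (by rw [norm_pow, hω1, one_pow]) hζ1 _).trans ?_
        have : ((k.2 : ℕ) : ℝ) ≤ R := by exact_mod_cast k.2.2.le
        gcongr
      calc ((i.2 : ℕ) : ℝ) * ‖y k - ω ^ x k‖ ≤ J * (R * ‖ω ^ q - ζ‖) := by gcongr
        _ = ‖ω ^ q - ζ‖ * (J * R) := by ring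
        _ ≤ (1 / 2) ^ T := by
          rw [one_div, inv_pow, ← one_div, le_div_iff₀ (by positivity)]
          exact hclose
    have hxI : ‖((x k : ℕ) : ℂ) ^ (i.1 : ℕ)‖ ≤ B ^ I := by
      rw [norm_pow, Complex.norm_natCast]
      exact (pow_le_pow_left₀ (Nat.cast_nonneg _) (hxB k) _).trans
        (pow_le_pow_right₀ hB1 i.1.2.le)
    rw [hFP, norm_mul, hε]
    calc _ ≤ B ^ I * ((1 / 2) ^ T + (1 / 2) ^ T * 2) := by
          refine mul_le_mul hxI ?_ (norm_nonneg _) (by positivity)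
          have := norm_add_le (y k ^ (i.2 : ℕ) - Complex.exp u)
            (Complex.exp u - ∑ n ∈ Finset.range T, u ^ n / (n.factorial : ℂ))
          rw [sub_add_sub_cancel] at this
          linarith
      _ = 3 * B ^ I * (1 / 2) ^ T := by ring
  have hLJ : ((I * J : ℝ)) = L := by rw [hLIJ]; push_cast; ring
  rw [hLJ] at hfin
  have hBI : 1 ≤ B ^ I := one_le_pow₀ hB1
  have hL1 : (1 : ℝ) ≤ L := by exact_mod_cast hL0
  have h2W : (1 : ℝ) ≤ 2 ^ (2 * W * J) := one_le_pow₀ (by norm_num)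
  have hmain : 16 * (L : ℝ) ^ 2 * (B ^ I) ^ 2 * 2 ^ (2 * W * J) * ε < 1 := by
    have h1 : 16 * (L : ℝ) ^ 2 * (B ^ I) ^ 2 * 2 ^ (2 * W * J) * ε =
        48 * (L : ℝ) ^ 2 * B ^ (3 * I) * 2 ^ (2 * W * J) / 2 ^ T := by
      rw [hε, one_div, inv_pow, mul_comm 3 I, pow_mul]
      field_simp
      ring
    rw [h1, div_lt_one (by positivity)]
    exact hfin
  have hε0 : 0 ≤ ε := by positivity
  have hε1 : ε ≤ 1 := by
    have h1 : 1 ≤ 16 * (L : ℝ) ^ 2 * (B ^ I) ^ 2 * 2 ^ (2 * W * J) := by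
      have := one_le_mul_of_one_le_of_one_le (one_le_mul_of_one_le_of_one_le
        (one_le_mul_of_one_le_of_one_le (by norm_num : (1 : ℝ) ≤ 16) (one_le_pow₀ (n := 2) hL1))
        (one_le_pow₀ (n := 2) hBI)) h2W
      exact this
    nlinarith
  have hup := norm_det_le_of_near_polynomial P (F - P) (fun j => ((x (c j) : ℕ) : ℂ)) (I + T)
    (fun i n => (pol i).coeff n) (fun i j => eval_eq_sum_range' (hpoldeg i) _) (2 * B ^ I) ε
    (by linarith) hε0 hε1 (by
      intro i j
      have h1 : P i j = F i j - (F - P) i j := by simp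
      have h2 : ‖F i j‖ ≤ B ^ I := by
        simp only [hF, Matrix.of_apply, norm_mul, norm_pow, hy1, one_pow, mul_one,
          Complex.norm_natCast]
        exact (pow_le_pow_left₀ (Nat.cast_nonneg _) (hxB _) _).trans
          (pow_le_pow_right₀ hB1 i.1.2.le)
      rw [h1]
      refine (norm_sub_le _ _).trans ?_
      linarith [hent i j]) hent
  rw [add_sub_cancel] at hup
  have hfac : ((L.factorial : ℕ) : ℝ) ≤ (L : ℝ) ^ L := by exact_mod_cast Nat.factorial_le_pow L
  have hup2 : ‖F.det‖ ≤ (4 * L * B ^ I) ^ L * ε ^ (L - (I + T)) := by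
    refine hup.trans ?_
    calc (2 : ℝ) ^ L * (L.factorial * ((2 * B ^ I) ^ L * ε ^ (L - (I + T))))
        ≤ 2 ^ L * ((L : ℝ) ^ L * ((2 * B ^ I) ^ L * ε ^ (L - (I + T)))) := by gcongr
      _ = (4 * L * B ^ I) ^ L * ε ^ (L - (I + T)) := by
        have : (4 * (L : ℝ) * B ^ I) = 2 * L * (2 * B ^ I) := by ring
        rw [this, mul_pow _ (2 * B ^ I), mul_pow 2 (L : ℝ)]
        simp only [mul_assoc]
  have hsq : (ε ^ (L - (I + T))) ^ 2 ≤ ε ^ L := by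
    rw [← pow_mul]
    exact pow_le_pow_of_le_one hε0 hε1 (by omega)
  have h1 : 1 ≤ (‖F.det‖ * (2 ^ (W * J)) ^ L) ^ 2 := one_le_pow₀ hlow
  have h2 : (‖F.det‖ * (2 ^ (W * J)) ^ L) ^ 2 ≤
      (16 * (L : ℝ) ^ 2 * (B ^ I) ^ 2 * 2 ^ (2 * W * J) * ε) ^ L := by
    calc (‖F.det‖ * (2 ^ (W * J)) ^ L) ^ 2
        ≤ ((4 * L * B ^ I) ^ L * ε ^ (L - (I + T)) * (2 ^ (W * J)) ^ L) ^ 2 := by gcongr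
      _ = ((4 * L * B ^ I) ^ 2 * (2 ^ (W * J)) ^ 2) ^ L * (ε ^ (L - (I + T))) ^ 2 := by
        rw [mul_pow _ ((2 ^ (W * J)) ^ 2) L, ← pow_mul, ← pow_mul (2 ^ (W * J)), mul_comm 2 L,
          pow_mul, pow_mul (2 ^ (W * J)), mul_right_comm, mul_pow, mul_pow,
          pow_right_comm (4 * (L : ℝ) * B ^ I)]
      _ ≤ ((4 * L * B ^ I) ^ 2 * (2 ^ (W * J)) ^ 2) ^ L * ε ^ L := by gcongr
      _ = (16 * (L : ℝ) ^ 2 * (B ^ I) ^ 2 * 2 ^ (2 * W * J) * ε) ^ L := by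
        rw [← mul_pow]
        congr 1
        ring
  have h3 := pow_lt_one₀ (by positivity) hmain hL0.ne'
  linarith

theorem exists_pow_eq_exp_small {ω : ℂ} (hω : ‖ω‖ = 1) {U : ℕ} (hU : 0 < U) :
    ∃ u : ℕ, 0 < u ∧ u ≤ U ∧ ∃ θ : ℝ, ω ^ u = Complex.exp (θ * Complex.I) ∧ |θ| * U ≤ 7 := by
  obtain ⟨u, hu0, huU, hu⟩ :=
    Real.exists_nat_abs_mul_sub_round_le (ω.arg / (2 * Real.pi)) hU
  set m := round ((u : ℝ) * (ω.arg / (2 * Real.pi)))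
  refine ⟨u, hu0, huU, 2 * Real.pi * (u * (ω.arg / (2 * Real.pi)) - m), ?_, ?_⟩
  · have h1 : ω = Complex.exp (ω.arg * Complex.I) := by
      have := Complex.norm_mul_exp_arg_mul_I ω
      rw [hω, Complex.ofReal_one, one_mul] at this
      exact this.symm
    have h2 : ((2 * Real.pi * (u * (ω.arg / (2 * Real.pi)) - m) : ℝ) : ℂ) * Complex.I =
        (u : ℂ) * (ω.arg * Complex.I) - m * (2 * Real.pi * Complex.I) := by
      have hpi : (Real.pi : ℂ) ≠ 0 := Complex.ofReal_ne_zero.2 Real.pi_ne_zero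
      push_cast
      field_simp
    rw [h2, Complex.exp_sub, Complex.exp_int_mul_two_pi_mul_I, div_one, Complex.exp_nat_mul, ← h1]
  · have hU1 : (0 : ℝ) < U := by exact_mod_cast hU
    rw [abs_mul, abs_of_pos (by positivity : 0 < 2 * Real.pi)]
    rw [le_div_iff₀ (by positivity)] at hu
    have hpi : Real.pi < 3.15 := Real.pi_lt_d2
    have h3 := abs_nonneg ((u : ℝ) * (ω.arg / (2 * Real.pi)) - m)
    have hpi0 := Real.pi_pos
    nlinarith

theorem mul_sq_lt_two_pow {n : ℕ} (hn : 30 ≤ n) : 48 * (16 * n) ^ 2 < 2 ^ n := by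
  induction n, hn using Nat.le_induction with
  | base => norm_num
  | succ n hn ih =>
    have h1 : (n + 1) ^ 2 ≤ 2 * n ^ 2 := by nlinarith
    have h2 : ∀ m : ℕ, (16 * m) ^ 2 = 256 * m ^ 2 := fun m => by ring
    rw [h2] at *
    rw [pow_succ 2]
    omega

set_option maxHeartbeats 400000 in
open ComplexConjugate in
/-- A lower bound for `x * α ^ b + conj (x * α ^ b)` in a discrete, conjugation-stable subring
of `ℂ`. -/
theorem norm_mul_pow_lt_norm_add_conj (O : Subring ℂ) (hO : ∀ z ∈ O, z ≠ 0 → 1 ≤ ‖z‖)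
    (hconj : ∀ z ∈ O, conj z ∈ O) {α x : ℂ} (hα : α ∈ O) (hx : x ∈ O) (hα0 : α ≠ 0) (hx0 : x ≠ 0)
    (hω : ∀ n : ℕ, 0 < n → (α / conj α) ^ n ≠ 1) {H G b U j : ℕ} (hH : 1 ≤ H) (hj : 1 ≤ j)
    (hαH : ‖α‖ ≤ 2 ^ H) (hxG : ‖x‖ ≤ 2 ^ G) (hU : 672 * (16 * j) ≤ U)
    (hb : U * (2 * (338 + 32 * (U * H + G)) * (16 * j) + 1) ≤ b)
    (hbj : (b * (96 * U * H * (16 * j) + 1)) ^ 3 ≤ 2 ^ j) :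
    ‖x‖ * ‖α‖ ^ b < ‖x * α ^ b + conj (x * α ^ b)‖ *
      2 ^ (96 * H * (16 * j) ^ 2 * (336 * (b / U + 1 + U) + 32 * U * (U * H + G))) := by
  by_contra! hcon
  have hU0 : 0 < U := by omega
  set β := conj α with hβ
  have hβ0 : β ≠ 0 := (map_ne_zero _).2 hα0
  have hβn : ‖β‖ = ‖α‖ := Complex.norm_conj α
  have hαn : 0 < ‖α‖ := norm_pos_iff.2 hα0
  have hxn : 0 < ‖x‖ := norm_pos_iff.2 hx0
  have hω0n : ‖α / β‖ = 1 := by rw [norm_div, hβn, div_self hαn.ne']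
  obtain ⟨u, hu0, huU, θ, hθ, hθU⟩ := exists_pow_eq_exp_small hω0n hU0
  obtain ⟨q, hq⟩ : ∃ q, q = b / u := ⟨_, rfl⟩
  obtain ⟨r, hr⟩ : ∃ r, r = b % u := ⟨_, rfl⟩
  have hbqr : b = u * q + r := by rw [hq, hr, Nat.div_add_mod]
  have hru : r < u := by rw [hr]; exact Nat.mod_lt _ hu0
  obtain ⟨J, hJ⟩ : ∃ J, J = 16 * j := ⟨_, rfl⟩
  obtain ⟨K, hK⟩ : ∃ K, K = U * H + G := ⟨_, rfl⟩
  obtain ⟨p, hp⟩ : ∃ p, p = q / U := ⟨_, rfl⟩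
  rw [← hJ] at hU hb hbj hcon
  rw [← hK] at hb hcon
  obtain ⟨V, hV⟩ : ∃ V, V = 336 * (p + 1) + 32 * K := ⟨_, rfl⟩
  obtain ⟨R, hR⟩ : ∃ R, R = 96 * u * H * J := ⟨_, rfl⟩
  obtain ⟨W, hW⟩ : ∃ W, W = H * u * ((V + 2) * J) + (G + H * u) * R := ⟨_, rfl⟩
  have hJ0 : 0 < J := by omega
  have hR0 : 0 < R := by rw [hR]; positivity
  have hV0 : 336 ≤ V := by rw [hV]; omega
  have hqU : U * p ≤ q := by rw [hp, mul_comm]; exact Nat.div_mul_le_self _ _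
  have hqU' : q ≤ U * (p + 1) := by
    have := Nat.lt_div_mul_add (a := q) hU0
    rw [hp, mul_add, mul_one, mul_comm]
    exact this.le
  have hSq : (V + 2) * J ≤ q := by
    have h1 : 2 * (338 + 32 * K) * J + 1 ≤ q := by
      rw [hq]
      exact ((Nat.le_div_iff_mul_le hU0).2 (by rw [mul_comm]; exact hb)).trans
        (Nat.div_le_div_left huU hu0)
    have h2 : 672 * J * p ≤ q := (Nat.mul_le_mul_right _ hU).trans hqU
    have h3 : 2 * ((V + 2) * J) = 672 * J * p + 2 * (338 + 32 * K) * J := by rw [hV]; ring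
    omega
  have hW16 : 16 * W ≤ V * R := by
    have h1 : H * u + G ≤ K := by rw [hK, mul_comm H u]; gcongr
    have h2 : 32 * K ≤ V := by omega
    have h3 : 96 * W = (V + 2) * R + 96 * (G + H * u) * R := by rw [hW, hR]; ring
    have h4 : 96 * (G + H * u) * R ≤ 3 * V * R := Nat.mul_le_mul_right _ (by omega)
    have h5 : (V + 2) * R ≤ 2 * V * R := Nat.mul_le_mul_right _ (by omega)
    linarith
  have hRU : R ≤ 96 * U * H * J := by rw [hR]; gcongr
  have hX : (V + 2) * J + q * R ≤ b * (96 * U * H * J + 1) := by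
    have h1 : q ≤ b := by rw [hq]; exact Nat.div_le_self _ _
    calc (V + 2) * J + q * R ≤ q + q * R := by omega
      _ = q * (R + 1) := by ring
      _ ≤ _ := by gcongr
  have hq1 : 0 < q := lt_of_lt_of_le (by positivity) hSq
  -- the exponent
  have hL : V * R * J ≤ 96 * H * J ^ 2 * (336 * (b / U + 1 + U) + 32 * U * K) := by
    have h1 : u * p ≤ b / U := by
      rw [hp, hq, Nat.div_div_eq_div_mul, mul_comm u U, ← Nat.div_div_eq_div_mul, mul_comm]
      exact Nat.div_mul_le_self _ _
    have h2 : u * V ≤ 336 * (b / U + 1 + U) + 32 * U * K := by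
      have : u * K ≤ U * K := Nat.mul_le_mul_right _ huU
      calc u * V = 336 * (u * p + u) + 32 * (u * K) := by rw [hV]; ring
        _ ≤ 336 * (b / U + 1 + U) + 32 * (U * K) := by omega
        _ = _ := by ring
    calc V * R * J = 96 * H * J ^ 2 * (u * V) := by rw [hR]; ring
      _ ≤ _ := by gcongr
  set E := 96 * H * J ^ 2 * (336 * (b / U + 1 + U) + 32 * U * K) with hE
  -- the interpolation determinant
  have hωq : (α / β) ^ u = α ^ u / β ^ u := div_pow _ _ _
  refine interpolation_determinant O hO (a₁ := α ^ u) (b₁ := β ^ u) (a₂ := -(conj x * β ^ r))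
    (b₂ := x * α ^ r) (O.pow_mem hα _) (O.pow_mem (hconj _ hα) _)
    (O.neg_mem (O.mul_mem (hconj _ hx) (O.pow_mem (hconj _ hα) _)))
    (O.mul_mem hx (O.pow_mem hα _)) (pow_ne_zero _ hβ0) (mul_ne_zero hx0 (pow_ne_zero _ hα0))
    hωq rfl hθ ?_ (I := V * R) (J := J) (S := (V + 2) * J) (R := R) (q := q)
    (T := 4 * (V * R) * j) (W := W) (by positivity) hJ0 hR0 (by positivity) ?_ hSq ?_ ?_ ?_ ?_ ?_ ?_
  · rw [norm_div, norm_neg, norm_mul, norm_mul, norm_pow, norm_pow, hβn, Complex.norm_conj,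
      div_self (by positivity)]
  · intro i k _ _ hik
    by_contra hne
    have key : ∀ m n : ℕ, m < n → ((α / β) ^ u) ^ m = ((α / β) ^ u) ^ n → False := by
      intro m n hmn h
      refine hω (u * (n - m)) (Nat.mul_pos hu0 (by omega)) ?_
      have hne0 : ((α / β) ^ u) ^ m ≠ 0 := pow_ne_zero _ (pow_ne_zero _ (div_ne_zero hα0 hβ0))
      rw [pow_mul]
      apply mul_left_cancel₀ hne0
      rw [← pow_add, mul_one, h]
      congr 1
      omega
    rcases lt_or_gt_of_ne hne with h | h
    · exact key _ _ h hik
    · exact key _ _ h hik.symm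
  · have : (V + 2) * J - J = (V + 1) * J := by
      rw [Nat.sub_eq_iff_eq_add (Nat.le_mul_of_pos_left _ (by omega))]; ring
    rw [this]
    have h2 : (V + 1) * J * R = V * R * J + J * R := by ring
    rw [h2]
    exact Nat.lt_add_of_pos_right (Nat.mul_pos hJ0 hR0)
  · rw [hJ]
    have : V * R ≤ V * R * j := Nat.le_mul_of_pos_right _ hj
    linarith
  · have hα1 : 1 ≤ ‖α‖ := hO _ hα hα0
    rw [norm_mul, norm_pow, norm_pow, hβn, hW, pow_add]
    refine mul_le_mul ?_ ?_ (by positivity) (by positivity)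
    · calc (‖α‖ ^ u) ^ ((V + 2) * J) ≤ ((2 ^ H) ^ u) ^ ((V + 2) * J) := by gcongr
        _ = _ := by rw [← pow_mul, ← pow_mul, ← mul_assoc]
    · calc (‖x‖ * ‖α‖ ^ r) ^ R ≤ (2 ^ G * (2 ^ H) ^ u) ^ R := by
            refine pow_le_pow_left₀ (by positivity) ?_ _
            refine mul_le_mul hxG ?_ (by positivity) (by positivity)
            calc ‖α‖ ^ r ≤ ‖α‖ ^ u := pow_le_pow_right₀ hα1 hru.le
              _ ≤ _ := by gcongr
        _ = _ := by rw [← pow_mul 2 H, ← pow_add, ← pow_mul]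
  · have h1 : 168 * ((V + 2) * J + q * R) ≤ (V * R) * U := by
      have h2 : q * R ≤ U * (p + 1) * R := Nat.mul_le_mul_right _ hqU'
      have h3 : (V + 2) * J ≤ q * R := hSq.trans (Nat.le_mul_of_pos_right _ hR0)
      have h4 : 336 * (p + 1) * (R * U) ≤ V * (R * U) := Nat.mul_le_mul_right _ (by omega)
      linarith
    have h1' : 168 * (((V + 2) * J : ℕ) + (q : ℝ) * R) ≤ (V : ℝ) * R * U := by exact_mod_cast h1
    have hUr : (0 : ℝ) < U := by exact_mod_cast hU0
    have hJr : (J : ℝ) = 16 * j := by rw [hJ]; push_cast; ring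
    have h5 : |θ| * (168 * (((V + 2) * J : ℕ) + (q : ℝ) * R)) ≤ 7 * (V * R) :=
      calc |θ| * (168 * (((V + 2) * J : ℕ) + (q : ℝ) * R)) ≤ |θ| * ((V : ℝ) * R * U) := by gcongr
        _ = (|θ| * U) * (V * R) := by ring
        _ ≤ _ := by gcongr
    have h6 := mul_le_mul_of_nonneg_right h5 (Nat.cast_nonneg (α := ℝ) j)
    rw [hJr]
    push_cast at h6 ⊢
    linarith
  · have hc : ((α / β) ^ u) ^ q - -(conj x * β ^ r) / (x * α ^ r) =
        (x * α ^ b + conj (x * α ^ b)) / (x * α ^ r * (β ^ u) ^ q) := by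
      rw [map_mul, map_pow, ← hβ, hωq, hbqr, pow_add, pow_add, pow_mul, pow_mul]
      have hβu : β ^ u ≠ 0 := pow_ne_zero _ hβ0
      generalize β ^ u = γ at hβu ⊢
      rw [eq_div_iff (mul_ne_zero (mul_ne_zero hx0 (pow_ne_zero _ hα0)) (pow_ne_zero _ hβu)), sub_mul, neg_div, neg_mul, sub_neg_eq_add]
      congr 1
      · rw [div_pow]
        field_simp
      · field_simp
    have hden : ‖x * α ^ r * (β ^ u) ^ q‖ = ‖x‖ * ‖α‖ ^ b := by
      rw [norm_mul, norm_mul, norm_pow, norm_pow, norm_pow, hβn, ← pow_mul, mul_assoc, ← pow_add,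
        hbqr, add_comm r]
    rw [hc, norm_div, hden, mul_assoc, div_mul_eq_mul_div, div_le_one (by positivity)]
    refine le_trans (mul_le_mul_of_nonneg_left ?_ (norm_nonneg _)) hcon
    have h1 : J * R * 2 ^ (4 * (V * R) * j) ≤ 2 ^ E := by
      have h2 : J * R ≤ V * R * j := by
        calc J * R = 16 * (j * R) := by rw [hJ]; ring
          _ ≤ V * (j * R) := Nat.mul_le_mul_right _ (by omega)
          _ = V * R * j := by ring
      calc J * R * 2 ^ (4 * (V * R) * j) ≤ 2 ^ (V * R * j) * 2 ^ (4 * (V * R) * j) :=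
            Nat.mul_le_mul_right _ (h2.trans Nat.lt_two_pow_self.le)
        _ = 2 ^ (5 * (V * R * j)) := by rw [← pow_add]; congr 1; ring
        _ ≤ 2 ^ E := Nat.pow_le_pow_right (by norm_num) (le_trans (by rw [hJ]; linarith [Nat.zero_le (V * R * j)]) hL)
    exact_mod_cast h1
  · have h0 : 48 * (V * R * J) ^ 2 < 2 ^ (V * R * j) := by
      have h30 : 30 ≤ V * R * j :=
        calc 30 ≤ V := by omega
          _ ≤ V * (R * j) := Nat.le_mul_of_pos_right _ (Nat.mul_pos hR0 hj)
          _ = V * R * j := by ring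
      have := mul_sq_lt_two_pow h30
      rw [hJ]
      calc _ = 48 * (16 * (V * R * j)) ^ 2 := by ring
        _ < _ := this
    have h1 : ((V + 2) * J + q * R) ^ (3 * (V * R)) ≤ 2 ^ (V * R * j) := by
      rw [pow_mul _ 3, mul_comm (V * R) j, pow_mul 2]
      exact Nat.pow_le_pow_left ((Nat.pow_le_pow_left hX 3).trans hbj) _
    have h2 : 2 ^ (2 * W * J) ≤ 2 ^ (2 * (V * R * j)) :=
      Nat.pow_le_pow_right (by norm_num) (by
        calc 2 * W * J = 2 * (16 * W * j) := by rw [hJ]; ring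
          _ ≤ _ := by gcongr)
    have h3 : 48 * (V * R * J) ^ 2 * ((V + 2) * J + q * R) ^ (3 * (V * R)) * 2 ^ (2 * W * J) <
        2 ^ (4 * (V * R) * j) :=
      calc _ < 2 ^ (V * R * j) * 2 ^ (V * R * j) * 2 ^ (2 * (V * R * j)) := by
            refine Nat.mul_lt_mul_of_lt_of_le ?_ h2 (by positivity)
            exact Nat.mul_lt_mul_of_lt_of_le h0 h1 (by positivity)
        _ = 2 ^ (4 * (V * R) * j) := by rw [← pow_add, ← pow_add]; congr 1; ring
    exact_mod_cast h3

theorem lucasV_eq_pow_add_pow {A B : ℤ} {α β : ℂ} (hs : α + β = A) (hp : α * β = -(B : ℂ))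
    (n : ℕ) : (lucasV A B n : ℂ) = α ^ n + β ^ n := by
  induction n using Nat.twoStepInduction with
  | zero => simp [lucasV]; norm_num
  | one => simp [lucasV, hs]
  | more n h0 h1 =>
    have hB : (B : ℂ) = -(α * β) := by rw [hp, neg_neg]
    rw [lucasV]
    push_cast
    rw [h0, h1, ← hs, hB]
    ring

/-- The ring `ℤ[α]` for a quadratic integer `α`. -/
def quadraticSubring {A B : ℤ} {α : ℂ} (h : α ^ 2 = A * α + B) : Subring ℂ where
  carrier := {z | ∃ p q : ℤ, z = p + q * α}
  mul_mem' := by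
    rintro _ _ ⟨p, q, rfl⟩ ⟨r, s, rfl⟩
    refine ⟨p * r + q * s * B, p * s + q * r + q * s * A, ?_⟩
    push_cast
    linear_combination (q * s : ℂ) * h
  one_mem' := ⟨1, 0, by simp⟩
  add_mem' := by
    rintro _ _ ⟨p, q, rfl⟩ ⟨r, s, rfl⟩
    exact ⟨p + r, q + s, by push_cast; ring⟩
  zero_mem' := ⟨0, 0, by simp⟩
  neg_mem' := by
    rintro _ ⟨p, q, rfl⟩
    exact ⟨-p, -q, by push_cast; ring⟩

section Quadratic

open ComplexConjugate

variable {A B : ℤ} {α : ℂ}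

theorem sq_eq_of_add_conj (hs : α + conj α = A) (hp : α * conj α = -(B : ℂ)) :
    α ^ 2 = A * α + B := by
  linear_combination α * hs - hp

theorem mem_quadraticSubring_self (h : α ^ 2 = A * α + B) : α ∈ quadraticSubring h :=
  ⟨0, 1, by simp⟩

theorem conj_mem_quadraticSubring (hs : α + conj α = A) (h : α ^ 2 = A * α + B) {z : ℂ}
    (hz : z ∈ quadraticSubring h) : conj z ∈ quadraticSubring h := by
  obtain ⟨p, q, rfl⟩ := hz
  refine ⟨p + q * A, -q, ?_⟩
  simp only [map_add, map_mul, map_intCast]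
  push_cast
  linear_combination (q : ℂ) * hs

theorem exists_int_norm_sq (hs : α + conj α = A) (hp : α * conj α = -(B : ℂ))
    (h : α ^ 2 = A * α + B) {z : ℂ} (hz : z ∈ quadraticSubring h) :
    ∃ m : ℤ, z * conj z = m ∧ ‖z‖ ^ 2 = m := by
  obtain ⟨p, q, rfl⟩ := hz
  have h1 : ((p : ℂ) + q * α) * conj ((p : ℂ) + q * α) = (p ^ 2 + p * q * A - q ^ 2 * B : ℤ) := by
    simp only [map_add, map_mul, map_intCast]
    push_cast
    linear_combination (p * q : ℂ) * hs + (q ^ 2 : ℂ) * hp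
  refine ⟨_, h1, ?_⟩
  rw [Complex.mul_conj, Complex.normSq_eq_norm_sq] at h1
  exact_mod_cast h1

theorem exists_int_add_conj (hs : α + conj α = A) (h : α ^ 2 = A * α + B) {z : ℂ}
    (hz : z ∈ quadraticSubring h) : ∃ m : ℤ, z + conj z = m := by
  obtain ⟨p, q, rfl⟩ := hz
  refine ⟨2 * p + q * A, ?_⟩
  simp only [map_add, map_mul, map_intCast]
  push_cast
  linear_combination (q : ℂ) * hs

theorem one_le_norm_of_mem (hs : α + conj α = A) (hp : α * conj α = -(B : ℂ))
    (h : α ^ 2 = A * α + B) {z : ℂ} (hz : z ∈ quadraticSubring h) (hz0 : z ≠ 0) : 1 ≤ ‖z‖ := by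
  obtain ⟨m, -, hm⟩ := exists_int_norm_sq hs hp h hz
  have h1 : 0 < ‖z‖ := norm_pos_iff.2 hz0
  have h2 : (0 : ℝ) < m := by rw [← hm]; positivity
  have h3 : (1 : ℝ) ≤ m := by exact_mod_cast (by exact_mod_cast h2 : 0 < m)
  nlinarith

theorem norm_sq_eq_neg (hp : α * conj α = -(B : ℂ)) : ‖α‖ ^ 2 = -(B : ℝ) := by
  rw [Complex.mul_conj, Complex.normSq_eq_norm_sq] at hp
  exact_mod_cast hp

theorem abs_lucasV_le (hs : α + conj α = A) (hp : α * conj α = -(B : ℂ)) (n : ℕ) :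
    |(lucasV A B n : ℝ)| ≤ 2 * ‖α‖ ^ n := by
  have h := lucasV_eq_pow_add_pow hs hp n
  have h1 : |(lucasV A B n : ℝ)| = ‖(lucasV A B n : ℂ)‖ := by simp
  rw [h1, h]
  refine (norm_add_le _ _).trans ?_
  rw [norm_pow, norm_pow, Complex.norm_conj]
  linarith

theorem lucasV_sq_le (hs : α + conj α = A) (hp : α * conj α = -(B : ℂ)) (n : ℕ) :
    lucasV A B n ^ 2 ≤ 4 * (-B) ^ n := by
  have h := abs_lucasV_le hs hp n
  have h1 := pow_le_pow_left₀ (abs_nonneg _) h 2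
  rw [sq_abs, mul_pow, ← pow_mul, mul_comm n, pow_mul, norm_sq_eq_neg hp] at h1
  have h2 : ((lucasV A B n ^ 2 : ℤ) : ℝ) ≤ ((4 * (-B) ^ n : ℤ) : ℝ) := by
    push_cast
    linarith
  exact_mod_cast h2

/-- A conjugate pair with non-degenerate quotient has norm at least two. -/
theorem two_le_neg_of_nondegenerate (hA : A ≠ 0) (hB : B ≠ 0) (hs : α + conj α = A)
    (hp : α * conj α = -(B : ℂ)) (hω : ∀ n : ℕ, 0 < n → (α / conj α) ^ n ≠ 1) :
    2 ≤ -B := by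
  have h0 : (0 : ℝ) ≤ -(B : ℝ) := by rw [← norm_sq_eq_neg hp]; positivity
  have h1 : 0 ≤ -B := by exact_mod_cast h0
  by_contra! h2
  have hB1 : B = -1 := by omega
  subst hB1
  have h3 := lucasV_sq_le hs hp 1
  have h4 : A = 1 ∨ A = -1 := by
    simp only [lucasV] at h3
    have h5 : A ≤ 2 := by nlinarith
    have h6 : -2 ≤ A := by nlinarith
    have h7 : A ≠ 2 ∧ A ≠ -2 := by
      have hsub : ∀ a : ℂ, a ^ 2 = 1 → α + conj α = 2 * a → α * conj α = 1 → False := by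
        intro a ha hs' hp'
        have h8 : (α - a) ^ 2 = 0 := by linear_combination α * hs' - hp' + ha
        have h9 : α = a := by
          have := pow_eq_zero_iff (two_ne_zero) |>.1 h8
          exact sub_eq_zero.1 this
        have h10 : conj α = a := by linear_combination hs' - h9
        refine hω 1 one_pos ?_
        rw [h10, h9, pow_one, div_self]
        rintro rfl
        norm_num at ha
      constructor
      · rintro rfl
        exact hsub 1 (by norm_num) (by rw [hs]; norm_num) (by rw [hp]; norm_num)
      · rintro rfl
        exact hsub (-1) (by norm_num) (by rw [hs]; norm_num) (by rw [hp]; norm_num)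
    omega
  have hsq : (A : ℂ) ^ 2 = 1 := by rcases h4 with rfl | rfl <;> norm_num
  have hcube : ∀ z : ℂ, z ^ 2 = A * z + (-1 : ℤ) → z ^ 3 = -A := by
    intro z hz
    push_cast at hz
    linear_combination (z + A) * hz + z * hsq
  have hα3 := hcube α (sq_eq_of_add_conj hs hp)
  have hβ3 := hcube (conj α) (by linear_combination conj α * hs - hp)
  refine hω 3 (by norm_num) ?_
  rw [div_pow, hα3, hβ3, div_self]
  simpa using hA

end Quadratic

section Nondegenerate

open ComplexConjugate

variable {A B : ℤ} {α : ℂ}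

theorem ne_zero_of_mul_conj (hB : B ≠ 0) (hp : α * conj α = -(B : ℂ)) : α ≠ 0 := by
  rintro rfl
  simp at hp
  exact hB (by exact_mod_cast hp)

theorem sq_add_mul_ne_zero (hB : B ≠ 0) (hs : α + conj α = A) (hp : α * conj α = -(B : ℂ))
    (hω : ∀ n : ℕ, 0 < n → (α / conj α) ^ n ≠ 1) :
    A ^ 2 + B ≠ 0 ∧ A ^ 2 + 2 * B ≠ 0 ∧ A ^ 2 + 3 * B ≠ 0 ∧ A ^ 2 + 4 * B ≠ 0 := by
  set β := conj α with hβ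
  have hα0 : α ≠ 0 := ne_zero_of_mul_conj hB hp
  have hβ0 : β ≠ 0 := (map_ne_zero _).2 hα0
  have key : ∀ n : ℕ, 0 < n → α ^ n = β ^ n → False := by
    intro n hn h
    refine hω n hn ?_
    rw [div_pow, h, div_self (pow_ne_zero _ hβ0)]
  have hAB : ∀ k : ℤ, A ^ 2 + k * B = 0 → (α + β) ^ 2 - k * (α * β) = 0 := by
    intro k hk
    rw [hs, hp]
    have : ((A ^ 2 + k * B : ℤ) : ℂ) = 0 := by rw [hk]; simp
    push_cast at this
    linear_combination this
  refine ⟨fun h => ?_, fun h => ?_, fun h => ?_, fun h => ?_⟩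
  · have := hAB 1 (by linarith)
    push_cast at this
    exact key 3 (by norm_num) (by linear_combination (α - β) * this)
  · have := hAB 2 h
    push_cast at this
    exact key 4 (by norm_num) (by linear_combination (α ^ 2 - β ^ 2) * this)
  · have := hAB 3 h
    push_cast at this
    exact key 6 (by norm_num) (by linear_combination (α ^ 3 - β ^ 3) * (α + β) * this)
  · have := hAB 4 h
    push_cast at this
    have h2 : (α - β) ^ 2 = 0 := by linear_combination this
    have h3 := pow_eq_zero_iff (two_ne_zero) |>.1 h2
    exact key 1 (by norm_num) (by linear_combination h3)

theorem sq_lt_of_nondegenerate (hB : B ≠ 0) (hs : α + conj α = A) (hp : α * conj α = -(B : ℂ))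
    (hω : ∀ n : ℕ, 0 < n → (α / conj α) ^ n ≠ 1) : A ^ 2 < 4 * (-B) := by
  have h1 := lucasV_sq_le hs hp 1
  simp only [lucasV, pow_one] at h1
  have h2 := (sq_add_mul_ne_zero hB hs hp hω).2.2.2
  omega

/-- The coefficients occurring in a three-term progression, in some order. -/
def IsProgressionCoeff (e₁ e₂ e₃ : ℤ) : Prop :=
  (e₁ = 1 ∧ e₂ = 1 ∧ e₃ = -2) ∨ (e₁ = 1 ∧ e₂ = -2 ∧ e₃ = 1) ∨ (e₁ = -2 ∧ e₂ = 1 ∧ e₃ = 1)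

theorem one_add_pow_mul_ne (hA : A ≠ 0) (hB : B ≠ 0) (hs : α + conj α = A)
    (hp : α * conj α = -(B : ℂ)) (hω : ∀ n : ℕ, 0 < n → (α / conj α) ^ n ≠ 1)
    (hex : (A, B) ≠ (-1, -2)) {s j : ℕ} (hs0 : 0 < s) (hj : 0 < j) :
    α ^ s * (1 + α ^ j) ≠ 2 := by
  intro h
  have hN := two_le_neg_of_nondegenerate hA hB hs hp hω
  obtain ⟨-, hne2, -, hne4⟩ := sq_add_mul_ne_zero hB hs hp hω
  have hv := lucasV_sq_le hs hp j
  have hnorm : (-B) ^ s * (1 + lucasV A B j + (-B) ^ j) = 4 := by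
    have h2 : conj α ^ s * (1 + conj α ^ j) = 2 := by
      have := congrArg conj h
      rwa [map_mul, map_add, map_pow, map_pow, map_one, Complex.conj_ofNat] at this
    have h3 := lucasV_eq_pow_add_pow hs hp j
    have : (((-B) ^ s * (1 + lucasV A B j + (-B) ^ j) : ℤ) : ℂ) = (4 : ℤ) := by
      push_cast
      rw [h3, ← hp, mul_pow, mul_pow]
      linear_combination h2 * (α ^ s * (1 + α ^ j)) + 2 * h
    exact_mod_cast this
  have hsmall : ∀ i : ℕ, (2 : ℤ) ^ i ≤ 7 → i ≤ 2 := by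
    intro i hi
    by_contra! h3
    have : (2 : ℤ) ^ 3 ≤ 2 ^ i := pow_le_pow_right₀ (by norm_num) h3
    linarith
  obtain ⟨N, hNB⟩ : ∃ N, N = -B := ⟨_, rfl⟩
  obtain ⟨v, hvdef⟩ : ∃ v, v = lucasV A B j := ⟨_, rfl⟩
  rw [← hNB] at hN hv hnorm
  rw [← hvdef] at hv hnorm
  have hNle : 2 ^ s ≤ N ^ s := pow_le_pow_left₀ (by norm_num) hN s
  have hN4 : N ^ s ≤ 4 := Int.le_of_dvd (by norm_num) ⟨_, hnorm.symm⟩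
  have hs2 : s ≤ 2 := hsmall s (by linarith)
  have hNdvd : N ∣ 4 := (dvd_pow_self N hs0.ne').trans ⟨_, hnorm.symm⟩
  have hNle4 : N ≤ 4 := Int.le_of_dvd (by norm_num) hNdvd
  have hB' : B = -N := by omega
  have hN24 : N = 2 ∨ N = 4 := by
    interval_cases N
    · exact Or.inl rfl
    · omega
    · exact Or.inr rfl
  have hv1 : j = 1 → v = A := by rintro rfl; simp [hvdef, lucasV]
  have hv2 : j = 2 → v = A ^ 2 + 2 * B := by rintro rfl; simp [hvdef, lucasV]; ring
  have hj12 : j ≤ 2 → j = 1 ∨ j = 2 := by omega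
  rcases hN24 with rfl | rfl
  · have hP : (0 : ℤ) < 2 ^ j := by positivity
    have hs12 : s = 1 ∨ s = 2 := by omega
    rcases hs12 with rfl | rfl
    · have hv' : v = 1 - 2 ^ j := by linarith
      rw [hv'] at hv
      rcases hj12 (hsmall j (by nlinarith)) with rfl | rfl
      · refine hex ?_
        have := hv1 rfl
        rw [hB', ← this, hv']
        norm_num
      · have h5 := hv2 rfl
        rw [hv', hB'] at h5
        have h6 : A = 1 ∨ A = -1 := sq_eq_one_iff.1 (by linarith)
        rcases h6 with rfl | rfl
        · have h7 := sq_eq_of_add_conj hs hp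
          rw [hB'] at h7
          push_cast at h7
          have h8 : (4 : ℂ) = 0 := by linear_combination -h + (α + 1) * h7
          norm_num at h8
        · exact hex (by rw [hB'])
    · have hv' : v = - 2 ^ j := by linarith
      rw [hv'] at hv
      rcases hj12 (hsmall j (by nlinarith)) with rfl | rfl
      · have := hv1 rfl
        apply hne2
        rw [← this, hv', hB']
        norm_num
      · have h5 := hv2 rfl
        rw [hv', hB'] at h5
        apply hA
        nlinarith
  · have hs1 : s = 1 := by
      by_contra hne
      have : s = 2 := by omega
      subst this
      norm_num at hN4
    subst hs1
    have hv' : v = - 4 ^ j := by linarith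
    rw [hv'] at hv
    have hP : (0 : ℤ) < 4 ^ j := by positivity
    have h4 : (4 : ℤ) ^ j ≤ 4 := by nlinarith
    have hj1 : j = 1 := by
      by_contra hne
      have : (4 : ℤ) ^ 2 ≤ 4 ^ j := pow_le_pow_right₀ (by norm_num) (by omega)
      linarith
    have := hv1 hj1
    apply hne4
    rw [← this, hv', hB', hj1]
    norm_num

theorem IsProgressionCoeff.add_mul_pow_ne_zero {e₁ e₂ e₃ : ℤ} (he : IsProgressionCoeff e₁ e₂ e₃)
    (hA : A ≠ 0) (hB : B ≠ 0) (hs : α + conj α = A)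
    (hp : α * conj α = -(B : ℂ)) (hω : ∀ n : ℕ, 0 < n → (α / conj α) ^ n ≠ 1)
    (hex : (A, B) ≠ (-1, -2)) {s j : ℕ} (hs0 : 0 < s) (hj : 0 < j) :
    (e₁ : ℂ) + e₂ * α ^ s + e₃ * α ^ (s + j) ≠ 0 := by
  intro h
  have hα := sq_eq_of_add_conj hs hp
  have hunit : ∀ e e' : ℤ, (1 : ℂ) + α ^ s * (e + e' * α ^ j) = 0 → False := by
    intro e e' h1
    have hmem : (e : ℂ) + e' * α ^ j ∈ quadraticSubring hα :=
      Subring.add_mem _ (intCast_mem _ _) (Subring.mul_mem _ (intCast_mem _ _)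
        (Subring.pow_mem _ (mem_quadraticSubring_self hα) _))
    have h2 : ‖α‖ ^ s * ‖(e : ℂ) + e' * α ^ j‖ = 1 := by
      rw [← norm_pow, ← norm_mul, eq_neg_of_add_eq_zero_right h1, norm_neg, norm_one]
    have h3 : 1 ≤ ‖(e : ℂ) + e' * α ^ j‖ := by
      refine one_le_norm_of_mem hs hp hα hmem fun h0 => ?_
      rw [h0] at h1
      simp at h1
    have hN : (2 : ℝ) ≤ -B := by exact_mod_cast two_le_neg_of_nondegenerate hA hB hs hp hω
    have h4 : 1 < ‖α‖ := by
      have := norm_sq_eq_neg hp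
      have h0 := norm_nonneg α
      nlinarith
    have h5 : 1 < ‖α‖ ^ s := one_lt_pow₀ h4 hs0.ne'
    nlinarith
  rw [pow_add] at h
  rcases he with ⟨rfl, rfl, rfl⟩ | ⟨rfl, rfl, rfl⟩ | ⟨rfl, rfl, rfl⟩
  · exact hunit 1 (-2) (by linear_combination h)
  · exact hunit (-2) 1 (by linear_combination h)
  · refine one_add_pow_mul_ne hA hB hs hp hω hex hs0 hj ?_
    push_cast at h
    linear_combination h

/-- If `X * α ^ a` is purely imaginary then a power of a fixed integer divides the norm of `X`. -/
theorem two_pow_le_norm_sq (hA : A ≠ 0) (hB : B ≠ 0) (hs : α + conj α = A)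
    (hp : α * conj α = -(B : ℂ)) (hω : ∀ n : ℕ, 0 < n → (α / conj α) ^ n ≠ 1)
    (hα : α ^ 2 = A * α + B) {X : ℂ} (hX : X ∈ quadraticSubring hα) (hX0 : X ≠ 0) {a : ℕ}
    (hXa : X * α ^ a + conj (X * α ^ a) = 0) : (2 : ℝ) ^ a ≤ ‖X‖ ^ 2 := by
  have hN := two_le_neg_of_nondegenerate hA hB hs hp hω
  obtain ⟨hne1, hne2, hne3, hne4⟩ := sq_add_mul_ne_zero hB hs hp hω
  have hAlt := sq_lt_of_nondegenerate hB hs hp hω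
  obtain ⟨m, hm, hmn⟩ := exists_int_norm_sq hs hp hα hX
  obtain ⟨w, hw⟩ := exists_int_add_conj hs hα (Subring.pow_mem _ hX 2)
  rw [map_pow] at hw
  have hm0 : 0 < m := by
    have : (0 : ℝ) < m := by rw [← hmn]; have := norm_pos_iff.2 hX0; positivity
    exact_mod_cast this
  obtain ⟨g, T, N', hg0, hgT, hgN, hcop⟩ :
      ∃ g T N' : ℤ, 0 < g ∧ A ^ 2 + 2 * B = g * T ∧ -B = g * N' ∧ IsCoprime T N' := by
    refine ⟨(A ^ 2 + 2 * B).gcd (-B), (A ^ 2 + 2 * B) / (A ^ 2 + 2 * B).gcd (-B),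
      (-B) / (A ^ 2 + 2 * B).gcd (-B), ?_, ?_, ?_, ?_⟩
    · exact_mod_cast Int.gcd_pos_of_ne_zero_right _ (neg_ne_zero.2 hB)
    · exact (Int.mul_ediv_cancel' (Int.gcd_dvd_left ..)).symm
    · exact (Int.mul_ediv_cancel' (Int.gcd_dvd_right ..)).symm
    · rw [Int.isCoprime_iff_gcd_eq_one]
      exact Int.gcd_ediv_gcd_ediv_gcd (Int.gcd_pos_of_ne_zero_right _ (neg_ne_zero.2 hB))
  have hN'2 : 2 ≤ N' := by
    have h1 : 0 < N' := by
      by_contra! h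
      nlinarith
    by_contra! h2
    have h3 : N' = 1 := by omega
    rw [h3, mul_one] at hgN
    have h4 : A ^ 2 = g * (T + 2) := by linarith
    have hA2 : 0 < A ^ 2 := by positivity
    have h5 : 0 < T + 2 := by
      by_contra! h
      nlinarith
    have h6 : T + 2 < 4 := by
      by_contra! h
      nlinarith
    have hBg : B = -g := by omega
    have h7 : T + 2 = 1 ∨ T + 2 = 2 ∨ T + 2 = 3 := by omega
    rcases h7 with h | h | h <;> rw [h] at h4
    · exact hne1 (by omega)
    · exact hne2 (by omega)
    · exact hne3 (by omega)
  have hgc : (g : ℂ) ≠ 0 := by exact_mod_cast hg0.ne'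
  have hpN : α * conj α = g * N' := by rw [hp]; exact_mod_cast hgN
  have hsum : α ^ 2 / g + conj α ^ 2 / g = (T : ℤ) := by
    rw [← add_div, div_eq_iff hgc]
    have : ((A ^ 2 + 2 * B : ℤ) : ℂ) = (g * T : ℤ) := by rw [hgT]
    push_cast at this
    linear_combination (α + conj α + A) * hs - 2 * hp + this
  have hprod : α ^ 2 / g * (conj α ^ 2 / g) = -((-N' ^ 2 : ℤ) : ℂ) := by
    rw [div_mul_div_comm, div_eq_iff (mul_ne_zero hgc hgc)]
    push_cast
    linear_combination (α * conj α + g * N') * hpN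
  have hlv := lucasV_eq_pow_add_pow hsum hprod a
  have hkey : lucasV T (-N' ^ 2) a * m = -N' ^ a * w := by
    have : ((lucasV T (-N' ^ 2) a * m : ℤ) : ℂ) = (-N' ^ a * w : ℤ) := by
      push_cast
      rw [hlv, ← hm, ← hw, div_pow, div_pow, ← add_div, div_mul_eq_mul_div,
        div_eq_iff (pow_ne_zero _ hgc)]
      rw [map_mul, map_pow] at hXa
      have h1 : (α ^ a) * (conj α) ^ a = (g : ℂ) ^ a * N' ^ a := by
        rw [← mul_pow, hpN, mul_pow]
      have h2 : ∀ z : ℂ, (z ^ 2) ^ a = (z ^ a) ^ 2 := fun z => by rw [← pow_mul, ← pow_mul, mul_comm]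
      rw [h2, h2]
      linear_combination (X * conj α ^ a + conj X * α ^ a) * hXa - (X ^ 2 + conj X ^ 2) * h1
    exact_mod_cast this
  have hmod : ∀ n : ℕ, N' ∣ lucasV T (-N' ^ 2) (n + 1) - T ^ (n + 1) := by
    intro n
    induction n with
    | zero => simp [lucasV]
    | succ n ih =>
      obtain ⟨c, hc⟩ := ih
      refine ⟨T * c - N' * lucasV T (-N' ^ 2) n, ?_⟩
      rw [lucasV]
      linear_combination T * hc
  have hdvd : N' ^ a ∣ m := by
    rcases a with _ | n
    · simp
    · have hc1 : IsCoprime (lucasV T (-N' ^ 2) (n + 1)) N' := by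
        obtain ⟨c, hc⟩ := hmod n
        have : lucasV T (-N' ^ 2) (n + 1) = T ^ (n + 1) + N' * c := by linarith
        rw [this]
        exact (hcop.pow_left).add_mul_left_left c
      refine (hc1.symm.pow_left (m := n + 1)).dvd_of_dvd_mul_left ⟨-w, ?_⟩
      rw [hkey]
      ring
  have hle : N' ^ a ≤ m := Int.le_of_dvd hm0 hdvd
  have h2 : (2 : ℤ) ^ a ≤ m := (pow_le_pow_left₀ (by norm_num) hN'2 a).trans hle
  rw [hmn]
  exact_mod_cast h2

end Nondegenerate

theorem pow_le_two_pow_self {M : ℕ} (hM : 2 ^ 38 ≤ M) : M ^ 249 ≤ 2 ^ M := by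
  have key : ∀ e : ℕ, 12 ≤ e → 249 * (e + 1) ≤ 2 ^ e := by
    intro e he
    induction e, he using Nat.le_induction with
    | base => norm_num
    | succ e he ih => rw [pow_succ]; omega
  have hM0 : M ≠ 0 := by
    rintro rfl
    norm_num at hM
  have he : 38 ≤ Nat.log 2 M := Nat.le_log_of_pow_le (by norm_num) hM
  calc M ^ 249 ≤ (2 ^ (Nat.log 2 M + 1)) ^ 249 :=
        Nat.pow_le_pow_left (Nat.lt_pow_succ_log_self (by norm_num) M).le _
    _ = 2 ^ (249 * (Nat.log 2 M + 1)) := by rw [← pow_mul, mul_comm]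
    _ ≤ 2 ^ M := Nat.pow_le_pow_right (by norm_num)
        ((key _ (by omega)).trans (Nat.pow_log_le_self 2 hM0))

theorem succ_pow_le_two_mul_pow {M : ℕ} (hM : 128 ≤ M) : (M + 1) ^ 60 ≤ 2 * M ^ 60 := by
  have h1 : (128 * (M + 1)) ^ 60 ≤ (129 * M) ^ 60 := Nat.pow_le_pow_left (by omega) _
  rw [mul_pow, mul_pow] at h1
  have h2 : 129 ^ 60 * M ^ 60 ≤ 2 * 128 ^ 60 * M ^ 60 := Nat.mul_le_mul_right _ (by norm_num)
  have h3 : 128 ^ 60 * (M + 1) ^ 60 ≤ 128 ^ 60 * (2 * M ^ 60) := h1.trans (h2.trans (by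
    rw [mul_comm 2, mul_assoc]))
  exact Nat.le_of_mul_le_mul_left h3 (by positivity)

theorem lt_two_mul_of_pow_lt {Q : ℝ} (hQ0 : 0 ≤ Q) (hQ : 2 ≤ Q ^ 2) {d n : ℕ}
    (h : Q ^ d < 2 ^ n) : d < 2 * n := by
  have h1 : (2 : ℝ) ^ d < 2 ^ (2 * n) :=
    calc (2 : ℝ) ^ d ≤ (Q ^ 2) ^ d := pow_le_pow_left₀ (by norm_num) hQ d
      _ = (Q ^ d) ^ 2 := by rw [← pow_mul, ← pow_mul, mul_comm]
      _ < (2 ^ n) ^ 2 := pow_lt_pow_left₀ h (by positivity) (by norm_num)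
      _ = 2 ^ (2 * n) := by rw [← pow_mul, mul_comm]
  exact (pow_lt_pow_iff_right₀ (by norm_num)).1 h1

section BoundedNorm

open ComplexConjugate

variable {A B : ℤ} {α : ℂ}

theorem IsProgressionCoeff.abs_last_le {e₁ e₂ e₃ : ℤ} (he : IsProgressionCoeff e₁ e₂ e₃) {x y z : ℝ}
    (h : e₁ * x + e₂ * y + e₃ * z = 0) : |z| ≤ 2 * |x| + 2 * |y| := by
  have hx := abs_nonneg x
  have hy := abs_nonneg y
  rcases he with ⟨rfl, rfl, rfl⟩ | ⟨rfl, rfl, rfl⟩ | ⟨rfl, rfl, rfl⟩ <;> push_cast at h <;>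
    refine abs_le.2 ⟨?_, ?_⟩ <;> linarith [le_abs_self x, neg_abs_le x, le_abs_self y, neg_abs_le y]

theorem IsProgressionCoeff.abs_cast_le {e₁ e₂ e₃ : ℤ} (he : IsProgressionCoeff e₁ e₂ e₃) :
    |(e₁ : ℝ)| ≤ 2 ∧ |(e₂ : ℝ)| ≤ 2 ∧ |(e₃ : ℝ)| ≤ 2 ∧ |(e₁ : ℝ)| + |(e₂ : ℝ)| + |(e₃ : ℝ)| = 4 := by
  rcases he with ⟨rfl, rfl, rfl⟩ | ⟨rfl, rfl, rfl⟩ | ⟨rfl, rfl, rfl⟩ <;> norm_num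

theorem IsProgressionCoeff.ne_zero {e₁ e₂ e₃ : ℤ} (he : IsProgressionCoeff e₁ e₂ e₃) :
    e₁ ≠ 0 ∧ e₂ ≠ 0 ∧ e₃ ≠ 0 := by
  rcases he with ⟨rfl, rfl, rfl⟩ | ⟨rfl, rfl, rfl⟩ | ⟨rfl, rfl, rfl⟩ <;> norm_num

/-- The gap between the two largest indices is small. -/
theorem index_gap_le (hA : A ≠ 0) (hB : B ≠ 0) (hs : α + conj α = A)
    (hp : α * conj α = -(B : ℂ)) (hω : ∀ n : ℕ, 0 < n → (α / conj α) ^ n ≠ 1)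
    {e₁ e₂ e₃ : ℤ} (he : IsProgressionCoeff e₁ e₂ e₃) {a b c : ℕ} (hab : a < b) (hbc : b < c)
    (heq : e₁ * lucasV A B a + e₂ * lucasV A B b + e₃ * lucasV A B c = 0)
    {M : ℕ} (hM : 2 ^ 38 ≤ M) (hcM : M ^ 60 ≤ c) (hcM' : c ≤ 2 * M ^ 60) (hQ : ‖α‖ ≤ 2 ^ M) :
    c - b ≤ M ^ 46 := by
  have hα := sq_eq_of_add_conj hs hp
  have hα0 := ne_zero_of_mul_conj hB hp
  have hQ2 : 2 ≤ ‖α‖ ^ 2 := by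
    rw [norm_sq_eq_neg hp]
    exact_mod_cast two_le_neg_of_nondegenerate hA hB hs hp hω
  have hQ1 : 1 ≤ ‖α‖ := one_le_norm_of_mem hs hp hα (mem_quadraticSubring_self hα) hα0
  have hM0 : 0 < M := lt_of_lt_of_le (by norm_num) hM
  have hmono : ∀ i k : ℕ, i ≤ k → M ^ i ≤ M ^ k := fun i k h => Nat.pow_le_pow_right hM0 h
  have hstep : ∀ C k l : ℕ, C ≤ 2 ^ 38 → l = k + 1 → C * M ^ k ≤ M ^ l := fun C k l h hl => by
    rw [hl, pow_succ']
    exact Nat.mul_le_mul_right _ (h.trans hM)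
  have hbk := norm_mul_pow_lt_norm_add_conj (quadraticSubring hα)
    (fun z hz hz0 => one_le_norm_of_mem hs hp hα hz hz0)
    (fun z hz => conj_mem_quadraticSubring hs hα hz)
    (mem_quadraticSubring_self hα) (Subring.one_mem _) hα0 one_ne_zero hω (H := M) (G := 0)
    (b := c) (U := M ^ 20) (j := M) hM0 hM0 hQ (by simp)
    (by
      have h1 := hstep (672 * 16) 1 2 (by norm_num) rfl
      have h2 := hmono 2 20 (by norm_num)
      rw [pow_one] at h1
      omega)
    (by
      have h1 := hmono 20 42 (by norm_num)
      have h2 := hmono 21 42 (by norm_num)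
      have h3 := hstep 20000 42 43 (by norm_num) rfl
      have h4 := hmono 43 60 (by norm_num)
      calc M ^ 20 * (2 * (338 + 32 * (M ^ 20 * M + 0)) * (16 * M) + 1)
          = 10816 * M ^ 21 + 1024 * M ^ 42 + M ^ 20 := by ring
        _ ≤ c := by omega)
    (by
      have h1 : 2 * (96 * M ^ 20 * M * (16 * M) + 1) ≤ M ^ 23 := by
        have h2 := hstep 4000 22 23 (by norm_num) rfl
        have h3 := hmono 0 22 (by norm_num)
        rw [pow_zero] at h3
        calc 2 * (96 * M ^ 20 * M * (16 * M) + 1) = 3072 * M ^ 22 + 2 := by ring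
          _ ≤ M ^ 23 := by omega
      calc _ ≤ (2 * M ^ 60 * (96 * M ^ 20 * M * (16 * M) + 1)) ^ 3 :=
            Nat.pow_le_pow_left (Nat.mul_le_mul_right _ hcM') 3
        _ = (M ^ 60 * (2 * (96 * M ^ 20 * M * (16 * M) + 1))) ^ 3 := by ring
        _ ≤ (M ^ 60 * M ^ 23) ^ 3 := Nat.pow_le_pow_left (Nat.mul_le_mul_left _ h1) 3
        _ = M ^ 249 := by rw [← pow_add, ← pow_mul]
        _ ≤ 2 ^ M := pow_le_two_pow_self hM)
  set L := 96 * M * (16 * M) ^ 2 * (336 * (c / M ^ 20 + 1 + M ^ 20) +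
    32 * M ^ 20 * (M ^ 20 * M + 0)) with hL
  have hLle : L ≤ M ^ 45 := by
    have h1 : c / M ^ 20 ≤ 2 * M ^ 40 := by
      refine Nat.div_le_of_le_mul (hcM'.trans (le_of_eq ?_))
      ring
    have h2 : 336 * (c / M ^ 20 + 1 + M ^ 20) + 32 * M ^ 20 * (M ^ 20 * M + 0) ≤ 33 * M ^ 41 := by
      have h3 := hstep 2000 40 41 (by norm_num) rfl
      have h4 := hmono 20 40 (by norm_num)
      have h5 := hmono 0 40 (by norm_num)
      have h6 : 32 * M ^ 20 * (M ^ 20 * M + 0) = 32 * M ^ 41 := by ring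
      rw [pow_zero] at h5
      omega
    have h7 := hstep (24576 * 33) 44 45 (by norm_num) rfl
    calc L ≤ 96 * M * (16 * M) ^ 2 * (33 * M ^ 41) := Nat.mul_le_mul_left _ h2
      _ = 24576 * 33 * M ^ 44 := by ring
      _ ≤ M ^ 45 := h7
  have hvc : |(lucasV A B c : ℝ)| ≤ 8 * ‖α‖ ^ b := by
    have h1 := he.abs_last_le (x := lucasV A B a) (y := lucasV A B b) (z := lucasV A B c)
      (by exact_mod_cast heq)
    have h2 := abs_lucasV_le hs hp a
    have h3 := abs_lucasV_le hs hp b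
    have h4 : ‖α‖ ^ a ≤ ‖α‖ ^ b := pow_le_pow_right₀ hQ1 hab.le
    linarith
  have hnorm : ‖1 * α ^ c + conj (1 * α ^ c)‖ = |(lucasV A B c : ℝ)| := by
    rw [one_mul, map_pow, ← lucasV_eq_pow_add_pow hs hp]
    simp
  rw [hnorm, norm_one, one_mul] at hbk
  have hd : ‖α‖ ^ (c - b) < 2 ^ (L + 3) := by
    have h1 : ‖α‖ ^ (c - b) * ‖α‖ ^ b < 2 ^ (L + 3) * ‖α‖ ^ b :=
      calc ‖α‖ ^ (c - b) * ‖α‖ ^ b = ‖α‖ ^ c := by rw [← pow_add, Nat.sub_add_cancel hbc.le]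
        _ < |(lucasV A B c : ℝ)| * 2 ^ L := hbk
        _ ≤ 8 * ‖α‖ ^ b * 2 ^ L := by gcongr
        _ = 2 ^ (L + 3) * ‖α‖ ^ b := by ring
    exact lt_of_mul_lt_mul_right h1 (by positivity)
  have h1 := lt_two_mul_of_pow_lt (norm_nonneg _) hQ2 hd
  have h2 := hstep 100 45 46 (by norm_num) rfl
  have h3 := hmono 0 45 (by norm_num)
  rw [pow_zero] at h3
  omega

/-- The gap between the two smallest indices is small. -/
theorem index_gap_le_of_norm_le (hA : A ≠ 0) (hB : B ≠ 0) (hs : α + conj α = A)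
    (hp : α * conj α = -(B : ℂ)) (hω : ∀ n : ℕ, 0 < n → (α / conj α) ^ n ≠ 1)
    {e₁ e₂ e₃ : ℤ} (he : IsProgressionCoeff e₁ e₂ e₃) {a b c : ℕ} (hab : a < b) (hbc : b < c)
    (heq : e₁ * lucasV A B a + e₂ * lucasV A B b + e₃ * lucasV A B c = 0)
    {M : ℕ} (hM : 2 ^ 38 ≤ M) (hcM : M ^ 60 ≤ c) (hcM' : c ≤ 2 * M ^ 60) (hQ : ‖α‖ ≤ 2 ^ M)
    (hgap : c - b ≤ M ^ 46) : b - a ≤ 2 * M ^ 58 + 4 := by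
  have hα := sq_eq_of_add_conj hs hp
  have hα0 := ne_zero_of_mul_conj hB hp
  have hαm := mem_quadraticSubring_self hα
  have hQ2 : 2 ≤ ‖α‖ ^ 2 := by
    rw [norm_sq_eq_neg hp]
    exact_mod_cast two_le_neg_of_nondegenerate hA hB hs hp hω
  have hQ1 : 1 ≤ ‖α‖ := one_le_norm_of_mem hs hp hα hαm hα0
  have hM0 : 0 < M := lt_of_lt_of_le (by norm_num) hM
  have hmono : ∀ i k : ℕ, i ≤ k → M ^ i ≤ M ^ k := fun i k h => Nat.pow_le_pow_right hM0 h
  have hstep : ∀ C k l : ℕ, C ≤ 2 ^ 38 → l = k + 1 → C * M ^ k ≤ M ^ l := fun C k l h hl => by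
    rw [hl, pow_succ']
    exact Nat.mul_le_mul_right _ (h.trans hM)
  obtain ⟨d, hd⟩ : ∃ d, d = c - b := ⟨_, rfl⟩
  have hcd : c = d + b := by omega
  rw [← hd] at hgap
  set x : ℂ := e₂ + e₃ * α ^ d with hx
  have hxm : x ∈ quadraticSubring hα :=
    Subring.add_mem _ (intCast_mem _ _) (Subring.mul_mem _ (intCast_mem _ _)
      (Subring.pow_mem _ hαm _))
  have hx0 : x ≠ 0 := by
    intro h0
    have h1 : (e₂ : ℂ) + e₃ * conj α ^ d = 0 := by
      have := congrArg conj h0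
      simpa [hx] using this
    have h2 : (e₃ : ℂ) * (α ^ d - conj α ^ d) = 0 := by linear_combination h0 - h1
    have h3 := (mul_eq_zero.1 h2).resolve_left (by exact_mod_cast he.ne_zero.2.2)
    refine hω d (by omega) ?_
    rw [div_pow, sub_eq_zero.1 h3, div_self (pow_ne_zero _ ((map_ne_zero _).2 hα0))]
  have hx1 : 1 ≤ ‖x‖ := one_le_norm_of_mem hs hp hα hxm hx0
  have hxG : ‖x‖ ≤ 2 ^ M ^ 48 := by
    obtain ⟨-, h2, h3, -⟩ := he.abs_cast_le
    have h4 : 1 ≤ ‖α‖ ^ d := one_le_pow₀ hQ1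
    have h5 : ‖x‖ ≤ 4 * ‖α‖ ^ d := by
      refine (norm_add_le _ _).trans ?_
      rw [norm_mul, norm_pow, Complex.norm_intCast, Complex.norm_intCast]
      nlinarith
    have h6 : M * d + 2 ≤ M ^ 48 := by
      have h7 : M * d ≤ M ^ 47 := (Nat.mul_le_mul_left _ hgap).trans (le_of_eq (by ring))
      have h8 := hstep 10 47 48 (by norm_num) rfl
      have h9 := hmono 0 47 (by norm_num)
      rw [pow_zero] at h9
      omega
    calc ‖x‖ ≤ 4 * ‖α‖ ^ d := h5
      _ ≤ 4 * (2 ^ M) ^ d := by gcongr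
      _ = 2 ^ (M * d + 2) := by rw [← pow_mul]; ring
      _ ≤ 2 ^ M ^ 48 := pow_le_pow_right₀ (by norm_num) h6
  have hbk := norm_mul_pow_lt_norm_add_conj (quadraticSubring hα)
    (fun z hz hz0 => one_le_norm_of_mem hs hp hα hz hz0)
    (fun z hz => conj_mem_quadraticSubring hs hα hz)
    hαm hxm hα0 hx0 hω (H := M) (G := M ^ 48) (b := b) (U := M ^ 6) (j := M) hM0 hM0 hQ hxG
    (by
      have h1 := hstep (672 * 16) 1 2 (by norm_num) rfl
      have h2 := hmono 2 6 (by norm_num)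
      rw [pow_one] at h1
      omega)
    (by
      have h1 := hmono 7 55 (by norm_num)
      have h2 := hmono 14 55 (by norm_num)
      have h3 := hstep 20000 55 56 (by norm_num) rfl
      have h4 := hmono 56 59 (by norm_num)
      have h5 := hmono 46 59 (by norm_num)
      have h6 := hstep 10 59 60 (by norm_num) rfl
      have h7 := hmono 6 55 (by norm_num)
      calc M ^ 6 * (2 * (338 + 32 * (M ^ 6 * M + M ^ 48)) * (16 * M) + 1)
          = 10816 * M ^ 7 + 1024 * M ^ 14 + 1024 * M ^ 55 + M ^ 6 := by ring
        _ ≤ b := by omega)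
    (by
      have h1 : 2 * (96 * M ^ 6 * M * (16 * M) + 1) ≤ M ^ 9 := by
        have h2 := hstep 4000 8 9 (by norm_num) rfl
        have h3 := hmono 0 8 (by norm_num)
        rw [pow_zero] at h3
        calc 2 * (96 * M ^ 6 * M * (16 * M) + 1) = 3072 * M ^ 8 + 2 := by ring
          _ ≤ M ^ 9 := by omega
      calc _ ≤ (2 * M ^ 60 * (96 * M ^ 6 * M * (16 * M) + 1)) ^ 3 :=
            Nat.pow_le_pow_left (Nat.mul_le_mul_right _ (hbc.le.trans hcM')) 3
        _ = (M ^ 60 * (2 * (96 * M ^ 6 * M * (16 * M) + 1))) ^ 3 := by ring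
        _ ≤ (M ^ 60 * M ^ 9) ^ 3 := Nat.pow_le_pow_left (Nat.mul_le_mul_left _ h1) 3
        _ = M ^ 207 := by rw [← pow_add, ← pow_mul]
        _ ≤ M ^ 249 := hmono _ _ (by norm_num)
        _ ≤ 2 ^ M := pow_le_two_pow_self hM)
  set L := 96 * M * (16 * M) ^ 2 * (336 * (b / M ^ 6 + 1 + M ^ 6) +
    32 * M ^ 6 * (M ^ 6 * M + M ^ 48)) with hL
  have hLle : L ≤ M ^ 58 := by
    have h1 : b / M ^ 6 ≤ 2 * M ^ 54 := by
      refine Nat.div_le_of_le_mul ((hbc.le.trans hcM').trans (le_of_eq ?_))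
      ring
    have h2 : 336 * (b / M ^ 6 + 1 + M ^ 6) + 32 * M ^ 6 * (M ^ 6 * M + M ^ 48) ≤
        2000 * M ^ 54 := by
      have h3 := hmono 13 54 (by norm_num)
      have h4 := hmono 6 54 (by norm_num)
      have h5 := hmono 0 54 (by norm_num)
      have h6 : 32 * M ^ 6 * (M ^ 6 * M + M ^ 48) = 32 * M ^ 13 + 32 * M ^ 54 := by ring
      rw [pow_zero] at h5
      omega
    have h7 := hstep (24576 * 2000) 57 58 (by norm_num) rfl
    calc L ≤ 96 * M * (16 * M) ^ 2 * (2000 * M ^ 54) := Nat.mul_le_mul_left _ h2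
      _ = 24576 * 2000 * M ^ 57 := by ring
      _ ≤ M ^ 58 := h7
  have hnorm : ‖x * α ^ b + conj (x * α ^ b)‖ ≤ 4 * ‖α‖ ^ a := by
    have h1 : x * α ^ b + conj (x * α ^ b) = -((e₁ * lucasV A B a : ℤ) : ℂ) := by
      have h2 : (e₁ : ℂ) * lucasV A B a + e₂ * lucasV A B b + e₃ * lucasV A B c = 0 := by
        exact_mod_cast heq
      rw [lucasV_eq_pow_add_pow hs hp b, lucasV_eq_pow_add_pow hs hp c, hcd, pow_add, pow_add] at h2
      simp only [hx, map_mul, map_add, map_intCast, map_pow]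
      push_cast
      linear_combination h2
    rw [h1, norm_neg, Complex.norm_intCast]
    push_cast
    rw [abs_mul]
    calc |(e₁ : ℝ)| * |(lucasV A B a : ℝ)| ≤ 2 * (2 * ‖α‖ ^ a) :=
          mul_le_mul he.abs_cast_le.1 (abs_lucasV_le hs hp a) (abs_nonneg _) (by norm_num)
      _ = 4 * ‖α‖ ^ a := by ring
  have hgap2 : ‖α‖ ^ (b - a) < 2 ^ (L + 2) := by
    have h1 : ‖α‖ ^ (b - a) * ‖α‖ ^ a < 2 ^ (L + 2) * ‖α‖ ^ a :=
      calc ‖α‖ ^ (b - a) * ‖α‖ ^ a = ‖α‖ ^ b := by rw [← pow_add, Nat.sub_add_cancel hab.le]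
        _ ≤ ‖x‖ * ‖α‖ ^ b := le_mul_of_one_le_left (by positivity) hx1
        _ < ‖x * α ^ b + conj (x * α ^ b)‖ * 2 ^ L := hbk
        _ ≤ 4 * ‖α‖ ^ a * 2 ^ L := by gcongr
        _ = 2 ^ (L + 2) * ‖α‖ ^ a := by ring
    exact lt_of_mul_lt_mul_right h1 (by positivity)
  have h1 := lt_two_mul_of_pow_lt (norm_nonneg _) hQ2 hgap2
  omega

/-- If the roots are small compared with the largest index, there is no progression. -/
theorem no_progression_of_norm_le (hA : A ≠ 0) (hB : B ≠ 0) (hs : α + conj α = A)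
    (hp : α * conj α = -(B : ℂ)) (hω : ∀ n : ℕ, 0 < n → (α / conj α) ^ n ≠ 1)
    (hex : (A, B) ≠ (-1, -2))
    {e₁ e₂ e₃ : ℤ} (he : IsProgressionCoeff e₁ e₂ e₃) {a b c : ℕ} (hab : a < b) (hbc : b < c)
    (heq : e₁ * lucasV A B a + e₂ * lucasV A B b + e₃ * lucasV A B c = 0)
    {M : ℕ} (hM : 2 ^ 38 ≤ M) (hcM : M ^ 60 ≤ c) (hcM' : c ≤ 2 * M ^ 60) (hQ : ‖α‖ ≤ 2 ^ M) :
    False := by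
  have hgap := index_gap_le hA hB hs hp hω he hab hbc heq hM hcM hcM' hQ
  have hgap' := index_gap_le_of_norm_le hA hB hs hp hω he hab hbc heq hM hcM hcM' hQ hgap
  have hα := sq_eq_of_add_conj hs hp
  have hα0 := ne_zero_of_mul_conj hB hp
  have hαm := mem_quadraticSubring_self hα
  have hQ1 : 1 ≤ ‖α‖ := one_le_norm_of_mem hs hp hα hαm hα0
  have hM0 : 0 < M := lt_of_lt_of_le (by norm_num) hM
  have hmono : ∀ i k : ℕ, i ≤ k → M ^ i ≤ M ^ k := fun i k h => Nat.pow_le_pow_right hM0 h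
  have hstep : ∀ C k l : ℕ, C ≤ 2 ^ 38 → l = k + 1 → C * M ^ k ≤ M ^ l := fun C k l h hl => by
    rw [hl, pow_succ']
    exact Nat.mul_le_mul_right _ (h.trans hM)
  obtain ⟨s, hs'⟩ : ∃ s, s = b - a := ⟨_, rfl⟩
  obtain ⟨d, hd⟩ : ∃ d, d = c - b := ⟨_, rfl⟩
  have hb : b = s + a := by omega
  have hc : c = s + d + a := by omega
  rw [← hd] at hgap
  rw [← hs'] at hgap'
  set X : ℂ := e₁ + e₂ * α ^ s + e₃ * α ^ (s + d) with hX
  have hX0 : X ≠ 0 := he.add_mul_pow_ne_zero hA hB hs hp hω hex (by omega) (by omega)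
  have hXm : X ∈ quadraticSubring hα :=
    Subring.add_mem _ (Subring.add_mem _ (intCast_mem _ _) (Subring.mul_mem _ (intCast_mem _ _)
      (Subring.pow_mem _ hαm _))) (Subring.mul_mem _ (intCast_mem _ _) (Subring.pow_mem _ hαm _))
  have hXa : X * α ^ a + conj (X * α ^ a) = 0 := by
    have h2 : (e₁ : ℂ) * lucasV A B a + e₂ * lucasV A B b + e₃ * lucasV A B c = 0 := by
      exact_mod_cast heq
    rw [lucasV_eq_pow_add_pow hs hp a, lucasV_eq_pow_add_pow hs hp b,
      lucasV_eq_pow_add_pow hs hp c, hb, hc, pow_add _ (s + d), pow_add _ s a,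
      pow_add _ (s + d), pow_add _ s a] at h2
    simp only [hX, map_mul, map_add, map_intCast, map_pow]
    linear_combination h2
  have h2a := two_pow_le_norm_sq hA hB hs hp hω hα hXm hX0 hXa
  have hXn : ‖X‖ ≤ 2 ^ (M * (s + d) + 2) := by
    obtain ⟨-, -, -, h4⟩ := he.abs_cast_le
    have h5 : 1 ≤ ‖α‖ ^ (s + d) := one_le_pow₀ hQ1
    have h6 : ‖α‖ ^ s ≤ ‖α‖ ^ (s + d) := pow_le_pow_right₀ hQ1 (by omega)
    calc ‖X‖ ≤ |(e₁ : ℝ)| + |(e₂ : ℝ)| * ‖α‖ ^ s + |(e₃ : ℝ)| * ‖α‖ ^ (s + d) := by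
          refine (norm_add₃_le).trans (le_of_eq ?_)
          rw [norm_mul, norm_mul, norm_pow, norm_pow, Complex.norm_intCast, Complex.norm_intCast,
            Complex.norm_intCast]
      _ ≤ |(e₁ : ℝ)| * ‖α‖ ^ (s + d) + |(e₂ : ℝ)| * ‖α‖ ^ (s + d) +
          |(e₃ : ℝ)| * ‖α‖ ^ (s + d) := by
          gcongr
          exact le_mul_of_one_le_right (abs_nonneg _) h5
      _ = 4 * ‖α‖ ^ (s + d) := by rw [← h4]; ring
      _ ≤ 4 * (2 ^ M) ^ (s + d) := by gcongr
      _ = 2 ^ (M * (s + d) + 2) := by rw [← pow_mul]; ring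
  have h3 : (2 : ℝ) ^ a ≤ 2 ^ (2 * (M * (s + d) + 2)) :=
    calc (2 : ℝ) ^ a ≤ ‖X‖ ^ 2 := h2a
      _ ≤ (2 ^ (M * (s + d) + 2)) ^ 2 := by gcongr
      _ = _ := by rw [← pow_mul, mul_comm]
  have ha : a ≤ 2 * (M * (s + d) + 2) := (pow_le_pow_iff_right₀ (by norm_num)).1 h3
  have hsd : s + d ≤ 3 * M ^ 58 := by
    have h4 := hmono 46 57 (by norm_num)
    have h5 := hmono 0 57 (by norm_num)
    have h6 := hstep 100 57 58 (by norm_num) rfl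
    rw [pow_zero] at h5
    omega
  have hMsd : M * (s + d) ≤ 3 * M ^ 59 :=
    (Nat.mul_le_mul_left _ hsd).trans (le_of_eq (by ring))
  have h4 := hmono 58 59 (by norm_num)
  have h5 := hmono 0 59 (by norm_num)
  have h6 := hstep 100 59 60 (by norm_num) rfl
  rw [pow_zero] at h5
  omega

end BoundedNorm

theorem exists_abs_cos_eq_abs_sin (x : ℝ) :
    ∃ j : ℤ, |x - Real.pi / 2 - j * Real.pi| ≤ Real.pi / 2 ∧
      |Real.cos x| = |Real.sin (x - Real.pi / 2 - j * Real.pi)| := by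
  have hpi := Real.pi_pos
  refine ⟨round ((x - Real.pi / 2) / Real.pi), ?_, ?_⟩
  · have h := abs_sub_round ((x - Real.pi / 2) / Real.pi)
    set j := round ((x - Real.pi / 2) / Real.pi)
    have h2 : x - Real.pi / 2 - j * Real.pi = ((x - Real.pi / 2) / Real.pi - j) * Real.pi := by
      field_simp
    rw [h2, abs_mul, abs_of_pos hpi]
    nlinarith
  · rw [Real.sin_sub_int_mul_pi, Real.sin_sub_pi_div_two, abs_mul, abs_neg, abs_zpow]
    simp

theorem abs_cos_add_of_cos_eq_zero {x y : ℝ} (hx : Real.cos x = 0) :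
    |Real.cos (x + y)| = |Real.sin y| := by
  have h := Real.sin_sq_add_cos_sq x
  have h1 : |Real.sin x| = 1 := by
    rw [hx] at h
    rw [← pow_eq_one_iff_of_nonneg (abs_nonneg _) two_ne_zero, sq_abs]
    linarith
  rw [Real.cos_add, hx, zero_mul, zero_sub, abs_neg, abs_mul, h1, one_mul]

/-- The angle `ψ` is a small perturbation, by `τ`, of an angle `ψ₀` for which each `cos (n * ψ₀)`,
`n ≤ Y`, is zero or not too small. -/
structure IsNearRational (Q ψ ψ₀ τ : ℝ) (Y : ℕ) : Prop where
  pow_lt : (Y : ℝ) ^ 4 < Q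
  le : 2000 ≤ Y
  eq_add : ψ = ψ₀ + τ
  ne_zero : τ ≠ 0
  abs_mul_le : Y * |τ| * Q ≤ 7
  cos_eq_zero_or (n : ℕ) : n ≤ Y → Real.cos (n * ψ₀) = 0 ∨ 1 ≤ 2 * Y * |Real.cos (n * ψ)|

theorem exists_isNearRational {Q ψ : ℝ} {c : ℕ} (hc : 2000 ≤ c) (hcQ : (c : ℝ) ^ 4 < Q)
    (h0 : Real.cos (c * ψ) ≠ 0) (h : |Real.cos (c * ψ)| * Q ≤ 4) :
    ∃ ψ₀ τ, IsNearRational Q ψ ψ₀ τ c ∧ Real.cos (c * ψ₀) = 0 := by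
  have hpi := Real.pi_pos
  have hpi4 := Real.pi_lt_d2
  have hc' : (2000 : ℝ) ≤ c := by exact_mod_cast hc
  have hc0 : (0 : ℝ) < c := by linarith
  have hQ : 0 < Q := lt_of_le_of_lt (by positivity) hcQ
  obtain ⟨j, hj, hj'⟩ := exists_abs_cos_eq_abs_sin (c * ψ)
  set δ := c * ψ - Real.pi / 2 - j * Real.pi with hδ
  have hδ1 := Real.mul_abs_le_abs_sin hj
  rw [← hj'] at hδ1
  have hδ2 : |δ| * Q ≤ 7 := by
    have h1 : |δ| ≤ Real.pi / 2 * |Real.cos (c * ψ)| := by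
      calc |δ| = Real.pi / 2 * (2 / Real.pi * |δ|) := by field_simp
        _ ≤ _ := by gcongr
    calc |δ| * Q ≤ Real.pi / 2 * |Real.cos (c * ψ)| * Q := by gcongr
      _ = Real.pi / 2 * (|Real.cos (c * ψ)| * Q) := by ring
      _ ≤ Real.pi / 2 * 4 := by gcongr
      _ ≤ 7 := by linarith
  have hcδ : c * |δ / c| = |δ| := by
    rw [abs_div, abs_of_pos hc0]; field_simp
  have hψ₀ : c * (ψ - δ / c) = Real.pi / 2 + j * Real.pi := by
    rw [hδ]; field_simp; ring
  refine ⟨ψ - δ / c, δ / c, ⟨hcQ, hc, by ring, ?_, by rw [hcδ]; exact hδ2, fun n hn => ?_⟩, ?_⟩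
  · rw [div_ne_zero_iff]
    refine ⟨fun h1 => h0 ?_, hc0.ne'⟩
    rw [h1, Real.sin_zero, abs_zero] at hj'
    exact abs_eq_zero.1 hj'
  · obtain ⟨i, hi, hi'⟩ := exists_abs_cos_eq_abs_sin (n * (ψ - δ / c))
    have hi2 := Real.mul_abs_le_abs_sin hi
    have h1 : n * (ψ - δ / c) - Real.pi / 2 - i * Real.pi =
        Real.pi / 2 / c * ((n * (2 * j + 1) - c * (2 * i + 1) : ℤ) : ℝ) := by
      have : ψ - δ / c = (Real.pi / 2 + j * Real.pi) / c := by
        rw [← hψ₀]; field_simp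
      rw [this]; push_cast; field_simp; ring
    set t : ℤ := n * (2 * j + 1) - c * (2 * i + 1)
    rcases eq_or_ne t 0 with ht | ht
    · left
      rw [h1, ht] at hi'
      simpa using hi'
    · right
      have ht1 : (1 : ℝ) ≤ |(t : ℝ)| := by exact_mod_cast Int.one_le_abs ht
      rw [← hi', h1, abs_mul, abs_of_pos (by positivity)] at hi2
      have h2 : 1 ≤ c * |Real.cos (n * (ψ - δ / c))| := by
        calc (1 : ℝ) ≤ |(t : ℝ)| := ht1
          _ = c * (2 / Real.pi * (Real.pi / 2 / c * |(t : ℝ)|)) := by field_simp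
          _ ≤ _ := by gcongr
      have h3 := Real.abs_cos_sub_cos_le (n * ψ) (n * (ψ - δ / c))
      have h4 : |n * ψ - n * (ψ - δ / c)| ≤ |δ| := by
        rw [show n * ψ - n * (ψ - δ / c) = n * (δ / c) by ring, abs_mul, Nat.abs_cast, ← hcδ]
        gcongr
      have h5 := abs_sub_abs_le_abs_sub (Real.cos (n * (ψ - δ / c))) (Real.cos (n * ψ))
      rw [abs_sub_comm] at h5
      have h6 : c * |δ| ≤ 1 / 2 := by
        have h7 : (2000 : ℝ) ^ 3 * c ≤ c ^ 4 := by
          rw [show (c : ℝ) ^ 4 = c ^ 3 * c by ring]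
          gcongr
        have h8 : 2000 ^ 3 * (c * |δ|) ≤ 7 := by
          calc 2000 ^ 3 * (c * |δ|) = 2000 ^ 3 * c * |δ| := by ring
            _ ≤ Q * |δ| := by gcongr; linarith
            _ ≤ 7 := by linarith
        linarith
      nlinarith
  · rw [hψ₀, Real.cos_add_int_mul_pi]
    simp

namespace IsNearRational

variable {Q ψ ψ₀ τ : ℝ} {Y : ℕ}

theorem cast_le (h : IsNearRational Q ψ ψ₀ τ Y) : (2000 : ℝ) ≤ Y := by exact_mod_cast h.le

theorem lt_norm (h : IsNearRational Q ψ ψ₀ τ Y) : 4000000 * (Y : ℝ) ^ 2 < Q := by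
  have h1 := h.cast_le
  have h2 := h.pow_lt
  nlinarith [mul_self_nonneg (Y : ℝ), mul_le_mul h1 h1 (by norm_num) (by linarith)]

theorem norm_pos (h : IsNearRational Q ψ ψ₀ τ Y) : 16000000000000 < Q := by
  have h1 := h.cast_le
  have h2 := h.lt_norm
  nlinarith

theorem abs_cos_bounds (h : IsNearRational Q ψ ψ₀ τ Y) {n : ℕ} (hn : n ≤ Y)
    (h0 : Real.cos (n * ψ₀) = 0) :
    n * |τ| ≤ 2 * |Real.cos (n * ψ)| ∧ |Real.cos (n * ψ)| ≤ n * |τ| := by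
  have hpi := Real.pi_pos
  have hpi4 := Real.pi_lt_d2
  have hpi3 := Real.pi_gt_three
  have hQ := h.norm_pos
  have h1 : |Real.cos (n * ψ)| = |Real.sin (n * τ)| := by
    rw [h.eq_add, mul_add, abs_cos_add_of_cos_eq_zero h0]
  have h2 : |n * τ| = n * |τ| := by rw [abs_mul, Nat.abs_cast]
  have h3 : n * |τ| ≤ 1 := by
    have h4 : n * |τ| ≤ Y * |τ| := by gcongr
    have h5 := h.abs_mul_le
    have h6 : 0 ≤ Y * |τ| := by positivity
    nlinarith
  rw [h1]
  refine ⟨?_, h2 ▸ Real.abs_sin_le_abs⟩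
  have h4 := Real.mul_abs_le_abs_sin (x := n * τ) (by rw [h2]; linarith)
  rw [h2] at h4
  have h5 : 1 / 2 ≤ 2 / Real.pi := by
    rw [div_le_div_iff₀ (by norm_num) hpi]; linarith
  have h6 : 0 ≤ n * |τ| := by positivity
  nlinarith

theorem abs_cos_sq_mul_lt_one_iff (h : IsNearRational Q ψ ψ₀ τ Y) {n : ℕ} (hn : n ≤ Y) :
    |Real.cos (n * ψ)| ^ 2 * Q < 1 ↔ Real.cos (n * ψ₀) = 0 := by
  have hQ := h.norm_pos
  have hY := h.cast_le
  constructor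
  · intro h1
    refine (h.cos_eq_zero_or n hn).resolve_right fun h2 => ?_
    have h3 : 1 ≤ (2 * Y * |Real.cos (n * ψ)|) ^ 2 := one_le_pow₀ h2
    have h4 := h.lt_norm
    have h5 : 4000000 * (Y : ℝ) ^ 2 * |Real.cos (n * ψ)| ^ 2 ≤ Q * |Real.cos (n * ψ)| ^ 2 := by
      gcongr
    nlinarith
  · intro h1
    have h2 : |Real.cos (n * ψ)| * Q ≤ 7 := by
      refine le_trans ?_ h.abs_mul_le
      have : (n : ℝ) * |τ| ≤ Y * |τ| := by gcongr
      exact mul_le_mul_of_nonneg_right ((h.abs_cos_bounds hn h1).2.trans this) (by linarith)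
    have h3 : (|Real.cos (n * ψ)| * Q) ^ 2 ≤ 7 ^ 2 := by
      gcongr
    by_contra! h4
    nlinarith

/-- If `cos (n * ψ₀)` and `cos (m * ψ₀)` are either both zero or both nonzero, then
`Q ^ n * cos (n * ψ)` and `Q ^ m * cos (m * ψ)` can only agree if `n = m`. -/
theorem le_of_pow_mul_cos_eq (h : IsNearRational Q ψ ψ₀ τ Y) {n m : ℕ} (hn : n ≤ Y) (hm : m ≤ Y)
    (hnm : Real.cos (n * ψ₀) = 0 ↔ Real.cos (m * ψ₀) = 0)
    (heq : Q ^ n * Real.cos (n * ψ) = Q ^ m * Real.cos (m * ψ)) : m ≤ n := by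
  by_contra! hlt
  have hQ := h.norm_pos
  have hY := h.cast_le
  have hQn : 0 < Q ^ n := by positivity
  have h1 : |Real.cos (n * ψ)| = Q ^ (m - n) * |Real.cos (m * ψ)| := by
    have h2 := congrArg abs heq
    have hQm : 0 < Q ^ m := by positivity
    rw [abs_mul, abs_mul, abs_of_pos hQn, abs_of_pos hQm] at h2
    refine mul_left_cancel₀ hQn.ne' (h2.trans ?_)
    rw [← mul_assoc, ← pow_add, Nat.add_sub_cancel' hlt.le]
  have h2 : Q * |Real.cos (m * ψ)| ≤ |Real.cos (n * ψ)| := by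
    rw [h1]
    gcongr
    exact le_self_pow₀ (by linarith) (by omega)
  have hτ : 0 < |τ| := abs_pos.2 h.ne_zero
  by_cases h0 : Real.cos (n * ψ₀) = 0
  · have h3 := (h.abs_cos_bounds hn h0).2
    have h4 := (h.abs_cos_bounds hm (hnm.1 h0)).1
    have h5 : (n : ℝ) * |τ| < m * |τ| := by gcongr
    have h6 := abs_nonneg (Real.cos (m * ψ))
    nlinarith
  · have h3 := (h.cos_eq_zero_or m hm).resolve_left fun h4 => h0 (hnm.2 h4)
    have h4 := Real.abs_cos_le_one (n * ψ)
    have h5 : 4000000 * (Y : ℝ) ^ 2 * |Real.cos (m * ψ)| ≤ Q * |Real.cos (m * ψ)| := by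
      gcongr
      exact h.lt_norm.le
    nlinarith

/-- The terms with indices `e` and `c`, of which only the latter is near a zero of the cosine,
almost cancel. -/
structure IsRegularPair (Q ψ ψ₀ : ℝ) (e c : ℕ) (u v : ℝ) : Prop where
  lt : e < c
  cos_eq_zero : Real.cos (c * ψ₀) = 0
  cos_ne_zero : Real.cos (e * ψ₀) ≠ 0
  abs_mul_le : |u * Q ^ (c - e) * Real.cos (c * ψ) + v * Real.cos (e * ψ)| * Q ≤ 16

end IsNearRational

theorem IsProgressionCoeff.one_le_abs {e₁ e₂ e₃ : ℤ} (he : IsProgressionCoeff e₁ e₂ e₃) :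
    1 ≤ |(e₁ : ℝ)| ∧ 1 ≤ |(e₂ : ℝ)| ∧ 1 ≤ |(e₃ : ℝ)| := by
  rcases he with ⟨rfl, rfl, rfl⟩ | ⟨rfl, rfl, rfl⟩ | ⟨rfl, rfl, rfl⟩ <;> norm_num

theorem IsProgressionCoeff.abs_cos_mul_le {e₁ e₂ e₃ : ℤ} (he : IsProgressionCoeff e₁ e₂ e₃)
    {Q ψ : ℝ} (hQ : 1 ≤ Q) {a b c : ℕ} (hab : a < b) (hbc : b < c)
    (heq : e₁ * (Q ^ a * Real.cos (a * ψ)) + e₂ * (Q ^ b * Real.cos (b * ψ)) +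
      e₃ * (Q ^ c * Real.cos (c * ψ)) = 0) : |Real.cos (c * ψ)| * Q ≤ 4 := by
  have h1 := he.abs_last_le heq
  have hQ0 : 0 < Q := by linarith
  rw [abs_mul, abs_mul, abs_mul, abs_of_pos (pow_pos hQ0 _), abs_of_pos (pow_pos hQ0 _),
    abs_of_pos (pow_pos hQ0 _)] at h1
  have h2 : ∀ n < c, Q ^ n * |Real.cos (n * ψ)| ≤ Q ^ (c - 1) := fun n hn =>
    calc Q ^ n * |Real.cos (n * ψ)| ≤ Q ^ n * 1 := by gcongr; exact Real.abs_cos_le_one _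
      _ = Q ^ n := mul_one _
      _ ≤ Q ^ (c - 1) := pow_le_pow_right₀ hQ (by omega)
  have h3 := h2 a (by omega)
  have h4 := h2 b hbc
  have h5 : Q ^ c = Q ^ (c - 1) * Q := by rw [← pow_succ]; congr 1; omega
  rw [h5] at h1
  have h6 : 0 < Q ^ (c - 1) := pow_pos hQ0 _
  refine le_of_mul_le_mul_left (a := Q ^ (c - 1)) ?_ h6
  linarith

namespace IsNearRational

variable {Q ψ ψ₀ τ : ℝ} {Y : ℕ}

theorem abs_cos_le_two_mul (h : IsNearRational Q ψ ψ₀ τ Y) {n m : ℕ} (hnm : n ≤ m) (hm : m ≤ Y)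
    (hn0 : Real.cos (n * ψ₀) = 0) (hm0 : Real.cos (m * ψ₀) = 0) :
    |Real.cos (n * ψ)| ≤ 2 * |Real.cos (m * ψ)| := by
  refine ((h.abs_cos_bounds (hnm.trans hm) hn0).2.trans ?_).trans (h.abs_cos_bounds hm hm0).1
  gcongr

theorem isRegularPair (h : IsNearRational Q ψ ψ₀ τ Y) {e₁ e₂ e₃ : ℤ}
    (he : IsProgressionCoeff e₁ e₂ e₃) {a b c : ℕ} (hab : a < b) (hbc : b < c) (hc : c ≤ Y)
    (heq : e₁ * (Q ^ a * Real.cos (a * ψ)) + e₂ * (Q ^ b * Real.cos (b * ψ)) +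
      e₃ * (Q ^ c * Real.cos (c * ψ)) = 0) :
    (Real.cos (b * ψ₀) ≠ 0 → IsRegularPair Q ψ ψ₀ b c e₃ e₂) ∧
    (Real.cos (b * ψ₀) = 0 → IsRegularPair Q ψ ψ₀ a c e₃ e₁) := by
  have hQ := h.norm_pos
  have hQ0 : 0 < Q := by linarith
  obtain ⟨l1, l2, l3⟩ := he.one_le_abs
  obtain ⟨u1, u2, u3, -⟩ := he.abs_cast_le
  have hcQ := he.abs_cos_mul_le (by linarith) hab hbc heq
  have hc0 : Real.cos (c * ψ₀) = 0 := by
    rw [← h.abs_cos_sq_mul_lt_one_iff hc]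
    have h1 : (|Real.cos (c * ψ)| * Q) ^ 2 ≤ 4 ^ 2 := by gcongr
    by_contra! h2
    nlinarith
  refine ⟨fun hb => ⟨hbc, hc0, hb, ?_⟩, fun hb => ?_⟩
  · have h1 : e₃ * Q ^ (c - b) * Real.cos (c * ψ) + e₂ * Real.cos (b * ψ) =
        -(e₁ * Real.cos (a * ψ)) / Q ^ (b - a) := by
      rw [eq_div_iff (by positivity)]
      refine mul_left_cancel₀ (pow_ne_zero a hQ0.ne') ?_
      have h2 : Q ^ b = Q ^ a * Q ^ (b - a) := by rw [← pow_add]; congr 1; omega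
      have h3 : Q ^ c = Q ^ a * Q ^ (b - a) * Q ^ (c - b) := by
        rw [← pow_add, ← pow_add]; congr 1; omega
      rw [h2, h3] at heq
      linear_combination heq
    have h2 : Q ≤ Q ^ (b - a) := le_self_pow₀ (by linarith) (by omega)
    rw [h1, abs_div, abs_neg, abs_mul, abs_of_pos (pow_pos hQ0 _), div_mul_eq_mul_div,
      div_le_iff₀ (by positivity)]
    have h3 := Real.abs_cos_le_one (a * ψ)
    have h4 : |(e₁ : ℝ)| * |Real.cos (a * ψ)| ≤ 2 * 1 := by gcongr
    nlinarith
  · set Z := Q ^ (c - a) * |Real.cos (c * ψ)| with hZ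
    have hcos : 0 < |Real.cos (c * ψ)| := by
      have h1 := (h.abs_cos_bounds hc hc0).1
      have h2 : 0 < |τ| := abs_pos.2 h.ne_zero
      have h3 : (0 : ℝ) < c := by exact_mod_cast (by omega : 0 < c)
      have := mul_pos h3 h2
      linarith
    have hZ0 : 0 < Z := by positivity
    have h1 : e₃ * Q ^ (c - a) * Real.cos (c * ψ) + e₁ * Real.cos (a * ψ) =
        -(e₂ * Q ^ (b - a) * Real.cos (b * ψ)) := by
      refine mul_left_cancel₀ (pow_ne_zero a hQ0.ne') ?_
      have h2 : Q ^ b = Q ^ a * Q ^ (b - a) := by rw [← pow_add]; congr 1; omega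
      have h3 : Q ^ c = Q ^ a * Q ^ (c - a) := by rw [← pow_add]; congr 1; omega
      rw [h2, h3] at heq
      linear_combination heq
    have h2 : |-(e₂ * Q ^ (b - a) * Real.cos (b * ψ))| * Q ≤ 4 * Z := by
      rw [abs_neg, abs_mul, abs_mul, abs_of_pos (pow_pos hQ0 _)]
      have h3 := h.abs_cos_le_two_mul hbc.le hc hb hc0
      have h4 : Q ^ (b - a) * Q ≤ Q ^ (c - a) := by
        rw [← pow_succ]; exact pow_le_pow_right₀ (by linarith) (by omega)
      calc |(e₂ : ℝ)| * Q ^ (b - a) * |Real.cos (b * ψ)| * Q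
          ≤ 2 * Q ^ (b - a) * (2 * |Real.cos (c * ψ)|) * Q := by gcongr
        _ = 4 * (Q ^ (b - a) * Q) * |Real.cos (c * ψ)| := by ring
        _ ≤ 4 * Q ^ (c - a) * |Real.cos (c * ψ)| := by gcongr
        _ = 4 * Z := by rw [hZ]; ring
    have h3 : Z ≤ 2 * |Real.cos (a * ψ)| + |-(e₂ * Q ^ (b - a) * Real.cos (b * ψ))| := by
      have h4 : |e₃ * Q ^ (c - a) * Real.cos (c * ψ)| = |(e₃ : ℝ)| * Z := by
        rw [abs_mul, abs_mul, abs_of_pos (pow_pos hQ0 _), hZ, mul_assoc]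
      have h5 := abs_sub (-(e₂ * Q ^ (b - a) * Real.cos (b * ψ))) (e₁ * Real.cos (a * ψ))
      rw [← h1, add_sub_cancel_right, h4, abs_mul (e₁ : ℝ), h1] at h5
      have h6 : |(e₁ : ℝ)| * |Real.cos (a * ψ)| ≤ 2 * |Real.cos (a * ψ)| := by gcongr
      have h7 : 1 * Z ≤ |(e₃ : ℝ)| * Z := by gcongr
      linarith
    refine ⟨by omega, hc0, fun ha => ?_, ?_⟩
    · have h4 := h.abs_cos_le_two_mul (hab.trans hbc).le hc ha hc0
      have h5 : Q * |Real.cos (c * ψ)| ≤ Z := by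
        rw [hZ]
        gcongr
        exact le_self_pow₀ (by linarith) (by omega)
      nlinarith
    · rw [h1]
      refine h2.trans ?_
      have h4 := Real.abs_cos_le_one (a * ψ)
      nlinarith

end IsNearRational

theorem quarter_le_sin_sub_sin {x y t : ℝ} (ht : 0 ≤ t) (hx : 0 ≤ x) (hxy : x + t ≤ y)
    (hy : y ≤ 1) : t / 4 ≤ Real.sin y - Real.sin x := by
  have hpi := Real.pi_gt_three
  have hpi4 := Real.pi_lt_d2
  rw [Real.sin_sub_sin]
  have h1 := Real.mul_le_sin (x := (y - x) / 2) (by linarith) (by linarith)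
  have h2 := Real.one_sub_sq_div_two_le_cos (x := (y + x) / 2)
  have h3 : 1 / 2 ≤ Real.cos ((y + x) / 2) := by nlinarith
  have h5 : 1 / 2 ≤ 2 / Real.pi := by
    rw [div_le_div_iff₀ (by norm_num) (by linarith)]; linarith
  have h6 : t / 4 ≤ Real.sin ((y - x) / 2) := by nlinarith
  nlinarith

namespace IsNearRational

variable {Q ψ ψ₀ τ : ℝ} {Y e c e' c' : ℕ} {u v : ℝ}

theorem IsRegularPair.bounds (hp : IsRegularPair Q ψ ψ₀ e c u v) (h : IsNearRational Q ψ ψ₀ τ Y)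
    (hc : c ≤ Y) (hu : 1 ≤ |u| ∧ |u| ≤ 2) (hv : 1 ≤ |v| ∧ |v| ≤ 2) :
    1 ≤ 8 * (Y : ℝ) ^ 2 * (Q ^ (c - e) * |τ|) ∧ Q ^ (c - e) * |τ| ≤ 6 := by
  have hQ := h.norm_pos
  have hQ0 : 0 < Q := by linarith
  have hY := h.cast_le
  have hec := hp.lt
  obtain ⟨b1, b2⟩ := h.abs_cos_bounds hc hp.cos_eq_zero
  have hc0 : (1 : ℝ) ≤ c := by exact_mod_cast (by omega : 1 ≤ c)
  have hcY : (c : ℝ) ≤ Y := by exact_mod_cast hc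
  have hne := (h.cos_eq_zero_or e (by omega)).resolve_left hp.cos_ne_zero
  have hle := hp.abs_mul_le
  have hp' : 0 < Q ^ (c - e) := pow_pos hQ0 _
  set P := Q ^ (c - e)
  have hP : |u * P * Real.cos (c * ψ)| = |u| * (P * |Real.cos (c * ψ)|) := by
    rw [abs_mul, abs_mul, abs_of_pos hp', mul_assoc]
  have h1 := abs_sub_abs_le_abs_sub (u * P * Real.cos (c * ψ)) (-(v * Real.cos (e * ψ)))
  have h2 := abs_sub_abs_le_abs_sub (-(v * Real.cos (e * ψ))) (u * P * Real.cos (c * ψ))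
  rw [abs_sub_comm] at h2
  rw [sub_neg_eq_add, hP, abs_neg, abs_mul] at h1 h2
  set R := |u * P * Real.cos (c * ψ) + v * Real.cos (e * ψ)|
  have hR0 : 0 ≤ R := abs_nonneg _
  have hτ : 0 < |τ| := abs_pos.2 h.ne_zero
  have hPτ : 0 < P * |τ| := by positivity
  have hPc : 0 ≤ P * |Real.cos (c * ψ)| := by positivity
  have hcos := Real.abs_cos_le_one (e * ψ)
  have hcos0 := abs_nonneg (Real.cos (e * ψ))
  have k1 : P * |τ| ≤ 2 * (P * |Real.cos (c * ψ)|) := by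
    calc P * |τ| = P * (1 * |τ|) := by ring
      _ ≤ P * (c * |τ|) := by gcongr
      _ ≤ P * (2 * |Real.cos (c * ψ)|) := by gcongr
      _ = _ := by ring
  have k2 : P * |Real.cos (c * ψ)| ≤ Y * (P * |τ|) := by
    calc P * |Real.cos (c * ψ)| ≤ P * (Y * |τ|) := by
          gcongr
          exact b2.trans (by gcongr)
      _ = _ := by ring
  have k3 : 1 * (P * |Real.cos (c * ψ)|) ≤ |u| * (P * |Real.cos (c * ψ)|) := by
    gcongr; exact hu.1
  have k4 : |u| * (P * |Real.cos (c * ψ)|) ≤ 2 * (P * |Real.cos (c * ψ)|) := by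
    gcongr; exact hu.2
  have k5 : 1 * |Real.cos (e * ψ)| ≤ |v| * |Real.cos (e * ψ)| := by gcongr; exact hv.1
  have k6 : |v| * |Real.cos (e * ψ)| ≤ 2 * |Real.cos (e * ψ)| := by gcongr; exact hv.2
  constructor
  · have hQY := h.lt_norm
    have m1 : 4 * (Y : ℝ) * R ≤ 1 := by nlinarith
    have m2 : |Real.cos (e * ψ)| ≤ R + 2 * (Y * (P * |τ|)) := by linarith
    have m3 : 2 * Y * |Real.cos (e * ψ)| ≤ 2 * Y * (R + 2 * (Y * (P * |τ|))) := by gcongr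
    nlinarith
  · nlinarith

theorem IsRegularPair.sub_le_sub (hp : IsRegularPair Q ψ ψ₀ e c u v)
    (hp' : IsRegularPair Q ψ ψ₀ e' c' u v) (h : IsNearRational Q ψ ψ₀ τ Y)
    (hc : c ≤ Y) (hc' : c' ≤ Y) (hu : 1 ≤ |u| ∧ |u| ≤ 2) (hv : 1 ≤ |v| ∧ |v| ≤ 2) :
    c' - e' ≤ c - e := by
  by_contra! hlt
  have h1 := (hp.bounds h hc hu hv).1
  have h2 := (hp'.bounds h hc' hu hv).2
  have hQ := h.norm_pos
  have hQY := h.lt_norm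
  have h3 : Q ^ (c - e) * Q ≤ Q ^ (c' - e') := by
    rw [← pow_succ]
    exact pow_le_pow_right₀ (by linarith) hlt
  have h4 : Q ^ (c - e) * Q * |τ| ≤ Q ^ (c' - e') * |τ| := by gcongr
  have h5 : 0 ≤ Q ^ (c - e) * |τ| := by positivity
  nlinarith

theorem IsRegularPair.index_le (hp : IsRegularPair Q ψ ψ₀ e c u v)
    (hp' : IsRegularPair Q ψ ψ₀ e' c' u v) (h : IsNearRational Q ψ ψ₀ τ Y)
    (hc : c ≤ Y) (hc' : c' ≤ Y) (hu : 1 ≤ |u| ∧ |u| ≤ 2) (hv : 1 ≤ |v| ∧ |v| ≤ 2) :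
    c' ≤ c := by
  by_contra! hlt
  have hQ := h.norm_pos
  have hQ0 : 0 < Q := by linarith
  have hQY := h.lt_norm
  have hY := h.cast_le
  have hd : c' - e' = c - e :=
    le_antisymm (hp.sub_le_sub hp' h hc hc' hu hv) (hp'.sub_le_sub hp h hc' hc hu hv)
  obtain ⟨d, hd'⟩ : ∃ d, d = c - e := ⟨_, rfl⟩
  have hlo := (hp.bounds h hc hu hv).1
  have hle := hp.abs_mul_le
  have hle' := hp'.abs_mul_le
  have hτ : 0 < |τ| := abs_pos.2 h.ne_zero
  have hYτ : Y * |τ| * Q ≤ 7 := h.abs_mul_le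
  rw [hd, ← hd'] at hle'
  rw [← hd'] at hle hlo
  have key : ∀ c e : ℕ, e < c → d = c - e → c ≤ Y → Real.cos (c * ψ₀) = 0 →
      |Real.cos (c * ψ)| = Real.sin (c * |τ|) ∧
        |Real.cos (e * ψ)| = |Real.sin (c * τ - d * ψ)| := by
    intro c e hec hd hc h0
    constructor
    · have h1 : c * |τ| ≤ 1 := by
        have h2 : c * |τ| ≤ Y * |τ| := by gcongr
        have h3 : 0 ≤ Y * |τ| := by positivity
        nlinarith
      have hpi := Real.pi_gt_three
      have h2 : 0 ≤ Real.sin (c * |τ|) :=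
        Real.sin_nonneg_of_nonneg_of_le_pi (by positivity) (by linarith)
      rw [h.eq_add, mul_add, abs_cos_add_of_cos_eq_zero h0, ← abs_of_nonneg h2]
      rcases abs_choice τ with h3 | h3 <;> rw [h3]
      rw [mul_neg, Real.sin_neg, abs_neg]
    · rw [← abs_cos_add_of_cos_eq_zero h0]
      have h1 : (c : ℝ) = e + d := by exact_mod_cast (by omega : c = e + d)
      have h2 : (e : ℝ) * ψ = c * ψ₀ + (c * τ - d * ψ) := by
        rw [h.eq_add, h1]; ring
      rw [h2]
  obtain ⟨f1, f2⟩ := key c e hp.lt hd' hc hp.cos_eq_zero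
  obtain ⟨f1', f2'⟩ := key c' e' hp'.lt (hd'.trans hd.symm) hc' hp'.cos_eq_zero
  have hP : 0 < Q ^ d := pow_pos hQ0 _
  set P := Q ^ d
  have g : ∀ x y : ℝ, |x + y| * Q ≤ 16 → |(|x| - |y|)| * Q ≤ 16 := fun x y hxy => by
    refine le_trans (mul_le_mul_of_nonneg_right ?_ hQ0.le) hxy
    have := abs_abs_sub_abs_le x (-y)
    rwa [abs_neg, sub_neg_eq_add] at this
  have g1 := g _ _ hle
  have g2 := g _ _ hle'
  rw [abs_mul, abs_mul, abs_mul, f1, f2, abs_of_pos hP] at g1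
  rw [abs_mul, abs_mul, abs_mul, f1', f2', abs_of_pos hP] at g2
  have hs : |τ| / 4 ≤ Real.sin (c' * |τ|) - Real.sin (c * |τ|) := by
    have h1 : (c : ℝ) + 1 ≤ c' := by exact_mod_cast hlt
    have h2 : c' * |τ| ≤ Y * |τ| := by gcongr
    have h3 : 0 ≤ Y * |τ| := by positivity
    refine quarter_le_sin_sub_sin hτ.le (by positivity) ?_ (by nlinarith)
    nlinarith
  have ht : (|Real.sin (c' * τ - d * ψ)| - |Real.sin (c * τ - d * ψ)|) * Q ≤ 7 := by
    refine le_trans ?_ hYτ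
    gcongr
    refine (abs_sub_abs_le_abs_sub _ _).trans ((Real.abs_sin_sub_sin_le _ _).trans ?_)
    rw [show c' * τ - d * ψ - (c * τ - d * ψ) = (c' - c : ℝ) * τ by ring, abs_mul]
    gcongr
    rw [abs_le]
    have h1 : (c' : ℝ) ≤ Y := by exact_mod_cast hc'
    have h2 : (c : ℝ) ≤ Y := by exact_mod_cast hc
    have h3 : (0 : ℝ) ≤ c := by positivity
    have h4 : (0 : ℝ) ≤ c' := by positivity
    constructor <;> linarith
  rw [← abs_of_pos hQ0, ← abs_mul, abs_le] at g1 g2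
  have hv1 : |v| * ((|Real.sin (c' * τ - d * ψ)| - |Real.sin (c * τ - d * ψ)|) * Q) ≤ 14 := by
    linarith [mul_le_mul_of_nonneg_left ht (abs_nonneg v), hv.2]
  have hu1 : |τ| / 4 * (P * Q) ≤
      |u| * ((Real.sin (c' * |τ|) - Real.sin (c * |τ|)) * (P * Q)) := by
    have h1 : |τ| / 4 * (P * Q) ≤ (Real.sin (c' * |τ|) - Real.sin (c * |τ|)) * (P * Q) := by
      gcongr
    have h2 : 0 ≤ |τ| / 4 * (P * Q) := by positivity
    exact h1.trans (le_mul_of_one_le_left (h2.trans h1) hu.1)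
  have hfin : |τ| / 4 * (P * Q) ≤ 46 := by linarith [g1.1, g2.2]
  have : P * |τ| * Q ≤ 184 := by linarith
  linarith [mul_lt_mul_of_pos_right hQY (mul_pos hP hτ)]

theorem eq_of_progression {Q ψ ψ₀ τ : ℝ} {Y : ℕ} (h : IsNearRational Q ψ ψ₀ τ Y) {e₁ e₂ e₃ : ℤ}
    (he : IsProgressionCoeff e₁ e₂ e₃) {a b c a' b' c' : ℕ} (hab : a < b) (hbc : b < c)
    (hc : c ≤ Y) (hab' : a' < b') (hbc' : b' < c') (hc' : c' ≤ Y)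
    (heq : e₁ * (Q ^ a * Real.cos (a * ψ)) + e₂ * (Q ^ b * Real.cos (b * ψ)) +
      e₃ * (Q ^ c * Real.cos (c * ψ)) = 0)
    (heq' : e₁ * (Q ^ a' * Real.cos (a' * ψ)) + e₂ * (Q ^ b' * Real.cos (b' * ψ)) +
      e₃ * (Q ^ c' * Real.cos (c' * ψ)) = 0)
    (ha : |Real.cos (a * ψ)| ^ 2 * Q < 1 ↔ |Real.cos (a' * ψ)| ^ 2 * Q < 1)
    (hb : |Real.cos (b * ψ)| ^ 2 * Q < 1 ↔ |Real.cos (b' * ψ)| ^ 2 * Q < 1) :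
    a = a' ∧ b = b' ∧ c = c' := by
  obtain ⟨l1, l2, l3⟩ := he.one_le_abs
  obtain ⟨u1, u2, u3, -⟩ := he.abs_cast_le
  obtain ⟨n1, n2, n3⟩ := he.ne_zero
  rw [h.abs_cos_sq_mul_lt_one_iff (by omega), h.abs_cos_sq_mul_lt_one_iff (by omega)] at ha hb
  have hp := h.isRegularPair he hab hbc hc heq
  have hp' := h.isRegularPair he hab' hbc' hc' heq'
  have huniq : ∀ {e e' : ℕ} {v : ℝ}, 1 ≤ |v| → |v| ≤ 2 → IsRegularPair Q ψ ψ₀ e c e₃ v →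
      IsRegularPair Q ψ ψ₀ e' c' e₃ v → e = e' ∧ c = c' := by
    intro e e' v v1 v2 r r'
    have h1 := r.index_le r' h hc hc' ⟨l3, u3⟩ ⟨v1, v2⟩
    have h2 := r'.index_le r h hc' hc ⟨l3, u3⟩ ⟨v1, v2⟩
    have h3 := r.sub_le_sub r' h hc hc' ⟨l3, u3⟩ ⟨v1, v2⟩
    have h4 := r'.sub_le_sub r h hc' hc ⟨l3, u3⟩ ⟨v1, v2⟩
    have h5 := r.lt
    have h6 := r'.lt
    omega
  by_cases hb0 : Real.cos (b * ψ₀) = 0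
  · obtain ⟨rfl, rfl⟩ := huniq l1 u1 (hp.2 hb0) (hp'.2 (hb.1 hb0))
    refine ⟨rfl, ?_, rfl⟩
    have h1 : Q ^ b * Real.cos (b * ψ) = Q ^ b' * Real.cos (b' * ψ) := by
      refine mul_left_cancel₀ (Int.cast_ne_zero.2 n2 : (e₂ : ℝ) ≠ 0) ?_
      linarith
    exact le_antisymm (h.le_of_pow_mul_cos_eq (by omega) (by omega) hb.symm h1.symm)
      (h.le_of_pow_mul_cos_eq (by omega) (by omega) hb h1)
  · obtain ⟨rfl, rfl⟩ := huniq l2 u2 (hp.1 hb0) (hp'.1 fun h1 => hb0 (hb.2 h1))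
    refine ⟨?_, rfl, rfl⟩
    have h1 : Q ^ a * Real.cos (a * ψ) = Q ^ a' * Real.cos (a' * ψ) := by
      refine mul_left_cancel₀ (Int.cast_ne_zero.2 n1 : (e₁ : ℝ) ≠ 0) ?_
      linarith
    exact le_antisymm (h.le_of_pow_mul_cos_eq (by omega) (by omega) ha.symm h1.symm)
      (h.le_of_pow_mul_cos_eq (by omega) (by omega) ha h1)

end IsNearRational

section ComplexRoots

open ComplexConjugate

variable {A B : ℤ} {α : ℂ}

theorem lucasV_eq_norm_pow_mul_cos (hs : α + conj α = A) (hp : α * conj α = -(B : ℂ)) (n : ℕ) :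
    (lucasV A B n : ℝ) = 2 * (‖α‖ ^ n * Real.cos (n * α.arg)) := by
  have h1 := lucasV_eq_pow_add_pow hs hp n
  rw [← map_pow, Complex.add_conj] at h1
  have h2 : (lucasV A B n : ℝ) = 2 * (α ^ n).re := by exact_mod_cast h1
  rw [h2]
  conv_lhs => rw [← Complex.norm_mul_cos_add_sin_mul_I α, mul_pow, Complex.cos_add_sin_mul_I_pow]
  rw [← Complex.ofReal_pow, Complex.re_ofReal_mul]
  have h3 : (n : ℂ) * (α.arg : ℂ) = ((n * α.arg : ℝ) : ℂ) := by push_cast; rfl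
  rw [h3, Complex.add_re, Complex.cos_ofReal_re, Complex.mul_I_re, Complex.sin_ofReal_im]
  simp

theorem lucasV_ne_zero (hB : B ≠ 0) (hs : α + conj α = A) (hp : α * conj α = -(B : ℂ))
    (hω : ∀ n : ℕ, 0 < n → (α / conj α) ^ n ≠ 1) (n : ℕ) : lucasV A B n ≠ 0 := by
  rcases Nat.eq_zero_or_pos n with rfl | hn
  · simp [lucasV]
  intro h0
  have h1 := lucasV_eq_pow_add_pow hs hp n
  rw [h0, Int.cast_zero] at h1
  refine hω (2 * n) (by omega) ?_
  have h2 : conj α ≠ 0 := (map_ne_zero _).2 (ne_zero_of_mul_conj hB hp)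
  rw [div_pow, div_eq_one_iff_eq (pow_ne_zero _ h2)]
  linear_combination (conj α ^ n - α ^ n) * h1

theorem pow_lt_norm_of_progression (hA : A ≠ 0) (hB : B ≠ 0) (hs : α + conj α = A)
    (hp : α * conj α = -(B : ℂ)) (hω : ∀ n : ℕ, 0 < n → (α / conj α) ^ n ≠ 1)
    (hex : (A, B) ≠ (-1, -2)) {e₁ e₂ e₃ : ℤ} (he : IsProgressionCoeff e₁ e₂ e₃) {a b c : ℕ}
    (hab : a < b) (hbc : b < c)
    (heq : e₁ * lucasV A B a + e₂ * lucasV A B b + e₃ * lucasV A B c = 0)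
    (hc : (2 ^ 38) ^ 60 ≤ c) : (c : ℝ) ^ 4 < ‖α‖ := by
  obtain ⟨M, hM, hcM, hcM'⟩ : ∃ M, 2 ^ 38 ≤ M ∧ M ^ 60 ≤ c ∧ c < (M + 1) ^ 60 := by
    have h0 : 2 ^ 38 ≤ c := le_trans (Nat.le_self_pow (by norm_num) _) hc
    refine ⟨Nat.findGreatest (fun M => M ^ 60 ≤ c) c, Nat.le_findGreatest h0 hc,
      Nat.findGreatest_spec (P := fun M => M ^ 60 ≤ c) h0 hc, ?_⟩
    by_contra! h
    have h1 := Nat.le_findGreatest (P := fun M => M ^ 60 ≤ c)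
      (le_trans (Nat.le_self_pow (by norm_num) _) h) h
    omega
  have h1 := succ_pow_le_two_mul_pow (le_trans (by norm_num) hM)
  have h2 : 2 ^ M < ‖α‖ := by
    by_contra! h
    exact no_progression_of_norm_le hA hB hs hp hω hex he hab hbc heq hM hcM (by omega) h
  have h3 : c ^ 4 ≤ 2 ^ M :=
    calc c ^ 4 ≤ (2 * M ^ 60) ^ 4 := Nat.pow_le_pow_left (by omega) 4
      _ = 16 * M ^ 240 := by ring
      _ ≤ M * M ^ 240 := Nat.mul_le_mul_right _ (le_trans (by norm_num) hM)
      _ = M ^ 241 := by ring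
      _ ≤ M ^ 249 := Nat.pow_le_pow_right (lt_of_lt_of_le (by norm_num) hM) (by norm_num)
      _ ≤ 2 ^ M := pow_le_two_pow_self hM
  refine lt_of_le_of_lt ?_ h2
  exact_mod_cast h3

theorem progression_eq_progression (hA : A ≠ 0) (hB : B ≠ 0) (hs : α + conj α = A)
    (hp : α * conj α = -(B : ℂ)) (hω : ∀ n : ℕ, 0 < n → (α / conj α) ^ n ≠ 1)
    (hex : (A, B) ≠ (-1, -2)) {e₁ e₂ e₃ : ℤ} (he : IsProgressionCoeff e₁ e₂ e₃)
    {a b c a' b' c' : ℕ} (hab : a < b) (hbc : b < c) (hab' : a' < b') (hbc' : b' < c')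
    (heq : e₁ * lucasV A B a + e₂ * lucasV A B b + e₃ * lucasV A B c = 0)
    (heq' : e₁ * lucasV A B a' + e₂ * lucasV A B b' + e₃ * lucasV A B c' = 0)
    (hc : (2 ^ 38) ^ 60 ≤ c) (hc' : (2 ^ 38) ^ 60 ≤ c')
    (ha : |Real.cos (a * α.arg)| ^ 2 * ‖α‖ < 1 ↔ |Real.cos (a' * α.arg)| ^ 2 * ‖α‖ < 1)
    (hb : |Real.cos (b * α.arg)| ^ 2 * ‖α‖ < 1 ↔ |Real.cos (b' * α.arg)| ^ 2 * ‖α‖ < 1) :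
    a = a' ∧ b = b' ∧ c = c' := by
  have hreal : ∀ {a b c : ℕ}, e₁ * lucasV A B a + e₂ * lucasV A B b + e₃ * lucasV A B c = 0 →
      e₁ * (‖α‖ ^ a * Real.cos (a * α.arg)) + e₂ * (‖α‖ ^ b * Real.cos (b * α.arg)) +
        e₃ * (‖α‖ ^ c * Real.cos (c * α.arg)) = 0 := by
    intro a b c h
    have h1 : (e₁ : ℝ) * lucasV A B a + e₂ * lucasV A B b + e₃ * lucasV A B c = 0 := by
      exact_mod_cast h
    rw [lucasV_eq_norm_pow_mul_cos hs hp, lucasV_eq_norm_pow_mul_cos hs hp,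
      lucasV_eq_norm_pow_mul_cos hs hp] at h1
    linarith
  have hnear : ∀ {a b c : ℕ}, a < b → b < c →
      e₁ * lucasV A B a + e₂ * lucasV A B b + e₃ * lucasV A B c = 0 → (2 ^ 38) ^ 60 ≤ c →
      ∃ ψ₀ τ, IsNearRational ‖α‖ α.arg ψ₀ τ c := by
    intro a b c hab hbc h hc
    have h1 := pow_lt_norm_of_progression hA hB hs hp hω hex he hab hbc h hc
    have hc1 : 2000 ≤ c := le_trans (by norm_num) hc
    have hcos : Real.cos (c * α.arg) ≠ 0 := fun h0 => by
      have h2 := lucasV_eq_norm_pow_mul_cos hs hp c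
      rw [h0, mul_zero, mul_zero] at h2
      exact lucasV_ne_zero hB hs hp hω c (by exact_mod_cast h2)
    have hQ1 : 1 ≤ ‖α‖ := by
      have h3 : (1 : ℝ) ≤ c := by exact_mod_cast (by omega : 1 ≤ c)
      exact (one_le_pow₀ h3).trans h1.le
    obtain ⟨ψ₀, τ, h2, -⟩ := exists_isNearRational hc1 h1 hcos
      (he.abs_cos_mul_le hQ1 hab hbc (hreal h))
    exact ⟨ψ₀, τ, h2⟩
  rcases le_total c c' with hcc | hcc
  · obtain ⟨ψ₀, τ, h⟩ := hnear hab' hbc' heq' hc'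
    exact h.eq_of_progression he hab hbc hcc hab' hbc' le_rfl (hreal heq) (hreal heq') ha hb
  · obtain ⟨ψ₀, τ, h⟩ := hnear hab hbc heq hc
    exact h.eq_of_progression he hab hbc le_rfl hab' hbc' hcc (hreal heq) (hreal heq') ha hb

end ComplexRoots

theorem finite_and_ncard_le_of_injOn {κ : Type*} [Fintype κ] {S : Set (ℕ × ℕ × ℕ)} (X : ℕ)
    (f : ℕ × ℕ × ℕ → κ) (hf : Set.InjOn f {p ∈ S | X ≤ max p.1 (max p.2.1 p.2.2)}) :
    S.Finite ∧ S.ncard ≤ X ^ 3 + Fintype.card κ := by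
  set E := {p ∈ S | X ≤ max p.1 (max p.2.1 p.2.2)} with hE
  set R : Set (ℕ × ℕ × ℕ) := ↑(Finset.range X ×ˢ Finset.range X ×ˢ Finset.range X) with hR
  have hEfin : E.Finite := Set.Finite.of_injOn (fun x _ => Set.mem_univ (f x)) hf Set.finite_univ
  have hRfin : R.Finite := Finset.finite_toSet _
  have hsub : S ⊆ R ∪ E := by
    intro p hp
    by_cases h : X ≤ max p.1 (max p.2.1 p.2.2)
    · exact Or.inr ⟨hp, h⟩
    · left
      simp only [hR, Finset.mem_coe, Finset.mem_product, Finset.mem_range]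
      omega
  have hEcard : E.ncard ≤ Fintype.card κ := by
    rw [← Nat.card_eq_fintype_card, ← Set.ncard_univ]
    exact Set.ncard_le_ncard_of_injOn f (fun x _ => Set.mem_univ _) hf Set.finite_univ
  have hRcard : R.ncard = X ^ 3 := by
    rw [hR, Set.ncard_coe_finset, Finset.card_product, Finset.card_product, Finset.card_range]
    ring
  refine ⟨(hRfin.union hEfin).subset hsub, ?_⟩
  calc S.ncard ≤ (R ∪ E).ncard := Set.ncard_le_ncard hsub (hRfin.union hEfin)
    _ ≤ R.ncard + E.ncard := Set.ncard_union_le _ _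
    _ ≤ _ := by omega

theorem injOn_of_complex_roots {A B : ℤ} {α : ℂ} (hA : A ≠ 0) (hB : B ≠ 0)
    (hs : α + starRingEnd ℂ α = A) (hp : α * starRingEnd ℂ α = -(B : ℂ))
    (hω : ∀ n : ℕ, 0 < n → (α / starRingEnd ℂ α) ^ n ≠ 1) (hex : (A, B) ≠ (-1, -2)) :
    Set.InjOn (fun p : ℕ × ℕ × ℕ => ((p.1 < p.2.1, p.2.1 < p.2.2, p.1 < p.2.2),
      (|Real.cos (p.1 * α.arg)| ^ 2 * ‖α‖ < 1, |Real.cos (p.2.1 * α.arg)| ^ 2 * ‖α‖ < 1,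
        |Real.cos (p.2.2 * α.arg)| ^ 2 * ‖α‖ < 1)))
      {p ∈ {p : ℕ × ℕ × ℕ | lucasV A B p.1 < lucasV A B p.2.1 ∧
        lucasV A B p.2.1 < lucasV A B p.2.2 ∧
        lucasV A B p.1 + lucasV A B p.2.2 = 2 * lucasV A B p.2.1} |
        (2 ^ 38) ^ 60 ≤ max p.1 (max p.2.1 p.2.2)} := by
  have key := @progression_eq_progression A B α hA hB hs hp hω hex
  generalize (2 ^ 38) ^ 60 = X at key ⊢
  rintro ⟨k, l, m⟩ ⟨⟨h1, h2, h3⟩, hX⟩ ⟨k', l', m'⟩ ⟨⟨h1', h2', h3'⟩, hX'⟩ h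
  simp only [Prod.mk.injEq, eq_iff_iff] at h h1 h2 h3 hX h1' h2' h3' hX' ⊢
  obtain ⟨⟨o1, o2, o3⟩, r1, r2, r3⟩ := h
  have n1 : k ≠ l := by rintro rfl; exact lt_irrefl _ h1
  have n2 : l ≠ m := by rintro rfl; exact lt_irrefl _ h2
  have n3 : k ≠ m := by rintro rfl; exact lt_irrefl _ (h1.trans h2)
  have n1' : k' ≠ l' := by rintro rfl; exact lt_irrefl _ h1'
  have n2' : l' ≠ m' := by rintro rfl; exact lt_irrefl _ h2'
  have n3' : k' ≠ m' := by rintro rfl; exact lt_irrefl _ (h1'.trans h2')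
  have o1' : l < k ↔ l' < k' := by omega
  have o2' : m < l ↔ m' < l' := by omega
  have o3' : m < k ↔ m' < k' := by omega
  have he : IsProgressionCoeff 1 1 (-2) := Or.inl ⟨rfl, rfl, rfl⟩
  have he' : IsProgressionCoeff 1 (-2) 1 := Or.inr (Or.inl ⟨rfl, rfl, rfl⟩)
  have he'' : IsProgressionCoeff (-2) 1 1 := Or.inr (Or.inr ⟨rfl, rfl, rfl⟩)
  rcases lt_or_gt_of_ne n1 with i1 | i1 <;> rcases lt_or_gt_of_ne n2 with i2 | i2 <;>
    rcases lt_or_gt_of_ne n3 with i3 | i3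
  · have := key he' i1 i2 (o1.1 i1) (o2.1 i2) (by linarith) (by linarith)
      (by omega) (by omega) r1 r2
    omega
  · omega
  · have := key he i3 i2 (o3.1 i3) (o2'.1 i2) (by linarith) (by linarith)
      (by omega) (by omega) r1 r3
    omega
  · have := key he i3 i1 (o3'.1 i3) (o1.1 i1) (by linarith) (by linarith)
      (by omega) (by omega) r3 r1
    omega
  · have := key he'' i1 i3 (o1'.1 i1) (o3.1 i3) (by linarith) (by linarith)
      (by omega) (by omega) r2 r1
    omega
  · have := key he'' i2 i3 (o2.1 i2) (o3'.1 i3) (by linarith) (by linarith)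
      (by omega) (by omega) r2 r3
    omega
  · omega
  · have := key he' i2 i1 (o2'.1 i2) (o1'.1 i1) (by linarith) (by linarith)
      (by omega) (by omega) r3 r2
    omega

section RealRoots

variable {w v : ℕ → ℤ} {a b c : ℕ} {e₁ e₂ e₃ : ℤ}

theorem natCast_le_of_lt_succ (h1 : 1 ≤ w 1) (hw : ∀ n, 1 ≤ n → w n < w (n + 1)) {n : ℕ}
    (hn : 1 ≤ n) : n ≤ w n := by
  induction n, hn using Nat.le_induction with
  | base => simpa using h1
  | succ n hn ih =>
    have := hw n hn
    push_cast
    omega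

theorem lt_of_lt_succ (hw : ∀ n, 1 ≤ n → w n < w (n + 1)) {m n : ℕ} (hm : 1 ≤ m) (hmn : m < n) :
    w m < w n := by
  induction n, hmn using Nat.le_induction with
  | base => exact hw m hm
  | succ n hn ih => exact ih.trans (hw n (by simp only [Nat.succ_eq_add_one] at hn; omega))

theorem lt_of_lt_of_three_le (h0 : w 0 = 2) (h1 : 1 ≤ w 1) (hw : ∀ n, 1 ≤ n → w n < w (n + 1))
    {m n : ℕ} (hmn : m < n) (hn : 3 ≤ n) : w m < w n := by
  rcases Nat.eq_zero_or_pos m with rfl | hm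
  · have := natCast_le_of_lt_succ h1 hw (by omega : 1 ≤ n)
    omega
  · exact lt_of_lt_succ hw hm hmn

/-- The possible shapes of a progression in a sequence which is increasing up to signs. -/
theorem IsProgressionCoeff.sign_cases (he : IsProgressionCoeff e₁ e₂ e₃)
    (h0 : w 0 = 2) (h1 : 1 ≤ w 1) (hw : ∀ n, 1 ≤ n → w n < w (n + 1))
    (hab : a < b) (hbc : b < c) (hc : 10 ≤ c)
    (hv : (∀ n, v n = w n) ∨ ∀ n, v n = (-1) ^ n * w n)
    (heq : e₁ * v a + e₂ * v b + e₃ * v c = 0) :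
    ((∀ n, v n = w n) ∧ w c + w a = 2 * w b) ∨
    (∀ n, v n = (-1) ^ n * w n) ∧ (b + 2 ≤ c ∧ w c ≤ 2 * w b + w a ∨
      a + 2 ≤ c ∧ (w c = 2 * w a + w b ∨ w c = 2 * w a - w b)) := by
  have ha := lt_of_lt_of_three_le h0 h1 hw (by omega : a < c) (by omega)
  have hb := lt_of_lt_of_three_le h0 h1 hw hbc (by omega)
  have hc' := natCast_le_of_lt_succ h1 hw (by omega : 1 ≤ c)
  have hpos : ∀ n, 0 < w n := fun n => by
    rcases Nat.eq_zero_or_pos n with rfl | hn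
    · omega
    · have := natCast_le_of_lt_succ h1 hw hn
      omega
  have pa := hpos a
  have pb := hpos b
  rcases hv with hv | hv
  · left
    refine ⟨hv, ?_⟩
    rw [hv, hv, hv] at heq
    have hab' : w a < w b ∨ w a = 2 := by
      rcases Nat.eq_zero_or_pos a with rfl | ha0
      · exact Or.inr h0
      · exact Or.inl (lt_of_lt_succ hw ha0 hab)
    rcases he with ⟨rfl, rfl, rfl⟩ | ⟨rfl, rfl, rfl⟩ | ⟨rfl, rfl, rfl⟩ <;> omega
  · right
    refine ⟨hv, ?_⟩
    rw [hv, hv, hv] at heq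
    rcases he with ⟨rfl, rfl, rfl⟩ | ⟨rfl, rfl, rfl⟩ | ⟨rfl, rfl, rfl⟩ <;>
    rcases Nat.even_or_odd a with ea | ea <;> rcases Nat.even_or_odd b with eb | eb <;>
    rcases Nat.even_or_odd c with ec | ec <;>
    rw [ea.neg_one_pow, eb.neg_one_pow, ec.neg_one_pow] at heq <;>
    obtain ⟨x, rfl⟩ := ea <;> obtain ⟨y, rfl⟩ := eb <;> obtain ⟨z, rfl⟩ := ec <;> omega

/-- A sequence which more than doubles in each step contains no progressions. -/
theorem no_progression_of_two_mul_lt (he : IsProgressionCoeff e₁ e₂ e₃)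
    (h0 : w 0 = 2) (h1 : 2 ≤ w 1) (hw : ∀ n, 1 ≤ n → 2 * w n < w (n + 1))
    (hab : a < b) (hbc : b < c) (hc : 10 ≤ c)
    (hv : (∀ n, v n = w n) ∨ ∀ n, v n = (-1) ^ n * w n)
    (heq : e₁ * v a + e₂ * v b + e₃ * v c = 0) : False := by
  have hpos : ∀ n, 1 ≤ n → 2 ≤ w n := by
    intro n hn
    induction n, hn using Nat.le_induction with
    | base => exact h1
    | succ n hn ih =>
      have := hw n hn
      omega
  have hw' : ∀ n, 1 ≤ n → w n < w (n + 1) := fun n hn => by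
    have := hw n hn
    have := hpos n hn
    omega
  have hab' : w a ≤ w b := by
    rcases Nat.eq_zero_or_pos a with rfl | ha0
    · exact h0 ▸ hpos b hab
    · exact (lt_of_lt_succ hw' ha0 hab).le
  have hle : ∀ {m n : ℕ}, 1 ≤ m → m ≤ n → w m ≤ w n := fun hm hmn => by
    rcases hmn.eq_or_lt with rfl | h
    · exact le_rfl
    · exact (lt_of_lt_succ hw' hm h).le
  have hdbl : ∀ {m n : ℕ}, 1 ≤ m → m < n → 2 * w m < w n := fun {m n} hm hmn =>
    (hw m hm).trans_le (hle (by omega) hmn)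
  have pb := hpos b (by omega)
  have hbc' := hdbl (by omega) hbc
  rcases he.sign_cases h0 (by omega) hw' hab hbc hc hv heq with
    ⟨-, h⟩ | ⟨-, ⟨h2, h⟩ | ⟨h2, h⟩⟩
  · have pa : 2 ≤ w a := by
      rcases Nat.eq_zero_or_pos a with rfl | ha0
      · exact h0.ge
      · exact hpos a ha0
    omega
  · have h3 := hdbl (by omega : 1 ≤ b) (by omega : b < b + 1)
    have h4 := hdbl (by omega : 1 ≤ b + 1) (by omega : b + 1 < c)
    omega
  · rcases Nat.eq_zero_or_pos a with rfl | ha0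
    · have h3 := natCast_le_of_lt_succ (by omega) hw' (by omega : 1 ≤ c)
      omega
    · have h3 := hdbl ha0 hab
      omega

theorem no_progression_of_eq_two_pow_add_one (he : IsProgressionCoeff e₁ e₂ e₃)
    (hw : ∀ n, w n = 2 ^ n + 1) (hab : a < b) (hbc : b < c) (hc : 10 ≤ c)
    (hv : (∀ n, v n = w n) ∨ ∀ n, v n = (-1) ^ n * w n)
    (heq : e₁ * v a + e₂ * v b + e₃ * v c = 0) : False := by
  have hpos : ∀ n, (0 : ℤ) < 2 ^ n := fun n => by positivity
  have hle : ∀ m n k : ℕ, m + k ≤ n → 2 ^ k * (2 : ℤ) ^ m ≤ 2 ^ n := fun m n k h => by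
    rw [← pow_add]
    exact pow_le_pow_right₀ (by norm_num) (by omega)
  have hw' : ∀ n, 1 ≤ n → w n < w (n + 1) := fun n _ => by
    rw [hw, hw, pow_succ]
    have := hpos n
    omega
  have pa := hpos a
  have hab' := hle a b 1 (by omega)
  have hbc' := hle b c 1 (by omega)
  have hc8 := hle 3 c 7 (by omega)
  norm_num at hc8
  rcases he.sign_cases (by simp [hw]) (by simp [hw]) hw' hab hbc hc hv heq with
    ⟨-, h⟩ | ⟨-, ⟨h2, h⟩ | ⟨h2, h⟩⟩
  · rw [hw, hw, hw] at h
    omega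
  · rw [hw, hw, hw] at h
    have h3 := hle b c 2 (by omega)
    omega
  · rw [hw, hw, hw] at h
    rcases Nat.lt_or_ge (b + 1) c with h3 | h3
    · have h4 := hle b c 2 (by omega)
      omega
    · rcases Nat.lt_or_ge (a + 2) c with h5 | h5
      · have h4 := hle a c 3 (by omega)
        omega
      · have h6 : c = a + 2 := by omega
        have h7 : b = a + 1 := by omega
        rw [h6, h7, pow_succ, pow_succ] at h
        omega

theorem lucasV_neg (A B : ℤ) (n : ℕ) : lucasV (-A) B n = (-1) ^ n * lucasV A B n := by
  induction n using Nat.twoStepInduction with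
  | zero => simp [lucasV]
  | one => simp [lucasV]
  | more n ih1 ih2 =>
    simp only [lucasV, ih1, ih2]
    ring

theorem lucasV_three_neg_two (n : ℕ) : lucasV 3 (-2) n = 2 ^ n + 1 := by
  induction n using Nat.twoStepInduction with
  | zero => simp [lucasV]
  | one => simp [lucasV]
  | more n ih1 ih2 =>
    simp only [lucasV, ih1, ih2]
    ring

theorem lucasV_one_two (n : ℕ) : lucasV 1 2 n = 2 ^ n + (-1) ^ n := by
  induction n using Nat.twoStepInduction with
  | zero => simp [lucasV]
  | one => simp [lucasV]
  | more n ih1 ih2 =>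
    simp only [lucasV, ih1, ih2]
    ring

theorem two_mul_lucasV_lt_of_pos {P B : ℤ} (hP : 2 ≤ P) (hB : 0 < B) {n : ℕ} (hn : 1 ≤ n) :
    2 * lucasV P B n < lucasV P B (n + 1) := by
  have hpos : ∀ n, 0 < lucasV P B n := fun n => by
    induction n using Nat.twoStepInduction with
    | zero => simp [lucasV]
    | one => simp only [lucasV]; omega
    | more n ih1 ih2 =>
      simp only [lucasV]
      have := mul_pos (by omega : 0 < P) ih2
      have := mul_pos hB ih1
      omega
  obtain ⟨m, rfl⟩ := Nat.exists_eq_add_of_le' hn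
  have h1 := hpos m
  have h2 := hpos (m + 1)
  simp only [lucasV]
  nlinarith

theorem two_mul_lucasV_lt_of_neg {P B : ℤ} (hP : 3 ≤ P) (hB : B < 0) (hd : 0 < P ^ 2 + 4 * B)
    (hPB : (P, B) ≠ (3, -2)) {n : ℕ} (hn : 1 ≤ n) :
    2 * lucasV P B n < lucasV P B (n + 1) := by
  by_cases hP4 : 4 ≤ P
  · have key : 0 < lucasV P B n ∧ P * lucasV P B n < 2 * lucasV P B (n + 1) := by
      induction n, hn using Nat.le_induction with
      | base => simp only [lucasV]; constructor <;> nlinarith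
      | succ n hn ih =>
        obtain ⟨h1, h2⟩ := ih
        have h3 : 0 < lucasV P B (n + 1) := by nlinarith
        refine ⟨h3, ?_⟩
        simp only [lucasV]
        nlinarith
    nlinarith
  · have hP3 : P = 3 := by omega
    subst hP3
    have hB1 : B = -1 := by
      have : B ≠ -2 := fun h => hPB (by rw [h])
      omega
    subst hB1
    have key : 0 < lucasV 3 (-1) n ∧ 2 * lucasV 3 (-1) n < lucasV 3 (-1) (n + 1) := by
      induction n, hn using Nat.le_induction with
      | base => simp [lucasV]
      | succ n hn ih =>
        simp only [lucasV] at ih ⊢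
        omega
    exact key.2

theorem no_progression_of_one (he : IsProgressionCoeff e₁ e₂ e₃) {B : ℤ} (hB : 2 ≤ B)
    (hv : (∀ n, v n = lucasV 1 B n) ∨ 3 ≤ B ∧ ∀ n, v n = (-1) ^ n * lucasV 1 B n)
    (hab : a < b) (hbc : b < c) (hc : 10 ≤ c)
    (heq : e₁ * v a + e₂ * v b + e₃ * v c = 0) : False := by
  have hpos : ∀ n, 0 < lucasV 1 B n := fun n => by
    induction n using Nat.twoStepInduction with
    | zero => simp [lucasV]
    | one => simp [lucasV]
    | more n ih1 ih2 =>
      simp only [lucasV]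
      have := mul_pos (by omega : 0 < B) ih1
      omega
  have hrec : ∀ n, lucasV 1 B (n + 2) = lucasV 1 B (n + 1) + B * lucasV 1 B n := fun n => by
    simp [lucasV]
  have hstep : ∀ n, 1 ≤ n → lucasV 1 B n < lucasV 1 B (n + 1) := fun n hn => by
    obtain ⟨m, rfl⟩ := Nat.exists_eq_add_of_le' hn
    rw [hrec]
    have := mul_pos (by omega : 0 < B) (hpos m)
    omega
  have h0 : lucasV 1 B 0 = 2 := rfl
  have h1 : 1 ≤ lucasV 1 B 1 := by simp [lucasV]
  have hlt := fun {m n : ℕ} => lt_of_lt_of_three_le (m := m) (n := n) h0 h1 hstep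
  obtain ⟨k, rfl⟩ : ∃ k, c = k + 5 := ⟨c - 5, by omega⟩
  have r0 := hrec k
  have r1 := hrec (k + 1)
  have r2 := hrec (k + 2)
  have r3 := hrec (k + 3)
  have hle3 : ∀ n, n ≤ k + 3 → lucasV 1 B n ≤ lucasV 1 B (k + 3) := fun n hn => by
    rcases hn.eq_or_lt with rfl | h
    · exact le_rfl
    · exact (hlt h (by omega)).le
  have hp0 := hpos k
  have hp1 := hpos (k + 1)
  have hp3 := hpos (k + 3)
  have hpa := hpos a
  rcases he.sign_cases h0 h1 hstep hab hbc hc (hv.imp_right And.right) heq with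
    ⟨hv', h⟩ | ⟨hv', h⟩
  · rcases Nat.lt_or_ge b (k + 4) with hb | hb
    · have h2 := hle3 b (by omega)
      have h3 := hlt (by omega : k + 3 < k + 4) (by omega)
      nlinarith
    · obtain rfl : b = k + 4 := by omega
      by_cases hB2 : B = 2
      · subst hB2
        have ha3 : a < 3 := by
          by_contra! ha
          have h3 : lucasV 1 2 3 ≤ lucasV 1 2 a := by
            rcases ha.eq_or_lt with rfl | h4
            · exact le_rfl
            · exact (hlt h4 (by omega)).le
          have h4 : lucasV 1 2 3 = 7 := by simp [lucasV]
          rw [lucasV_one_two (k + 4 + 1), lucasV_one_two (k + 4), pow_succ, pow_succ (-1 : ℤ)] at h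
          rcases neg_one_pow_eq_or ℤ (k + 4) with h5 | h5 <;> rw [h5] at h <;> omega
        rw [lucasV_one_two (k + 4 + 1), lucasV_one_two (k + 4), pow_succ, pow_succ (-1 : ℤ)] at h
        rcases neg_one_pow_eq_or ℤ (k + 4) with h5 | h5 <;> rw [h5] at h <;>
          interval_cases a <;> simp [lucasV] at h <;> omega
      · have h3 := hlt (by omega : k < k + 1 ) (by omega)
        have hB3 : 3 ≤ B := by omega
        have h4 : lucasV 1 B (k + 2) ≤ (1 + B) * lucasV 1 B (k + 1) := by nlinarith
        have h5 : (B - 1) * lucasV 1 B (k + 3) + lucasV 1 B a = B * lucasV 1 B (k + 2) := by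
          linarith
        rw [r1] at h5
        nlinarith [mul_nonneg (by nlinarith : 0 ≤ B ^ 2 - 2 * B - 1) hp1.le]
  · have hB3 : 3 ≤ B := by
      rcases hv with hv | hv
      · have h2 := hv 1
        rw [hv' 1] at h2
        norm_num [lucasV] at h2
      · exact hv.1
    have h4 : ∀ n < k + 4, lucasV 1 B n < lucasV 1 B (k + 4) := fun n hn => hlt hn (by omega)
    rcases h with ⟨h2, h⟩ | ⟨h2, h⟩
    · have h5 := hle3 b (by omega)
      have h6 := h4 a (by omega)
      nlinarith
    · have h5 := hle3 a (by omega)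
      have h6 : lucasV 1 B b ≤ lucasV 1 B (k + 4) := by
        rcases (by omega : b < k + 4 ∨ b = k + 4) with h7 | rfl
        · exact (h4 b h7).le
        · exact le_rfl
      have hpb := hpos b
      rcases h with h | h <;> nlinarith

end RealRoots

theorem no_progression_of_real_roots {A B : ℤ} (hA : A ≠ 0) (hB : B ≠ 0)
    (hd : 0 < A ^ 2 + 4 * B) (h1 : (A, B) ≠ (1, 1)) (h2 : (A, B) ≠ (-1, 1))
    (h3 : (A, B) ≠ (-1, 2)) {e₁ e₂ e₃ : ℤ} (he : IsProgressionCoeff e₁ e₂ e₃) {a b c : ℕ}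
    (hab : a < b) (hbc : b < c) (hc : 10 ≤ c)
    (heq : e₁ * lucasV A B a + e₂ * lucasV A B b + e₃ * lucasV A B c = 0) : False := by
  simp only [ne_eq, Prod.mk.injEq, not_and] at h1 h2 h3
  obtain ⟨P, hP, hAP⟩ : ∃ P : ℤ, 0 < P ∧ (A = P ∨ A = -P) :=
    ⟨|A|, abs_pos.2 hA, by rcases abs_choice A with h | h <;> rw [h] <;> simp⟩
  have hv : (∀ n, lucasV A B n = lucasV P B n) ∨
      ∀ n, lucasV A B n = (-1) ^ n * lucasV P B n := by
    rcases hAP with rfl | rfl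
    · exact Or.inl fun _ => rfl
    · exact Or.inr (lucasV_neg P B)
  have hsq : A ^ 2 = P ^ 2 := by rcases hAP with rfl | rfl <;> ring
  rw [hsq] at hd
  rcases lt_or_gt_of_ne hB with hB0 | hB0
  · have hP3 : 3 ≤ P := by nlinarith
    by_cases hPB : (P, B) = (3, -2)
    · obtain ⟨rfl, rfl⟩ := Prod.mk.inj hPB
      exact no_progression_of_eq_two_pow_add_one he lucasV_three_neg_two hab hbc hc hv heq
    · exact no_progression_of_two_mul_lt (w := lucasV P B) (v := lucasV A B) he rfl (by simp only [lucasV]; omega)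
        (fun n hn => two_mul_lucasV_lt_of_neg hP3 hB0 hd hPB hn) hab hbc hc hv heq
  · by_cases hP2 : 2 ≤ P
    · exact no_progression_of_two_mul_lt (w := lucasV P B) (v := lucasV A B) he rfl (by simp only [lucasV]; omega)
        (fun n hn => two_mul_lucasV_lt_of_pos hP2 hB0 hn) hab hbc hc hv heq
    · obtain rfl : P = 1 := by omega
      refine no_progression_of_one he (B := B) ?_ ?_ hab hbc hc heq
      · rcases hAP with h | h
        · have := h1 h
          omega
        · have := h2 h
          omega
      · rcases hAP with rfl | rfl
        · exact Or.inl fun _ => rfl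
        · exact Or.inr ⟨by have := h2 rfl; have := h3 rfl; omega, lucasV_neg 1 B⟩

theorem exists_sorted_progression {A B : ℤ} {k l m : ℕ} (h1 : lucasV A B k < lucasV A B l)
    (h2 : lucasV A B l < lucasV A B m) (h3 : lucasV A B k + lucasV A B m = 2 * lucasV A B l) :
    ∃ e₁ e₂ e₃ : ℤ, IsProgressionCoeff e₁ e₂ e₃ ∧ ∃ a b c : ℕ, a < b ∧ b < c ∧
      c = max k (max l m) ∧ e₁ * lucasV A B a + e₂ * lucasV A B b + e₃ * lucasV A B c = 0 := by
  have n1 : k ≠ l := by rintro rfl; exact lt_irrefl _ h1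
  have n2 : l ≠ m := by rintro rfl; exact lt_irrefl _ h2
  have n3 : k ≠ m := by rintro rfl; exact lt_irrefl _ (h1.trans h2)
  have he : IsProgressionCoeff 1 1 (-2) := Or.inl ⟨rfl, rfl, rfl⟩
  have he' : IsProgressionCoeff 1 (-2) 1 := Or.inr (Or.inl ⟨rfl, rfl, rfl⟩)
  have he'' : IsProgressionCoeff (-2) 1 1 := Or.inr (Or.inr ⟨rfl, rfl, rfl⟩)
  rcases lt_or_gt_of_ne n1 with i1 | i1 <;> rcases lt_or_gt_of_ne n2 with i2 | i2 <;>
    rcases lt_or_gt_of_ne n3 with i3 | i3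
  · exact ⟨_, _, _, he', k, l, m, i1, i2, by omega, by linarith⟩
  · omega
  · exact ⟨_, _, _, he, k, m, l, i3, i2, by omega, by linarith⟩
  · exact ⟨_, _, _, he, m, k, l, i3, i1, by omega, by linarith⟩
  · exact ⟨_, _, _, he'', l, k, m, i1, i3, by omega, by linarith⟩
  · exact ⟨_, _, _, he'', l, m, k, i2, i3, by omega, by linarith⟩
  · omega
  · exact ⟨_, _, _, he', m, l, k, i2, i1, by omega, by linarith⟩

theorem exists_conj_roots {A B : ℤ} (hd : A ^ 2 + 4 * B ≤ 0) :
    ∃ α : ℂ, α + starRingEnd ℂ α = A ∧ α * starRingEnd ℂ α = -(B : ℂ) := by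
  refine ⟨⟨A / 2, Real.sqrt (-(A ^ 2 + 4 * B)) / 2⟩, ?_, ?_⟩
  · rw [Complex.add_conj]
    push_cast
    ring
  · rw [Complex.mul_conj, Complex.normSq_mk]
    have h1 : (0 : ℝ) ≤ -(A ^ 2 + 4 * B) := by
      have : ((A ^ 2 + 4 * B : ℤ) : ℝ) ≤ 0 := by exact_mod_cast hd
      push_cast at this
      linarith
    have h2 := Real.mul_self_sqrt h1
    have h3 : (A / 2 : ℝ) * (A / 2) + Real.sqrt (-(A ^ 2 + 4 * B)) / 2 *
        (Real.sqrt (-(A ^ 2 + 4 * B)) / 2) = -B := by linarith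
    rw [h3]
    push_cast
    rfl

set_option exponentiation.threshold 10000 in
theorem pow_add_le_bound : ((2 ^ 38) ^ 60) ^ 3 + 64 ≤ 645 * 10 ^ 2338 := by
  have h1 : (2 : ℕ) ^ 6841 ≤ 10 ^ 2338 :=
    calc (2 : ℕ) ^ 6841 ≤ 2 ^ (3 * 2338) := Nat.pow_le_pow_right (by norm_num) (by norm_num)
      _ = 8 ^ 2338 := by rw [pow_mul]; norm_num
      _ ≤ 10 ^ 2338 := Nat.pow_le_pow_left (by norm_num) _
  have h2 : (2 : ℕ) ^ 6 ≤ 2 ^ 6840 := Nat.pow_le_pow_right (by norm_num) (by norm_num)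
  rw [← pow_mul, ← pow_mul]
  rw [pow_succ] at h1
  generalize (2 : ℕ) ^ 6840 = x at *
  generalize (10 : ℕ) ^ 2338 = y at *
  norm_num at *
  omega

theorem stmt_1 (A B : ℤ) (hA : A ≠ 0) (hB : B ≠ 0)
    (hnd : ∀ α β : ℂ, α + β = (A : ℂ) → α * β = -(B : ℂ) →
      ∀ n : ℕ, 0 < n → (α / β) ^ n ≠ 1)
    (h1 : (A, B) ≠ (1, 1)) (h2 : (A, B) ≠ (-1, 1))
    (h3 : (A, B) ≠ (-1, 2)) (h4 : (A, B) ≠ (-1, -2)) :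
    {p : ℕ × ℕ × ℕ | lucasV A B p.1 < lucasV A B p.2.1 ∧
        lucasV A B p.2.1 < lucasV A B p.2.2 ∧
        lucasV A B p.1 + lucasV A B p.2.2 = 2 * lucasV A B p.2.1}.Finite ∧
    {p : ℕ × ℕ × ℕ | lucasV A B p.1 < lucasV A B p.2.1 ∧
        lucasV A B p.2.1 < lucasV A B p.2.2 ∧
        lucasV A B p.1 + lucasV A B p.2.2 = 2 * lucasV A B p.2.1}.ncard
      ≤ 645 * 10 ^ 2338 := by
  rcases le_or_gt (A ^ 2 + 4 * B) 0 with hd | hd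
  · obtain ⟨α, hs, hp⟩ := exists_conj_roots hd
    obtain ⟨hfin, hcard⟩ := finite_and_ncard_le_of_injOn ((2 ^ 38) ^ 60) _
      (injOn_of_complex_roots hA hB hs hp (hnd α _ hs hp) h4)
    refine ⟨hfin, hcard.trans (le_trans ?_ pow_add_le_bound)⟩
    simp only [Fintype.card_prod, Fintype.card_prop]
    rfl
  · obtain ⟨hfin, hcard⟩ := finite_and_ncard_le_of_injOn 10 (fun _ => ())
      (S := {p : ℕ × ℕ × ℕ | lucasV A B p.1 < lucasV A B p.2.1 ∧
        lucasV A B p.2.1 < lucasV A B p.2.2 ∧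
        lucasV A B p.1 + lucasV A B p.2.2 = 2 * lucasV A B p.2.1})
      (by
        rintro p ⟨⟨i1, i2, i3⟩, hX⟩
        obtain ⟨e₁, e₂, e₃, he, a, b, c, hab, hbc, hc, heq⟩ := exists_sorted_progression i1 i2 i3
        exact (no_progression_of_real_roots hA hB hd h1 h2 h3 he hab hbc (hc ▸ hX) heq).elim)
    refine ⟨hfin, hcard.trans (le_trans ?_ pow_add_le_bound)⟩
    simp only [Fintype.card_unit]
    refine Nat.add_le_add ?_ (by norm_num)
    exact Nat.pow_le_pow_left (le_trans (by norm_num) (Nat.le_self_pow (by norm_num) (2 ^ 38))) 3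
end

section
/- Let (A,B) be one of the pairs (1,1), (-1,1), (1,2), (-1,2), (-1,-2), and let u be the Lucas sequence of the first kind corresponding to (A,B). Then the set of triples (k,l,m) of nonnegative integers such that u_k < u_l < u_m and u_k + u_m = 2·u_l is infinite. -/
/-- Lucas sequence of the first kind for parameters `A`, `B`:
`u 0 = 0`, `u 1 = 1`, `u (n+2) = A * u (n+1) + B * u n`. -/
def lucasU (A B : ℤ) : ℕ → ℤ
  | 0 => 0
  | 1 => 1
  | n + 2 => A * lucasU A B (n + 1) + B * lucasU A B n

lemma lucasU_add_two (A B : ℤ) (n : ℕ) :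
    lucasU A B (n + 2) = A * lucasU A B (n + 1) + B * lucasU A B n := by
  rw [lucasU]

/-- A set of triples of naturals whose middle entries are unbounded is infinite. -/
lemma infinite_of_forall_exists_middle_gt {S : Set (ℕ × ℕ × ℕ)}
    (h : ∀ N, ∃ k l m, (k, l, m) ∈ S ∧ N < l) : S.Infinite := by
  refine Set.Infinite.of_image (fun p => p.2.1) (Set.infinite_of_forall_exists_gt fun N => ?_)
  obtain ⟨k, l, m, hS, hl⟩ := h N
  exact ⟨l, ⟨_, hS, rfl⟩, hl⟩

lemma lucasU_one_one_pos (n : ℕ) : 0 ≤ lucasU 1 1 n ∧ 0 < lucasU 1 1 (n + 1) := by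
  induction n with
  | zero => simp [lucasU]
  | succ n ih =>
    have := lucasU_add_two 1 1 n
    exact ⟨ih.2.le, by linarith⟩

lemma lucasU_neg_one_one_sign (j : ℕ) :
    lucasU (-1) 1 (2 * j) ≤ 0 ∧ 0 < lucasU (-1) 1 (2 * j + 1) := by
  induction j with
  | zero => simp [lucasU]
  | succ j ih =>
    have h₂ := lucasU_add_two (-1) 1 (2 * j)
    have h₃ := lucasU_add_two (-1) 1 (2 * j + 1)
    simp only [mul_add, mul_one, add_assoc, Nat.reduceAdd] at *
    constructor <;> linarith

lemma lucasU_one_two_even (j : ℕ) :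
    lucasU 1 2 (2 * j + 4) = 2 * lucasU 1 2 (2 * j + 3) - 1 ∧ 1 < lucasU 1 2 (2 * j + 3) := by
  induction j with
  | zero => simp [lucasU]
  | succ j ih =>
    have h₅ := lucasU_add_two 1 2 (2 * j + 3)
    have h₆ := lucasU_add_two 1 2 (2 * j + 4)
    simp only [mul_add, mul_one, add_assoc, Nat.reduceAdd] at *
    constructor <;> linarith

lemma lucasU_neg_one_two_sign (j : ℕ) :
    0 < lucasU (-1) 2 (2 * j + 1) ∧ lucasU (-1) 2 (2 * j + 2) < 0 := by
  induction j with
  | zero => simp [lucasU]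
  | succ j ih =>
    have h₃ := lucasU_add_two (-1) 2 (2 * j + 1)
    have h₄ := lucasU_add_two (-1) 2 (2 * j + 2)
    simp only [mul_add, mul_one, add_assoc, Nat.reduceAdd] at *
    constructor <;> linarith

lemma lucasU_neg_one_neg_two_odd (n : ℕ) : Odd (lucasU (-1) (-2) (n + 1)) := by
  induction n with
  | zero => simp [lucasU]
  | succ n ih =>
    rw [lucasU_add_two]
    obtain ⟨c, hc⟩ := ih
    exact ⟨-c - 1 - lucasU (-1) (-2) n, by rw [hc]; ring⟩

lemma lucasU_neg_one_neg_two_exists_ne (N : ℕ) :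
    ∃ n, N < n ∧ lucasU (-1) (-2) (n + 1) ≠ lucasU (-1) (-2) n := by
  by_cases h : lucasU (-1) (-2) (N + 2) = lucasU (-1) (-2) (N + 1)
  · refine ⟨N + 2, by omega, ?_⟩
    have := lucasU_add_two (-1) (-2) (N + 1)
    obtain ⟨c, hc⟩ := lucasU_neg_one_neg_two_odd N
    simp only [add_assoc, Nat.reduceAdd] at *
    omega
  · exact ⟨N + 1, by omega, h⟩

theorem stmt_2 (A B : ℤ)
    (h : (A, B) = (1, 1) ∨ (A, B) = (-1, 1) ∨ (A, B) = (1, 2) ∨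
      (A, B) = (-1, 2) ∨ (A, B) = (-1, -2)) :
    {p : ℕ × ℕ × ℕ | lucasU A B p.1 < lucasU A B p.2.1 ∧
        lucasU A B p.2.1 < lucasU A B p.2.2 ∧
        lucasU A B p.1 + lucasU A B p.2.2 = 2 * lucasU A B p.2.1}.Infinite := by
  simp only [Prod.mk.injEq] at h
  refine infinite_of_forall_exists_middle_gt fun N => ?_
  simp only [Set.mem_ofPred_eq]
  rcases h with ⟨rfl, rfl⟩ | ⟨rfl, rfl⟩ | ⟨rfl, rfl⟩ | ⟨rfl, rfl⟩ | ⟨rfl, rfl⟩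
  · have h₂ := lucasU_add_two 1 1 N
    have h₃ := lucasU_add_two 1 1 (N + 1)
    have hpos := lucasU_one_one_pos N
    simp only [add_assoc, Nat.reduceAdd] at *
    exact ⟨N, N + 2, N + 3, by omega, by omega⟩
  · have h₂ := lucasU_add_two (-1) 1 (2 * N)
    have h₃ := lucasU_add_two (-1) 1 (2 * N + 1)
    have hsign := lucasU_neg_one_one_sign N
    simp only [add_assoc, Nat.reduceAdd] at *
    exact ⟨2 * N, 2 * N + 1, 2 * N + 3, by omega, by omega⟩
  · have heven := lucasU_one_two_even N
    have h₁ : lucasU 1 2 1 = 1 := by simp [lucasU]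
    exact ⟨1, 2 * N + 3, 2 * N + 4, by omega, by omega⟩
  · have h₃ := lucasU_add_two (-1) 2 (2 * N + 1)
    have hsign := lucasU_neg_one_two_sign N
    simp only [add_assoc, Nat.reduceAdd] at *
    exact ⟨2 * N + 2, 2 * N + 1, 2 * N + 3, by omega, by omega⟩
  · obtain ⟨n, hn, hne⟩ := lucasU_neg_one_neg_two_exists_ne N
    have h₂ := lucasU_add_two (-1) (-2) n
    have h₃ := lucasU_add_two (-1) (-2) (n + 1)
    simp only [add_assoc, Nat.reduceAdd] at *
    rcases lt_or_gt_of_ne hne with hlt | hgt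
    · exact ⟨n + 1, n, n + 3, by omega, hn⟩
    · exact ⟨n + 3, n, n + 1, by omega, hn⟩
end

section
/- Let (A,B) be one of the pairs (1,1), (-1,1), (-1,2), (-1,-2), and let v be the Lucas sequence of the second kind corresponding to (A,B). Then the set of triples (k,l,m) of nonnegative integers such that v_k < v_l < v_m and v_k + v_m = 2·v_l is infinite. -/
theorem lucasV_add_two (A B : ℤ) (n : ℕ) :
    lucasV A B (n + 2) = A * lucasV A B (n + 1) + B * lucasV A B n := by
  rw [lucasV]

theorem lucasV_one_one_pos (n : ℕ) : 0 < lucasV 1 1 n ∧ 0 < lucasV 1 1 (n + 1) := by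
  induction n with
  | zero => simp [lucasV]
  | succ n ih =>
    have h := lucasV_add_two 1 1 n
    exact ⟨ih.2, by rw [h]; linarith [ih.1, ih.2]⟩

theorem lucasV_neg_one_one_sign (j : ℕ) :
    0 < lucasV (-1) 1 (2 * j) ∧ lucasV (-1) 1 (2 * j + 1) < 0 := by
  induction j with
  | zero => simp [lucasV]
  | succ j ih =>
    have h₀ := lucasV_add_two (-1) 1 (2 * j)
    have h₁ := lucasV_add_two (-1) 1 (2 * j + 1)
    simp only [mul_add, mul_one, add_assoc, Nat.reduceAdd] at *
    constructor <;> linarith [ih.1, ih.2]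

theorem lucasV_neg_one_two_bounds (j : ℕ) :
    1 < lucasV (-1) 2 (2 * j) ∧ lucasV (-1) 2 (2 * j + 1) < 1 := by
  induction j with
  | zero => simp [lucasV]
  | succ j ih =>
    have h₀ := lucasV_add_two (-1) 2 (2 * j)
    have h₁ := lucasV_add_two (-1) 2 (2 * j + 1)
    simp only [mul_add, mul_one, add_assoc, Nat.reduceAdd] at *
    constructor <;> linarith [ih.1, ih.2]

theorem lucasV_neg_one_neg_two_emod_three (j : ℕ) :
    lucasV (-1) (-2) (8 * j + 1) % 3 = 2 ∧ lucasV (-1) (-2) (8 * j + 2) % 3 = 0 := by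
  induction j with
  | zero => simp [lucasV]
  | succ j ih =>
    have h := fun i => lucasV_add_two (-1) (-2) (8 * j + i)
    have h₁ := h 1
    have h₂ := h 2
    have h₃ := h 3
    have h₄ := h 4
    have h₅ := h 5
    have h₆ := h 6
    have h₇ := h 7
    have h₈ := h 8
    clear h
    simp only [mul_add, mul_one, add_assoc, Nat.reduceAdd] at *
    omega

theorem stmt_3 (A B : ℤ)
    (h : (A, B) = (1, 1) ∨ (A, B) = (-1, 1) ∨ (A, B) = (-1, 2) ∨
      (A, B) = (-1, -2)) :
    {p : ℕ × ℕ × ℕ | lucasV A B p.1 < lucasV A B p.2.1 ∧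
        lucasV A B p.2.1 < lucasV A B p.2.2 ∧
        lucasV A B p.1 + lucasV A B p.2.2 = 2 * lucasV A B p.2.1}.Infinite := by
  simp only [Prod.mk.injEq] at h
  obtain ⟨rfl, rfl⟩ | ⟨rfl, rfl⟩ | ⟨rfl, rfl⟩ | ⟨rfl, rfl⟩ := h
  · refine Set.infinite_of_injective_forall_mem (f := fun n : ℕ => (n, n + 2, n + 3))
      (fun a b hab => (Prod.mk.inj hab).1) fun n => ?_
    have h₀ := lucasV_add_two 1 1 n
    have h₁ := lucasV_add_two 1 1 (n + 1)
    have hpos := lucasV_one_one_pos n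
    simp only [Set.mem_ofPred_eq, add_assoc, Nat.reduceAdd] at *
    omega
  · refine Set.infinite_of_injective_forall_mem
      (f := fun j : ℕ => (2 * j + 1, 2 * j + 2, 2 * j + 4))
      (fun a b hab => by have := (Prod.mk.inj hab).1; omega) fun j => ?_
    have h₀ := lucasV_add_two (-1) 1 (2 * j)
    have h₁ := lucasV_add_two (-1) 1 (2 * j + 1)
    have h₂ := lucasV_add_two (-1) 1 (2 * j + 2)
    have hsign := lucasV_neg_one_one_sign j
    simp only [Set.mem_ofPred_eq, add_assoc, Nat.reduceAdd] at *
    omega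
  · refine Set.infinite_of_injective_forall_mem
      (f := fun j : ℕ => (2 * j + 1, 2 * j, 2 * j + 2))
      (fun a b hab => by have := (Prod.mk.inj hab).1; omega) fun j => ?_
    have h₀ := lucasV_add_two (-1) 2 (2 * j)
    have hbounds := lucasV_neg_one_two_bounds j
    simp only [Set.mem_ofPred_eq] at *
    omega
  · refine Set.infinite_of_injective_forall_mem
      (f := fun j : ℕ =>
        if lucasV (-1) (-2) (8 * j + 2) < lucasV (-1) (-2) (8 * j + 1) then
          (8 * j + 2, 8 * j + 1, 8 * j + 4)
        else (8 * j + 4, 8 * j + 1, 8 * j + 2))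
      (fun a b hab => ?_) fun j => ?_
    · have hmid := congrArg (fun p : ℕ × ℕ × ℕ => p.2.1) hab
      simp only [apply_ite (fun p : ℕ × ℕ × ℕ => p.2.1), ite_self] at hmid
      omega
    · have h₁ := lucasV_add_two (-1) (-2) (8 * j + 1)
      have h₂ := lucasV_add_two (-1) (-2) (8 * j + 2)
      have hmod := lucasV_neg_one_neg_two_emod_three j
      simp only [add_assoc, Nat.reduceAdd] at h₁ h₂
      split_ifs with hlt <;> simp only [Set.mem_ofPred_eq] <;> omega
end
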